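/- arXiv:1510.05016 — 5 statements merged into one kernel-verified Lean document; each statement's English description precedes it below -/
import Mathlib

section
/- Let K be an algebraically closed field of characteristic 0 and let d, n ≥ 2 be integers. Define c_1(d,2) := 2d^4 and recursively c_1(d,m) := c_1(d,m-1) · 2d^{4·c_1(d,m-1)} for m ≥ 3. Let f_1,…,f_n ∈ K[x] be disintegrated polynomials of degree at most d such that f_i ≈ f_j for all i, j. Then there exist a positive integer N ≤ c_1(d,n) and a polynomial θ ∈ K[x] that is semiconjugate to f_i^{∘N} for every 1 ≤ i ≤ n. -/
open Polynomial

/-- The Chebyshev polynomial `T_n` satisfying `T_n(x + 1/x) = x^n + 1/x^n`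
(the Dickson polynomial of the first kind with parameter 1). -/
noncomputable def cheb (K : Type*) [CommRing K] (n : ℕ) : K[X] :=
  Polynomial.dickson 1 1 n

/-- The `n`-fold compositional iterate of a polynomial. -/
noncomputable def polyIter {K : Type*} [CommRing K] (f : K[X]) : ℕ → K[X]
  | 0 => X
  | n + 1 => f.comp (polyIter f n)

/-- `f` is linearly conjugate to `g`, i.e. `f = ℓ ∘ g ∘ ℓ⁻¹` for a degree-1 polynomial `ℓ`. -/
def LinConj {K : Type*} [CommRing K] (f g : K[X]) : Prop :=
  ∃ ℓ ℓi : K[X], ℓ.degree = 1 ∧ ℓi.degree = 1 ∧ ℓ.comp ℓi = X ∧ ℓi.comp ℓ = X ∧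
    f = ℓ.comp (g.comp ℓi)

/-- A polynomial is disintegrated if it has degree `δ ≥ 2` and is not linearly conjugate
to `x^δ` or `±T_δ(x)`. -/
def Disintegrated {K : Type*} [CommRing K] (f : K[X]) : Prop :=
  2 ≤ f.natDegree ∧ ¬ LinConj f (X ^ f.natDegree) ∧
    ¬ LinConj f (cheb K f.natDegree) ∧ ¬ LinConj f (-(cheb K f.natDegree))

/-- `η` (of degree at least 2) is semiconjugate to `f` if `f ∘ p = p ∘ η` for some
non-constant polynomial `p`. -/
def SemiconjTo {K : Type*} [CommRing K] (η f : K[X]) : Prop :=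
  ∃ p : K[X], 0 < p.natDegree ∧ f.comp p = p.comp η

/-- `f ≈ g`: there exist `N ≥ 1` and a polynomial `η` (of degree at least 2) semiconjugate
to both `f^{∘N}` and `g^{∘N}`. -/
def PolyApprox {K : Type*} [CommRing K] (f g : K[X]) : Prop :=
  ∃ N : ℕ, 1 ≤ N ∧ ∃ η : K[X], 2 ≤ η.natDegree ∧
    SemiconjTo η (polyIter f N) ∧ SemiconjTo η (polyIter g N)

/-- The constant `c₁(d, n)`: `c₁(d,2) = 2d⁴` and
`c₁(d,m) = c₁(d,m-1) · 2d^{4·c₁(d,m-1)}` for `m ≥ 3`. -/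
def c₁ (d : ℕ) : ℕ → ℕ
  | 0 => 2 * d ^ 4
  | 1 => 2 * d ^ 4
  | 2 => 2 * d ^ 4
  | m + 3 => c₁ d (m + 2) * (2 * d ^ (4 * c₁ d (m + 2)))


section PartOne

variable {K : Type*} [Field K]

lemma polyIter_natDegree (f : K[X]) (n : ℕ) : (polyIter f n).natDegree = f.natDegree ^ n := by
  induction n with
  | zero => simp [polyIter]
  | succ n ih => rw [polyIter, natDegree_comp, ih, pow_succ, mul_comm]

lemma polyIter_add (f : K[X]) (a b : ℕ) :
    polyIter f (a + b) = (polyIter f a).comp (polyIter f b) := by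
  induction a with
  | zero => simp [polyIter]
  | succ a ih => rw [Nat.succ_add, polyIter, ih, polyIter, comp_assoc]

lemma polyIter_one (f : K[X]) : polyIter f 1 = f := by simp [polyIter]

lemma polyIter_mul (f : K[X]) (a b : ℕ) :
    polyIter f (a * b) = polyIter (polyIter f a) b := by
  induction b with
  | zero => simp [polyIter]
  | succ b ih => rw [Nat.mul_succ, add_comm, polyIter_add, ih, polyIter]

lemma polyIter_succ_right (f : K[X]) (n : ℕ) :
    polyIter f (n + 1) = (polyIter f n).comp f := by
  rw [polyIter_add, polyIter_one]

lemma semiconj_iter {f g p : K[X]} (h : f.comp p = p.comp g) (k : ℕ) :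
    (polyIter f k).comp p = p.comp (polyIter g k) := by
  induction k with
  | zero => simp [polyIter]
  | succ k ih => rw [polyIter, polyIter, comp_assoc, ih, ← comp_assoc, h, comp_assoc]

lemma semiconj_iter_dvd {f g p : K[X]} {a b : ℕ}
    (h : (polyIter f a).comp p = p.comp (polyIter g a)) (hab : a ∣ b) :
    (polyIter f b).comp p = p.comp (polyIter g b) := by
  obtain ⟨c, rfl⟩ := hab
  rw [polyIter_mul, polyIter_mul]
  exact semiconj_iter h c

lemma polyIter_comm (f : K[X]) (n : ℕ) : (polyIter f n).comp f = f.comp (polyIter f n) := by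
  rw [← polyIter_succ_right, polyIter]

lemma comp_right_cancel {a b h : K[X]} (hh : 0 < h.natDegree) (e : a.comp h = b.comp h) :
    a = b := by
  have : (a - b).comp h = 0 := by rw [sub_comp, e, sub_self]
  rcases comp_eq_zero_iff.1 this with h0 | ⟨_, h1⟩
  · exact sub_eq_zero.1 h0
  · rw [h1] at hh; simp at hh

/-- geometric sums -/
def geoS (D k : ℕ) : ℕ := ∑ i ∈ Finset.range k, D ^ i

lemma geoS_succ (D k : ℕ) : geoS D (k + 1) = D * geoS D k + 1 := by
  unfold geoS
  rw [Finset.sum_range_succ', Finset.mul_sum]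
  simp [pow_succ, mul_comm]

lemma geoS_add (D a b : ℕ) : geoS D (a + b) = geoS D a + D ^ a * geoS D b := by
  unfold geoS
  rw [Finset.sum_range_add, Finset.mul_sum]
  simp [pow_add]

lemma exists_geoS_dvd (D r : ℕ) (hr : 0 < r) (hc : Nat.Coprime r D) :
    ∃ k, 1 ≤ k ∧ k ≤ r ∧ r ∣ geoS D k := by
  have : ∃ a ∈ Finset.range (r + 1), ∃ b ∈ Finset.range (r + 1), a ≠ b ∧
      geoS D a % r = geoS D b % r := by
    apply Finset.exists_ne_map_eq_of_card_lt_of_maps_to (t := Finset.range r)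
    · simp
    · intro a _
      simpa using Nat.mod_lt _ hr
  obtain ⟨a, ha, b, hb, hab, h⟩ := this
  have key : ∀ a b, a < b → b < r + 1 → geoS D a % r = geoS D b % r →
      ∃ k, 1 ≤ k ∧ k ≤ r ∧ r ∣ geoS D k := by
    intro a b hab hb h
    refine ⟨b - a, by omega, by omega, ?_⟩
    have h1 := geoS_add D a (b - a)
    rw [show a + (b - a) = b by omega] at h1
    have h2 : r ∣ geoS D b - geoS D a := (Nat.modEq_iff_dvd' (by omega)).1 h
    rw [h1, Nat.add_sub_cancel_left] at h2
    exact (Nat.Coprime.pow_right a hc).dvd_of_dvd_mul_left h2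
  rw [Finset.mem_range] at ha hb
  rcases lt_or_gt_of_ne hab with h' | h'
  · exact key a b h' hb h
  · exact key b a h' ha h.symm

/-- twisted semiconjugacies and iteration -/
lemma twist_iter {f g p : K[X]} {τ : K} {D : ℕ} (h : f.comp p = C τ * p.comp g)
    (hf : f.comp (C τ * X) = C (τ ^ D) * f) (k : ℕ) :
    (polyIter f k).comp p = C (τ ^ geoS D k) * p.comp (polyIter g k) := by
  have hf' : ∀ e : ℕ, f.comp (C (τ ^ e) * X) = C (τ ^ (D * e)) * f := by
    intro e
    induction e with
    | zero => simp
    | succ e ih =>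
      have : (C (τ ^ (e + 1)) * X : K[X]) = (C (τ ^ e) * X).comp (C τ * X) := by
        simp [pow_succ, mul_assoc]
      rw [this, ← comp_assoc, ih, C_mul_comp, hf, ← mul_assoc, ← C_mul]
      ring_nf
  induction k with
  | zero => simp [polyIter, geoS]
  | succ k ih =>
    have : (C (τ ^ geoS D k) * p.comp (polyIter g k)) =
        (C (τ ^ geoS D k) * X).comp (p.comp (polyIter g k)) := by simp
    rw [polyIter, comp_assoc, ih, this, ← comp_assoc, hf', C_mul_comp, ← comp_assoc, h,
      C_mul_comp, comp_assoc, ← mul_assoc, ← C_mul, geoS_succ, pow_succ]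
    rfl

end PartOne

section PartTwo

variable {K : Type*} [Field K]

/-- monic and centered of degree `n` -/
def Cen (f : K[X]) (n : ℕ) : Prop := (f - X ^ n).degree < ((n - 1 : ℕ) : WithBot ℕ)

lemma Cen.natDegree {f : K[X]} {n : ℕ} (h : Cen f n) : f.natDegree = n := by
  have : f = X ^ n + (f - X ^ n) := by ring
  rw [this]
  apply natDegree_eq_of_degree_eq_some
  rw [degree_add_eq_left_of_degree_lt]
  · simp
  · rw [degree_X_pow]
    exact lt_of_lt_of_le h (by exact_mod_cast Nat.sub_le n 1)

lemma Cen.monic {f : K[X]} {n : ℕ} (h : Cen f n) : f.Monic := by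
  have : f = X ^ n + (f - X ^ n) := by ring
  rw [this]
  apply (monic_X_pow n).add_of_left
  rw [degree_X_pow]
  exact lt_of_lt_of_le h (by exact_mod_cast Nat.sub_le n 1)

lemma natDegree_lt_of_ne {r : K[X]} {n : ℕ} (h : r.degree < (n : WithBot ℕ)) (h0 : r ≠ 0) :
    r.natDegree < n := (natDegree_lt_iff_degree_lt h0).2 h

lemma degree_lt_of_natDegree {r : K[X]} {n : ℕ} (h : r ≠ 0 → r.natDegree < n) :
    r.degree < (n : WithBot ℕ) := by
  by_cases h0 : r = 0
  · rw [h0, degree_zero]; exact WithBot.bot_lt_coe n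
  · exact (natDegree_lt_iff_degree_lt h0).1 (h h0)

lemma Cen.comp {f g : K[X]} {n k : ℕ} (hn : 1 ≤ n) (hk : 1 ≤ k) (hf : Cen f n) (hg : Cen g k) :
    Cen (f.comp g) (n * k) := by
  have hgd := hg.natDegree
  have e : f.comp g - X ^ (n * k) = (f - X ^ n).comp g + (g ^ n - (X ^ k) ^ n) := by
    simp only [sub_comp, X_pow_comp]; ring
  unfold Cen
  rw [e]
  refine lt_of_le_of_lt (degree_add_le _ _) (max_lt ?_ ?_)
  · apply degree_lt_of_natDegree
    intro h0
    have h1 : f - X ^ n ≠ 0 := by rintro h; rw [h] at h0; simp at h0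
    have h2 := natDegree_lt_of_ne hf h1
    rw [natDegree_comp, hgd]
    obtain ⟨n, rfl⟩ : ∃ n', n = n' + 1 := ⟨n - 1, by omega⟩
    simp only [Nat.add_sub_cancel] at h2
    have h3 : (f - X ^ (n + 1)).natDegree * k ≤ (n - 1) * k := Nat.mul_le_mul_right _ (by omega)
    have h4 : (n - 1) * k + k = n * k := by
      obtain ⟨n, rfl⟩ : ∃ n', n = n' + 1 := ⟨n - 1, by omega⟩
      simp only [Nat.add_sub_cancel]; ring
    have h5 : (n + 1) * k = n * k + k := by ring
    omega
  · apply degree_lt_of_natDegree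
    intro h0
    rw [← Commute.geom_sum₂_mul (Commute.all _ _)] at h0 ⊢
    have h1 : g - X ^ k ≠ 0 := by rintro h; rw [h] at h0; simp at h0
    have h2 := natDegree_lt_of_ne hg h1
    have h3 : (∑ i ∈ Finset.range n, g ^ i * (X ^ k) ^ (n - 1 - i)).natDegree ≤ (n - 1) * k := by
      apply natDegree_sum_le_of_forall_le
      intro i hi
      rw [Finset.mem_range] at hi
      refine natDegree_mul_le.trans ?_
      rw [natDegree_pow, natDegree_pow, natDegree_X_pow, hgd, ← add_mul]
      exact Nat.mul_le_mul_right _ (by omega)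
    have h4 := natDegree_mul_le (p := ∑ i ∈ Finset.range n, g ^ i * (X ^ k) ^ (n - 1 - i))
      (q := g - X ^ k)
    have h5 : (n - 1) * k + k = n * k := by
      obtain ⟨n, rfl⟩ : ∃ n', n = n' + 1 := ⟨n - 1, by omega⟩
      simp only [Nat.add_sub_cancel]; ring
    omega

lemma Cen.iter {f : K[X]} {n : ℕ} (hn : 1 ≤ n) (hf : Cen f n) (k : ℕ) :
    Cen (polyIter f k) (n ^ k) := by
  induction k with
  | zero => simp [polyIter, Cen]
  | succ k ih =>
    rw [pow_succ, mul_comm]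
    exact Cen.comp hn (Nat.one_le_pow _ _ hn) hf ih

/-- rigidity of semiconjugacies of the same degree -/
lemma rigid [CharZero K] {F G V W : K[X]} {D m : ℕ} (hD : 2 ≤ D) (hm : 1 ≤ m) (hF : Cen F D)
    (hV : F.comp V = V.comp G) (hW : F.comp W = W.comp G)
    (dV : V.natDegree = m) (dW : W.natDegree = m) : ∃ τ : K, τ ≠ 0 ∧ V = C τ * W := by
  have dF := hF.natDegree
  have mF := hF.monic
  have hV0 : V ≠ 0 := by rintro rfl; simp at dV; omega
  have hW0 : W ≠ 0 := by rintro rfl; simp at dW; omega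
  have lV : V.leadingCoeff ≠ 0 := leadingCoeff_ne_zero.2 hV0
  have lW : W.leadingCoeff ≠ 0 := leadingCoeff_ne_zero.2 hW0
  have dG : G.natDegree = D := by
    have := congrArg Polynomial.natDegree hV
    rw [natDegree_comp, natDegree_comp, dF, dV, mul_comm] at this
    exact (Nat.eq_of_mul_eq_mul_left (by omega) this).symm
  have e1 : V.leadingCoeff ^ D = V.leadingCoeff * G.leadingCoeff ^ m := by
    have := congrArg Polynomial.leadingCoeff hV
    rwa [leadingCoeff_comp (by omega), leadingCoeff_comp (by omega), mF.leadingCoeff, dF, dV,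
      one_mul] at this
  have e2 : W.leadingCoeff ^ D = W.leadingCoeff * G.leadingCoeff ^ m := by
    have := congrArg Polynomial.leadingCoeff hW
    rwa [leadingCoeff_comp (by omega), leadingCoeff_comp (by omega), mF.leadingCoeff, dF, dW,
      one_mul] at this
  set τ := V.leadingCoeff / W.leadingCoeff with hτ
  have τ0 : τ ≠ 0 := div_ne_zero lV lW
  have hτD : τ ^ D = τ := by
    rw [hτ, div_pow, e1, e2]
    have : G.leadingCoeff ≠ 0 := by
      intro h; rw [leadingCoeff_eq_zero] at h; rw [h] at dG; simp at dG; omega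
    field_simp
  refine ⟨τ, τ0, ?_⟩
  by_contra hne
  set R := V - C τ * W with hR
  have R0 : R ≠ 0 := fun h => hne (sub_eq_zero.1 h)
  set U := C τ * W with hU
  have dU : U.natDegree = m := by rw [hU, natDegree_C_mul τ0, dW]
  have hU0 : U ≠ 0 := by rintro h; rw [h] at dU; simp at dU; omega
  have dR : R.natDegree < m := by
    rw [← dV]
    apply natDegree_lt_natDegree R0
    apply degree_sub_lt_left
    · rw [degree_eq_natDegree hV0, degree_eq_natDegree hU0, dV, dU]
    · exact hV0
    · rw [leadingCoeff_mul, leadingCoeff_C, hτ]; field_simp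
  -- the identity
  set Q := F - X ^ D with hQ
  have FQ : F = X ^ D + Q := by rw [hQ]; ring
  have key : (V ^ D - U ^ D) = R.comp G + (C τ * Q.comp W - Q.comp V) := by
    have h1 : V ^ D + Q.comp V = V.comp G := by
      rw [← hV, FQ]; simp
    have h2 : W ^ D + Q.comp W = W.comp G := by
      rw [← hW, FQ]; simp
    have h3 : U ^ D = C τ * W ^ D := by rw [hU, mul_pow, ← C_pow, hτD]
    have h4 : R.comp G = V.comp G - C τ * W.comp G := by simp [hR, hU]
    rw [h4, ← h1, ← h2, h3]; ring
  -- degree of the left-hand side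
  have hd1 : (V ^ D - U ^ D).natDegree = (D - 1) * m + R.natDegree := by
    rw [← Commute.geom_sum₂_mul (Commute.all _ _)]
    have hs : (∑ i ∈ Finset.range D, V ^ i * U ^ (D - 1 - i)).coeff ((D - 1) * m) =
        D * V.leadingCoeff ^ (D - 1) := by
      rw [finsetSum_coeff]
      have : ∀ i ∈ Finset.range D, (V ^ i * U ^ (D - 1 - i)).coeff ((D - 1) * m) =
          V.leadingCoeff ^ (D - 1) := by
        intro i hi
        rw [Finset.mem_range] at hi
        have hd : (V ^ i * U ^ (D - 1 - i)).natDegree = (D - 1) * m := by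
          rw [natDegree_mul (pow_ne_zero _ hV0) (pow_ne_zero _ hU0), natDegree_pow, natDegree_pow,
            dV, dU, ← add_mul]
          congr 1; omega
        rw [← hd, coeff_natDegree, leadingCoeff_mul, leadingCoeff_pow, leadingCoeff_pow]
        have : U.leadingCoeff = V.leadingCoeff := by
          rw [hU, leadingCoeff_mul, leadingCoeff_C, hτ]; field_simp
        rw [this, ← pow_add]
        congr 1; omega
      rw [Finset.sum_congr rfl this]
      simp
    have hs0 : (∑ i ∈ Finset.range D, V ^ i * U ^ (D - 1 - i)).coeff ((D - 1) * m) ≠ 0 := by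
      rw [hs]
      exact mul_ne_zero (by exact_mod_cast (by omega : D ≠ 0)) (pow_ne_zero _ lV)
    have hsd : (∑ i ∈ Finset.range D, V ^ i * U ^ (D - 1 - i)).natDegree = (D - 1) * m := by
      apply le_antisymm
      · apply natDegree_sum_le_of_forall_le
        intro i hi
        rw [Finset.mem_range] at hi
        refine natDegree_mul_le.trans ?_
        rw [natDegree_pow, natDegree_pow, dV, dU, ← add_mul]
        exact Nat.mul_le_mul_right _ (by omega)
      · exact le_natDegree_of_ne_zero hs0
    rw [natDegree_mul _ R0, hsd]
    intro h
    rw [h] at hs0; simp at hs0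
  have hQd : ∀ Z : K[X], Z.natDegree = m → (Q.comp Z).natDegree ≤ (D - 2) * m := by
    intro Z hZ
    rw [natDegree_comp, hZ]
    apply Nat.mul_le_mul_right
    by_cases h : Q = 0
    · rw [h]; simp
    · have : Q.natDegree < D - 1 := natDegree_lt_of_ne hF h
      omega
  have hd2 : (R.comp G + (C τ * Q.comp W - Q.comp V)).natDegree ≤
      max (R.natDegree * D) ((D - 2) * m) := by
    refine (natDegree_add_le _ _).trans (max_le_max ?_ ?_)
    · rw [natDegree_comp, dG]
    · refine (natDegree_sub_le _ _).trans (max_le ?_ (hQd V dV))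
      exact (natDegree_C_mul_le _ _).trans (hQd W dW)
  rw [← key, hd1] at hd2
  obtain ⟨D, rfl⟩ : ∃ D', D = D' + 2 := ⟨D - 2, by omega⟩
  simp only [Nat.add_sub_cancel, show D + 2 - 1 = D + 1 by omega] at hd2
  rcases le_max_iff.1 hd2 with h | h
  · nlinarith
  · nlinarith

/-- the bound on the period, for centered polynomials -/
lemma period_bound_cen [CharZero K] {f g p : K[X]} {n M : ℕ} (hn : 2 ≤ n) (hM : 1 ≤ M)
    (hf : Cen f n) (hg : g.natDegree = n) (hp : 0 < p.natDegree)
    (hX : f ≠ X ^ n) (h : (polyIter f M).comp p = p.comp (polyIter g M)) :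
    ∃ k, 1 ≤ k ∧ k ≤ n ∧ (polyIter f k).comp p = p.comp (polyIter g k) := by
  have df := hf.natDegree
  have mf := hf.monic
  have hF := hf.iter (by omega) M
  have hD : 2 ≤ n ^ M := le_trans hn (Nat.le_self_pow (by omega) n)
  set F := polyIter f M
  set G := polyIter g M
  have cg : G.comp g = g.comp G := polyIter_comm g M
  have cf : F.comp f = f.comp F := polyIter_comm f M
  have hpg : F.comp (p.comp g) = (p.comp g).comp G := by
    rw [← comp_assoc, h, comp_assoc, cg, comp_assoc]
  have hfp : F.comp (f.comp p) = (f.comp p).comp G := by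
    rw [← comp_assoc, cf, comp_assoc, h, comp_assoc]
  have hpgg : F.comp ((p.comp g).comp g) = ((p.comp g).comp g).comp G := by
    rw [← comp_assoc, hpg, comp_assoc, cg, comp_assoc (p.comp g)]
  have hffp : F.comp (f.comp (f.comp p)) = (f.comp (f.comp p)).comp G := by
    rw [← comp_assoc, cf, comp_assoc, hfp]
    simp only [comp_assoc]
  have hpos : 1 ≤ n * p.natDegree := Nat.mul_pos (by omega) hp
  obtain ⟨τ, τ0, hτ⟩ := rigid (m := n * p.natDegree) hD hpos hF hfp hpg
    (by rw [natDegree_comp, df]) (by rw [natDegree_comp, hg, mul_comm])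
  obtain ⟨σ, σ0, hσ⟩ := rigid (m := n * n * p.natDegree) hD
    (Nat.mul_pos (Nat.mul_pos (by omega) (by omega)) hp) hF hffp hpgg
    (by rw [natDegree_comp, natDegree_comp, df]; ring)
    (by rw [natDegree_comp, natDegree_comp, hg]; ring)
  have e1 : f.comp (C τ * X) = C (σ * τ⁻¹) * f := by
    apply comp_right_cancel (h := p.comp g) (by rw [natDegree_comp, hg, mul_comm]; omega)
    have a1 : (f.comp (C τ * X)).comp (p.comp g) = f.comp (f.comp p) := by
      rw [comp_assoc, hτ]; simp
    rw [a1, hσ, C_mul_comp, ← comp_assoc, hτ, C_mul_comp, ← mul_assoc, ← C_mul]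
    congr 2
    field_simp
  have e2 : ∀ i, f.coeff i * τ ^ i = σ * τ⁻¹ * f.coeff i := by
    intro i
    have := congrArg (fun q => q.coeff i) e1
    simp only [comp_C_mul_X_coeff, coeff_C_mul] at this
    exact this
  have e3 : σ * τ⁻¹ = τ ^ n := by
    have := e2 n
    rw [← df, coeff_natDegree, mf.leadingCoeff, df] at this
    simpa using this.symm
  rw [e3] at e1 e2
  obtain ⟨j, hj, hjn⟩ : ∃ j, f.coeff j ≠ 0 ∧ j < n := by
    by_contra hcon
    push Not at hcon
    apply hX
    ext i
    rw [coeff_X_pow]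
    split_ifs with hi
    · rw [hi, ← df, coeff_natDegree, mf.leadingCoeff]
    · by_contra hc
      have := hcon i hc
      exact hc (coeff_eq_zero_of_natDegree_lt (by omega))
  have hord : τ ^ (n - j) = 1 := by
    have h1 := e2 j
    have h2 : τ ^ j = τ ^ n := by
      rw [mul_comm] at h1
      exact mul_right_cancel₀ hj h1
    have h3 : τ ^ n = τ ^ j * τ ^ (n - j) := by rw [← pow_add]; congr 1; omega
    rw [h3] at h2
    exact (mul_eq_left₀ (pow_ne_zero _ τ0)).1 h2.symm
  have hr : 0 < orderOf τ := orderOf_pos_iff.2 (isOfFinOrder_iff_pow_eq_one.2 ⟨n - j, by omega, hord⟩)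
  have hrn : orderOf τ ≤ n := by
    have := Nat.le_of_dvd (by omega) (orderOf_dvd_of_pow_eq_one hord)
    omega
  have tw := twist_iter hτ e1
  have hM1 : τ ^ geoS n M = 1 := by
    have h1 := tw M
    change F.comp p = C _ * p.comp G at h1
    rw [h] at h1
    have h0 : p.comp G ≠ 0 := by
      intro hz
      have := congrArg Polynomial.natDegree hz
      rw [natDegree_comp, polyIter_natDegree, hg, natDegree_zero] at this
      have : 0 < p.natDegree * n ^ M := Nat.mul_pos hp (by omega)
      omega
    have h2 : (C (τ ^ geoS n M) - 1) * p.comp G = 0 := by rw [sub_mul, ← h1]; ring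
    rcases mul_eq_zero.1 h2 with h3 | h3
    · have := sub_eq_zero.1 h3
      rw [← C_1] at this
      exact C_injective this
    · exact absurd h3 h0
  have hcop : Nat.Coprime (orderOf τ) n := by
    obtain ⟨M, rfl⟩ : ∃ M', M = M' + 1 := ⟨M - 1, by omega⟩
    have h1 := orderOf_dvd_of_pow_eq_one hM1
    apply Nat.Coprime.coprime_dvd_left h1
    rw [geoS_succ]
    simp
  obtain ⟨k, hk1, hk2, hk3⟩ := exists_geoS_dvd n (orderOf τ) hr hcop
  refine ⟨k, hk1, hk2.trans hrn, ?_⟩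
  rw [tw k, orderOf_dvd_iff_pow_eq_one.1 hk3]
  simp

end PartTwo

section PartThree

variable {K : Type*} [Field K]

lemma lin_inv {a b : K} (ha : a ≠ 0) :
    (C a * X + C b : K[X]).comp (C a⁻¹ * X - C (a⁻¹ * b)) = X ∧
    (C a⁻¹ * X - C (a⁻¹ * b) : K[X]).comp (C a * X + C b) = X := by
  have h1 : (C a * C a⁻¹ : K[X]) = 1 := by rw [← C_mul, mul_inv_cancel₀ ha, C_1]
  constructor
  · simp only [add_comp, mul_comp, C_comp, X_comp, C_mul]
    linear_combination (X - C b) * h1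
  · simp only [sub_comp, mul_comp, C_comp, X_comp, C_mul]
    linear_combination X * h1

lemma degree_lin {a b : K} (ha : a ≠ 0) : (C a * X + C b : K[X]).degree = 1 :=
  degree_linear ha

lemma degree_lin_inv {a b : K} (ha : a ≠ 0) : (C a⁻¹ * X - C (a⁻¹ * b) : K[X]).degree = 1 := by
  rw [sub_eq_add_neg, ← C_neg]; exact degree_linear (inv_ne_zero ha)

lemma cen_of {f : K[X]} {n : ℕ} (hn : f.natDegree = n) (hm : f.Monic) (hn1 : 1 ≤ n)
    (hc : f.coeff (n - 1) = 0) : Cen f n := by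
  unfold Cen
  rw [degree_lt_iff_coeff_zero]
  intro m hm'
  rw [coeff_sub, coeff_X_pow]
  split_ifs with h
  · rw [h, ← hn, coeff_natDegree, hm.leadingCoeff, sub_self]
  · rw [sub_zero]
    by_cases h2 : m = n - 1
    · rw [h2, hc]
    · exact coeff_eq_zero_of_natDegree_lt (by omega)

lemma translate_cen [CharZero K] {f : K[X]} {n : ℕ} (hn : f.natDegree = n) (hm : f.Monic)
    (hn1 : 2 ≤ n) : ∃ s : K, Cen ((f.comp (X - C s)) + C s) n := by
  refine ⟨f.coeff (n - 1) / n, ?_⟩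
  set q := f.coeff (n - 1) with hq
  set s := q / n with hs
  have hXs : (X - C s : K[X]).natDegree = 1 := natDegree_X_sub_C s
  have hr : (f - X ^ n - C q * X ^ (n - 1)).degree < ((n - 1 : ℕ) : WithBot ℕ) := by
    rw [degree_lt_iff_coeff_zero]
    intro m hm'
    rw [coeff_sub, coeff_sub, coeff_X_pow, coeff_C_mul, coeff_X_pow]
    by_cases h : m = n
    · rw [if_pos h, if_neg (by omega), h, ← hn, coeff_natDegree, hm.leadingCoeff]; simp
    · rw [if_neg h]
      by_cases h2 : m = n - 1
      · rw [if_pos h2, h2, ← hq]; simp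
      · rw [if_neg h2, coeff_eq_zero_of_natDegree_lt (by omega)]; simp
  set r := f - X ^ n - C q * X ^ (n - 1) with hrdef
  have fe : f = X ^ n + C q * X ^ (n - 1) + r := by rw [hrdef]; ring
  have hd : (f.comp (X - C s)).natDegree = n := by rw [natDegree_comp, hXs, hn, mul_one]
  have hmon : (f.comp (X - C s)).Monic := by
    apply hm.comp_X_sub_C
  have hdC : (C s : K[X]).natDegree < n := by simp; omega
  apply cen_of
  · rw [natDegree_add_eq_left_of_natDegree_lt (by rw [hd]; exact hdC), hd]
  · apply hmon.add_of_left
    apply degree_lt_degree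
    rw [hd]; exact hdC
  · omega
  · have e : (f.comp (X - C s)) = (X - C s) ^ n + C q * (X - C s) ^ (n - 1) + r.comp (X - C s) := by
      conv_lhs => rw [fe]
      simp
    have hrc : (r.comp (X - C s)).coeff (n - 1) = 0 := by
      by_cases h0 : r = 0
      · rw [h0]; simp
      · apply coeff_eq_zero_of_natDegree_lt
        rw [natDegree_comp, hXs, mul_one]
        exact natDegree_lt_of_ne hr h0
    rw [e, sub_eq_add_neg, ← C_neg] at *
    rw [coeff_add, coeff_add, coeff_add, hrc, coeff_C_mul, coeff_X_add_C_pow, coeff_X_add_C_pow,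
      coeff_C, if_neg (by omega)]
    have h1 : n - (n - 1) = 1 := by omega
    have h2 : n.choose (n - 1) = n := by
      rw [Nat.choose_symm (by omega : 1 ≤ n)]; simp
    have h3 : (n : K) ≠ 0 := by exact_mod_cast (by omega : n ≠ 0)
    rw [h1, h2]
    simp only [Nat.sub_self, Nat.choose_self, hs]
    field_simp
    simp

lemma exists_cen [CharZero K] [IsAlgClosed K] {f : K[X]} {n : ℕ} (hn : f.natDegree = n)
    (hn1 : 2 ≤ n) : ∃ ℓ ℓi : K[X], ℓ.degree = 1 ∧ ℓi.degree = 1 ∧ ℓ.comp ℓi = X ∧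
      ℓi.comp ℓ = X ∧ Cen (ℓi.comp (f.comp ℓ)) n := by
  have hf0 : f ≠ 0 := by rintro rfl; simp at hn; omega
  have hl0 : f.leadingCoeff ≠ 0 := leadingCoeff_ne_zero.2 hf0
  obtain ⟨κ, hκ⟩ := IsAlgClosed.exists_pow_nat_eq f.leadingCoeff (n := n - 1) (by omega)
  have κ0 : κ ≠ 0 := by
    rintro rfl
    rw [zero_pow (by omega)] at hκ
    exact hl0 hκ.symm
  set f1 := C κ * f.comp (C κ⁻¹ * X) with hf1
  have d1 : (C κ⁻¹ * X : K[X]).natDegree = 1 := natDegree_C_mul_X _ (inv_ne_zero κ0)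
  have df1 : f1.natDegree = n := by
    rw [hf1, natDegree_C_mul κ0, natDegree_comp, d1, hn, mul_one]
  have mf1 : f1.Monic := by
    unfold Monic
    rw [hf1, leadingCoeff_mul, leadingCoeff_C, leadingCoeff_comp (by omega), hn, leadingCoeff_mul,
      leadingCoeff_C, leadingCoeff_X, mul_one, ← hκ, inv_pow]
    have : κ ^ n = κ * κ ^ (n - 1) := by rw [← pow_succ']; congr 1; omega
    rw [this]; field_simp
  obtain ⟨s, hs⟩ := translate_cen df1 mf1 hn1
  obtain ⟨h1, h2⟩ := lin_inv (a := κ) (b := s) κ0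
  refine ⟨C κ⁻¹ * X - C (κ⁻¹ * s), C κ * X + C s, degree_lin_inv κ0, degree_lin κ0, h2, h1, ?_⟩
  convert hs using 1
  rw [hf1]
  simp only [add_comp, mul_comp, C_comp, X_comp, comp_assoc, C_mul]
  rw [mul_sub]

lemma natDegree_of_degree_one {ℓ : K[X]} (h : ℓ.degree = 1) : ℓ.natDegree = 1 :=
  natDegree_eq_of_degree_eq_some h

lemma comp_left_cancel_inv {ℓ ℓi a b : K[X]} (h : ℓi.comp ℓ = X) (e : ℓ.comp a = ℓ.comp b) :
    a = b := by
  have := congrArg (fun q => ℓi.comp q) e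
  simpa only [← comp_assoc, h, X_comp] using this

/-- the bound on the period -/
lemma period_bound [CharZero K] [IsAlgClosed K] {f g p : K[X]} {n M : ℕ} (hn : 2 ≤ n) (hM : 1 ≤ M)
    (hf : f.natDegree = n) (hg : g.natDegree = n) (hp : 0 < p.natDegree)
    (hX : ¬ LinConj f (X ^ n)) (h : (polyIter f M).comp p = p.comp (polyIter g M)) :
    ∃ k, 1 ≤ k ∧ k ≤ n ∧ (polyIter f k).comp p = p.comp (polyIter g k) := by
  obtain ⟨ℓ, ℓi, h1, h2, h3, h4, hc⟩ := exists_cen hf hn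
  set f1 := ℓi.comp (f.comp ℓ) with hf1
  have hconj : f1.comp ℓi = ℓi.comp f := by
    rw [hf1, comp_assoc, comp_assoc, h3, comp_X]
  have hit := fun k => semiconj_iter hconj k
  have e : ∀ k, (polyIter f k).comp p = p.comp (polyIter g k) ↔
      (polyIter f1 k).comp (ℓi.comp p) = (ℓi.comp p).comp (polyIter g k) := by
    intro k
    rw [← comp_assoc, hit k, comp_assoc, comp_assoc]
    exact ⟨fun h => by rw [h], fun h => comp_left_cancel_inv h3 h⟩
  have hne : f1 ≠ X ^ n := by
    intro hx
    apply hX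
    refine ⟨ℓ, ℓi, h1, h2, h3, h4, ?_⟩
    rw [← hx, hf1]
    rw [comp_assoc, comp_assoc, h3, comp_X, ← comp_assoc, h3, X_comp]
  obtain ⟨k, hk1, hk2, hk3⟩ := period_bound_cen hn hM hc hg
    (by rw [natDegree_comp, natDegree_of_degree_one h2, one_mul]; exact hp) hne ((e M).1 h)
  exact ⟨k, hk1, hk2, (e k).2 hk3⟩

end PartThree

section PartFour

variable {K : Type*} [Field K]

lemma hensel_root [CharZero K] {u : K[X]} {n : ℕ} (hu : u.Monic) (hn : u.natDegree = n)
    (hn1 : 1 ≤ n) {ζ : K} (hζ : ζ ^ n = 1) :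
    ∃ y : PowerSeries K, PowerSeries.constantCoeff y = ζ ∧
      eval y (scaleRoots (u.map PowerSeries.C) PowerSeries.X) =
      eval 1 (scaleRoots (u.map PowerSeries.C) PowerSeries.X) := by
  set s : (PowerSeries K)[X] := scaleRoots (u.map PowerSeries.C) PowerSeries.X with hs
  have hmon : s.Monic := by
    rw [hs, monic_scaleRoots_iff]; exact hu.map _
  have hsd : s.natDegree = n := by
    rw [hs, natDegree_scaleRoots, hu.natDegree_map, hn]
  have hmap : s.map PowerSeries.constantCoeff = (X ^ n : K[X]) := by
    rw [hs, map_scaleRoots]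
    · rw [map_map]
      have : (PowerSeries.constantCoeff (R := K)).comp PowerSeries.C = RingHom.id K := by
        ext; simp
      rw [this, map_id]
      simp [hu.leadingCoeff, hn]
    · rw [(hu.map _).leadingCoeff]; simp
  set c := eval 1 s with hc
  have hcc : PowerSeries.constantCoeff c = 1 := by
    have := eval_map_apply (p := s) (f := PowerSeries.constantCoeff) (x := 1)
    rw [hmap] at this
    simpa using this.symm
  set F := s - C c with hF
  have hI : ∀ a : PowerSeries K, a ∈ Ideal.span {(PowerSeries.X : PowerSeries K)} ↔
      PowerSeries.constantCoeff a = 0 := by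
    intro a
    rw [Ideal.mem_span_singleton, PowerSeries.X_dvd_iff]
  have hFm : F.Monic := by
    rw [hF]
    apply hmon.sub_of_left
    rw [degree_eq_natDegree hmon.ne_zero, hsd]
    exact lt_of_le_of_lt degree_C_le (by exact_mod_cast hn1)
  have hn0 : (n : K) ≠ 0 := by exact_mod_cast (by omega : n ≠ 0)
  have hζ0 : ζ ≠ 0 := by
    rintro rfl; rw [zero_pow (by omega)] at hζ; exact zero_ne_one hζ
  obtain ⟨y, hy1, hy2⟩ := HenselianRing.is_henselian (I := Ideal.span {(PowerSeries.X : PowerSeries K)})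
    F hFm (PowerSeries.C ζ) (by
      rw [hI, hF, eval_sub, map_sub, eval_C, hcc]
      have := eval_map_apply (p := s) (f := PowerSeries.constantCoeff) (x := PowerSeries.C ζ)
      rw [← this, hmap]
      simp [hζ]) (by
      apply IsUnit.map
      rw [PowerSeries.isUnit_iff_constantCoeff, isUnit_iff_ne_zero]
      rw [hF, derivative_sub, derivative_C, sub_zero]
      have := eval_map_apply (p := derivative s) (f := PowerSeries.constantCoeff) (x := PowerSeries.C ζ)
      rw [← this, ← derivative_map, hmap]
      rw [derivative_X_pow]
      simp [hn0, hζ0])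
  refine ⟨y, ?_, ?_⟩
  · rw [hI, map_sub, sub_eq_zero] at hy2
    simpa using hy2
  · rw [hF, IsRoot.def, eval_sub, eval_C, sub_eq_zero] at hy1
    exact hy1

variable {Ω : Type*} [Field Ω]

lemma jX_ne (j : PowerSeries K →+* Ω) (hj : Function.Injective j) : j PowerSeries.X ≠ 0 := by
  rw [map_ne_zero_iff j hj]; exact PowerSeries.X_ne_zero

lemma lead_eval (j : PowerSeries K →+* Ω) (hj : Function.Injective j) {q : K[X]}
    (y : PowerSeries K) :
    ∃ y' : PowerSeries K, PowerSeries.constantCoeff y' =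
      q.leadingCoeff * (PowerSeries.constantCoeff y) ^ q.natDegree ∧
      eval₂ (j.comp PowerSeries.C) (j y * (j PowerSeries.X)⁻¹) q =
        j y' * (j PowerSeries.X)⁻¹ ^ q.natDegree ∧
      y' = eval y (scaleRoots (q.map PowerSeries.C) PowerSeries.X) := by
  have hX := jX_ne j hj
  have hCi : Function.Injective (PowerSeries.C (R := K)) := PowerSeries.C_injective
  refine ⟨eval y (scaleRoots (q.map PowerSeries.C) PowerSeries.X), ?_, ?_, rfl⟩
  · rw [← eval_map_apply]
    by_cases hq : q = 0
    · simp [hq]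
    rw [map_scaleRoots, map_map]
    · have : (PowerSeries.constantCoeff (R := K)).comp PowerSeries.C = RingHom.id K := by
        ext; simp
      rw [this, map_id]
      simp
    · rw [leadingCoeff_map_of_injective hCi]; simpa using hq
  · have h1 := scaleRoots_eval₂_mul (p := q.map PowerSeries.C) j (j y * (j PowerSeries.X)⁻¹)
      PowerSeries.X
    have h2 : j PowerSeries.X * (j y * (j PowerSeries.X)⁻¹) = j y := by field_simp
    rw [h2, eval₂_map, natDegree_map_eq_of_injective hCi, eval₂_at_apply] at h1
    rw [h1, mul_right_comm, ← mul_pow, mul_inv_cancel₀ hX, one_pow, one_mul]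

lemma jT_eq (j : PowerSeries K →+* Ω) (hj : Function.Injective j) {y y' : PowerSeries K} {a b : ℕ}
    (h : j y * (j PowerSeries.X)⁻¹ ^ a = j y' * (j PowerSeries.X)⁻¹ ^ b)
    (hy : PowerSeries.constantCoeff y ≠ 0) (hy' : PowerSeries.constantCoeff y' ≠ 0) :
    a = b ∧ PowerSeries.constantCoeff y = PowerSeries.constantCoeff y' := by
  have hX := jX_ne j hj
  have e : y * PowerSeries.X ^ b = y' * PowerSeries.X ^ a := by
    apply hj
    simp only [map_mul, map_pow]
    rw [inv_pow, inv_pow] at h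
    field_simp at h
    rw [h, mul_comm]
  rcases lt_trichotomy a b with hab | hab | hab
  · exfalso
    obtain ⟨c, rfl⟩ := Nat.exists_eq_add_of_lt hab
    have e2 : y * PowerSeries.X ^ (c + 1) = y' := by
      apply mul_right_cancel₀ (pow_ne_zero a (PowerSeries.X_ne_zero (R := K)))
      rw [← e]; ring
    apply hy'
    rw [← e2]; simp
  · subst hab
    refine ⟨rfl, ?_⟩
    rw [mul_right_cancel₀ (pow_ne_zero a (PowerSeries.X_ne_zero (R := K))) e]
  · exfalso
    obtain ⟨c, rfl⟩ := Nat.exists_eq_add_of_lt hab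
    have e2 : y' * PowerSeries.X ^ (c + 1) = y := by
      apply mul_right_cancel₀ (pow_ne_zero b (PowerSeries.X_ne_zero (R := K)))
      rw [e]; ring
    apply hy
    rw [← e2]; simp

lemma root_exists [CharZero K] (j : PowerSeries K →+* Ω) (hj : Function.Injective j) {u : K[X]}
    {n : ℕ} (hn : u.natDegree = n) (hn1 : 1 ≤ n) {ζ : K} (hζ : ζ ^ n = 1) :
    ∃ y : PowerSeries K, PowerSeries.constantCoeff y = ζ ∧
      eval₂ (j.comp PowerSeries.C) (j y * (j PowerSeries.X)⁻¹) u =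
      eval₂ (j.comp PowerSeries.C) (j PowerSeries.X)⁻¹ u := by
  have hu0 : u ≠ 0 := by rintro rfl; simp at hn; omega
  have hl : u.leadingCoeff ≠ 0 := leadingCoeff_ne_zero.2 hu0
  set u1 := C u.leadingCoeff⁻¹ * u with hu1
  have hu1d : u1.natDegree = n := by rw [hu1, natDegree_C_mul (inv_ne_zero hl), hn]
  have hu1m : u1.Monic := by
    unfold Monic; rw [hu1, leadingCoeff_mul, leadingCoeff_C, inv_mul_cancel₀ hl]
  obtain ⟨y, hy1, hy2⟩ := hensel_root hu1m hu1d hn1 hζ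
  refine ⟨y, hy1, ?_⟩
  obtain ⟨a, -, ha, ha'⟩ := lead_eval j hj (q := u1) y
  obtain ⟨b, -, hb, hb'⟩ := lead_eval j hj (q := u1) 1
  have hab : a = b := by rw [ha', hb', hy2]
  have e : eval₂ (j.comp PowerSeries.C) (j y * (j PowerSeries.X)⁻¹) u1 =
      eval₂ (j.comp PowerSeries.C) (j PowerSeries.X)⁻¹ u1 := by
    rw [ha, hab, ← hb, map_one, one_mul]
  have eu : u = C u.leadingCoeff * u1 := by
    rw [hu1, ← mul_assoc, ← C_mul, mul_inv_cancel₀ hl, C_1, one_mul]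
  rw [eu]
  generalize u1 = v at e
  rw [eval₂_mul, eval₂_mul, e, eval₂_C, eval₂_C]

open Classical in
lemma roots_param [CharZero K] [IsAlgClosed K] (j : PowerSeries K →+* Ω)
    (hj : Function.Injective j) {u : K[X]}
    {n : ℕ} (hn : u.natDegree = n) (hn1 : 1 ≤ n) :
    (∀ ρ, eval₂ (j.comp PowerSeries.C) ρ u = eval₂ (j.comp PowerSeries.C) (j PowerSeries.X)⁻¹ u →
      ∃ y : PowerSeries K, PowerSeries.constantCoeff y ^ n = 1 ∧ ρ = j y * (j PowerSeries.X)⁻¹) ∧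
    (∀ y y' : PowerSeries K, PowerSeries.constantCoeff y = PowerSeries.constantCoeff y' →
      eval₂ (j.comp PowerSeries.C) (j y * (j PowerSeries.X)⁻¹) u =
        eval₂ (j.comp PowerSeries.C) (j PowerSeries.X)⁻¹ u →
      eval₂ (j.comp PowerSeries.C) (j y' * (j PowerSeries.X)⁻¹) u =
        eval₂ (j.comp PowerSeries.C) (j PowerSeries.X)⁻¹ u → y = y') ∧
    (u.map (j.comp PowerSeries.C) -
      C (eval₂ (j.comp PowerSeries.C) (j PowerSeries.X)⁻¹ u)).roots.toFinset.card = n := by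
  have hX := jX_ne j hj
  have hu0 : u ≠ 0 := by rintro rfl; simp at hn; omega
  choose! y hy1 hy2 using fun ζ (hζ : ζ ^ n = 1) => root_exists j hj hn hn1 hζ
  set V := u.map (j.comp PowerSeries.C) - C (eval₂ (j.comp PowerSeries.C) (j PowerSeries.X)⁻¹ u)
    with hV
  have dm : (u.map (j.comp PowerSeries.C)).natDegree = n := by rw [natDegree_map, hn]
  have dV : V.natDegree = n := by
    rw [hV, natDegree_sub_C, dm]
  have V0 : V ≠ 0 := by rintro h; rw [h] at dV; simp at dV; omega
  have mem : ∀ ρ, ρ ∈ V.roots.toFinset ↔ eval₂ (j.comp PowerSeries.C) ρ u =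
      eval₂ (j.comp PowerSeries.C) (j PowerSeries.X)⁻¹ u := by
    intro ρ
    rw [Multiset.mem_toFinset, mem_roots V0, IsRoot.def, hV, eval_sub, eval_C, eval_map, sub_eq_zero]
  have : NeZero (n : K) := ⟨by exact_mod_cast (by omega : n ≠ 0)⟩
  obtain ⟨ω, hω⟩ := HasEnoughRootsOfUnity.exists_primitiveRoot K n
  have : NeZero n := ⟨by omega⟩
  have hcard : (nthRootsFinset n (1 : K)).card = n := hω.card_nthRootsFinset
  have hz : ∀ ζ ∈ nthRootsFinset n (1 : K), ζ ^ n = 1 := fun ζ h =>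
    (mem_nthRootsFinset (by omega) _).1 h
  have himg : (nthRootsFinset n (1 : K)).image (fun ζ => j (y ζ) * (j PowerSeries.X)⁻¹) =
      V.roots.toFinset := by
    apply Finset.eq_of_subset_of_card_le
    · intro ρ hρ
      rw [Finset.mem_image] at hρ
      obtain ⟨ζ, hζ, rfl⟩ := hρ
      rw [mem]
      exact hy2 ζ (hz ζ hζ)
    · rw [Finset.card_image_of_injOn, hcard]
      · exact (Multiset.toFinset_card_le _).trans ((card_roots' V).trans dV.le)
      · intro a ha b hb hab
        have h1 : y a = y b := hj (mul_right_cancel₀ (inv_ne_zero hX) hab)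
        rw [← hy1 a (hz a ha), ← hy1 b (hz b hb), h1]
  have key : ∀ a : PowerSeries K, eval₂ (j.comp PowerSeries.C) (j a * (j PowerSeries.X)⁻¹) u =
        eval₂ (j.comp PowerSeries.C) (j PowerSeries.X)⁻¹ u → a = y (PowerSeries.constantCoeff a) := by
    intro a ha
    rw [← mem, ← himg, Finset.mem_image] at ha
    obtain ⟨ζ, hζ, h⟩ := ha
    have h1 : y ζ = a := hj (mul_right_cancel₀ (inv_ne_zero hX) h)
    rw [← h1, hy1 ζ (hz ζ hζ)]
  refine ⟨?_, ?_, ?_⟩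
  · intro ρ hρ
    rw [← mem, ← himg, Finset.mem_image] at hρ
    obtain ⟨ζ, hζ, rfl⟩ := hρ
    refine ⟨y ζ, ?_, rfl⟩
    rw [hy1 ζ (hz ζ hζ), hz ζ hζ]
  · intro a b hab ha hb
    rw [key a ha, key b hb, hab]
  · rw [← himg, Finset.card_image_of_injOn, hcard]
    intro a ha b hb hab
    have h1 : y a = y b := hj (mul_right_cancel₀ (inv_ne_zero hX) hab)
    rw [← hy1 a (hz a ha), ← hy1 b (hz b hb), h1]

end PartFour

section PartFive

variable {K : Type*} [Field K]

lemma expand {h : K[X]} {k : ℕ} (hk : h.natDegree = k) (hk1 : 1 ≤ k) (q : K[X]) :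
    ∃ c : ℕ → K[X], q = ∑ j ∈ Finset.range k, (c j).comp h * X ^ j := by
  induction hn : q.natDegree using Nat.strong_induction_on generalizing q with
  | _ n ih =>
    by_cases hq : q.natDegree < k
    · refine ⟨fun j => C (q.coeff j), ?_⟩
      simp only [C_comp]
      exact as_sum_range_C_mul_X_pow' q hq
    · have hq0 : q ≠ 0 := by rintro rfl; simp at hq; omega
      have hd : (q / h).natDegree < q.natDegree := by
        by_cases h0 : q / h = 0
        · rw [h0]; simp; omega
        · exact natDegree_lt_natDegree h0
            (degree_div_lt hq0 (natDegree_pos_iff_degree_pos.1 (by omega)))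
      obtain ⟨c, hc⟩ := ih _ (by omega) (q / h) rfl
      have hr : (q % h).natDegree < k := by
        rw [← hk]; exact natDegree_mod_lt q (by omega)
      refine ⟨fun j => X * c j + C ((q % h).coeff j), ?_⟩
      have e := (EuclideanDomain.div_add_mod q h).symm
      rw [as_sum_range_C_mul_X_pow' (q % h) hr, hc, Finset.mul_sum, ← Finset.sum_add_distrib] at e
      conv_lhs => rw [e]
      apply Finset.sum_congr rfl
      intro j _
      simp only [add_comp, mul_comp, X_comp, C_comp]
      ring

variable {Ω : Type*} [Field Ω]

lemma phi_inj (j : PowerSeries K →+* Ω) (hj : Function.Injective j) {y : PowerSeries K}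
    (hy : PowerSeries.constantCoeff y ≠ 0) :
    Function.Injective (eval₂RingHom (j.comp PowerSeries.C) (j y * (j PowerSeries.X)⁻¹)) := by
  rw [injective_iff_map_eq_zero]
  intro q hq
  by_contra hq0
  rw [coe_eval₂RingHom] at hq
  obtain ⟨y', h1, h2, -⟩ := lead_eval j hj (q := q) y
  rw [hq] at h2
  have h3 : y' = 0 := by
    apply hj
    rw [map_zero]
    rcases mul_eq_zero.1 h2.symm with h | h
    · exact h
    · exact absurd h (pow_ne_zero _ (inv_ne_zero (jX_ne j hj)))
  rw [h3, map_zero] at h1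
  exact mul_ne_zero (leadingCoeff_ne_zero.2 hq0) (pow_ne_zero _ hy) h1.symm

lemma prod_lead (j : PowerSeries K →+* Ω) (s : Multiset Ω)
    (hs : ∀ ρ ∈ s, ∃ y : PowerSeries K, PowerSeries.constantCoeff y ≠ 0 ∧
      ρ = j y * (j PowerSeries.X)⁻¹) :
    ∃ y : PowerSeries K, PowerSeries.constantCoeff y ≠ 0 ∧
      (s.map (fun ρ => 0 - ρ)).prod = j y * (j PowerSeries.X)⁻¹ ^ s.card := by
  induction s using Multiset.induction_on with
  | empty => exact ⟨1, by simp, by simp⟩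
  | cons a s ih =>
    obtain ⟨y, hy, e⟩ := ih (fun ρ hρ => hs ρ (Multiset.mem_cons_of_mem hρ))
    obtain ⟨z, hz, e'⟩ := hs a (Multiset.mem_cons_self a s)
    refine ⟨-(z * y), by simpa using ⟨hz, hy⟩, ?_⟩
    rw [Multiset.map_cons, Multiset.prod_cons, e, e', Multiset.card_cons, map_neg, map_mul]
    ring

open Classical in
lemma exists_h [CharZero K] [IsAlgClosed K] (j : PowerSeries K →+* Ω) (hj : Function.Injective j)
    {v P : K[X]} (hv : 1 ≤ v.natDegree) :
    ∃ (Z : Finset Ω) (h : K[X]), (∀ ρ, ρ ∈ Z ↔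
      (eval₂ (j.comp PowerSeries.C) ρ v = eval₂ (j.comp PowerSeries.C) (j PowerSeries.X)⁻¹ v ∧
       eval₂ (j.comp PowerSeries.C) ρ P = eval₂ (j.comp PowerSeries.C) (j PowerSeries.X)⁻¹ P)) ∧
      h.natDegree = Z.card ∧ ∀ ρ ∈ Z,
        eval₂ (j.comp PowerSeries.C) ρ h = eval₂ (j.comp PowerSeries.C) (j PowerSeries.X)⁻¹ h := by
  obtain ⟨hform, -, hcard⟩ := roots_param j hj (u := v) rfl hv
  have hv0 : v ≠ 0 := by rintro rfl; simp at hv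
  have hlv : v.leadingCoeff ≠ 0 := leadingCoeff_ne_zero.2 hv0
  have hTform : (j PowerSeries.X)⁻¹ = j 1 * (j PowerSeries.X)⁻¹ := by simp
  have injT : Function.Injective (eval₂RingHom (j.comp PowerSeries.C) (j PowerSeries.X)⁻¹) := by
    rw [hTform]; exact phi_inj j hj (by simp)
  set i := j.comp PowerSeries.C with hi
  set T := (j PowerSeries.X)⁻¹ with hT
  -- the two-variable polynomials
  let W : K[X] → (K[X])[X] := fun q => q.map C - C q
  let VΩ : K[X] → Polynomial Ω := fun q => q.map i - C (eval₂ i T q)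
  have hW : ∀ q ρ, eval₂ i ρ q = eval₂ i T q → (W q).map (eval₂RingHom i ρ) = VΩ q := by
    intro q ρ h
    simp only [W, VΩ, Polynomial.map_sub, map_map, map_C, coe_eval₂RingHom, h]
    congr 2
    ext a; simp
  let A := algebraMap K[X] (FractionRing K[X])
  let g := EuclideanDomain.gcd ((W v).map A) ((W P).map A)
  have dW : (W v).natDegree = v.natDegree := by
    simp only [W]
    rw [natDegree_sub_C, natDegree_map_eq_of_injective C_injective]
  have lW : (W v).leadingCoeff = C v.leadingCoeff := by
    rw [leadingCoeff, dW]
    simp only [W, coeff_sub, coeff_map, coeff_C]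
    rw [if_neg (by omega), sub_zero, coeff_natDegree]
  have hmon : (C (C v.leadingCoeff⁻¹) * W v).Monic := by
    unfold Monic
    rw [leadingCoeff_mul, leadingCoeff_C, lW, ← C_mul, inv_mul_cancel₀ hlv, C_1]
  have hgdvd : g ∣ (C (C v.leadingCoeff⁻¹) * W v).map A := by
    rw [Polynomial.map_mul]
    exact (EuclideanDomain.gcd_dvd_left _ _).mul_left _
  obtain ⟨g', hg'⟩ := IsIntegrallyClosed.eq_map_mul_C_of_dvd (FractionRing K[X]) hmon hgdvd
  have hg0 : g ≠ 0 := ne_zero_of_dvd_ne_zero (hmon.map A).ne_zero hgdvd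
  have hAinj : Function.Injective A := IsFractionRing.injective _ _
  have hlg : g.leadingCoeff ≠ 0 := leadingCoeff_ne_zero.2 hg0
  have hg'm : g'.Monic := by
    have h1 := congrArg leadingCoeff hg'
    rw [leadingCoeff_mul, leadingCoeff_C] at h1
    have h2 := mul_right_cancel₀ hlg (h1.trans (one_mul _).symm)
    change (g'.map A).leadingCoeff = 1 at h2
    rw [leadingCoeff_map_of_injective hAinj] at h2
    apply hAinj
    rw [h2, map_one]
  set gΩ := EuclideanDomain.gcd (VΩ v) (VΩ P) with hgΩ
  have hmapg : ∀ ρ, Function.Injective (eval₂RingHom i ρ) → eval₂ i ρ v = eval₂ i T v →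
      eval₂ i ρ P = eval₂ i T P →
      g'.map (eval₂RingHom i ρ) = gΩ * C gΩ.leadingCoeff⁻¹ := by
    intro ρ hinj h1 h2
    let L := IsFractionRing.lift (K := FractionRing K[X]) hinj
    have hLA : L.comp A = eval₂RingHom i ρ := by
      apply RingHom.ext
      intro x
      exact IsFractionRing.lift_algebraMap hinj _
    have hg2 : g.map L = gΩ := by
      rw [hgΩ, ← hW v ρ h1, ← hW P ρ h2, ← hLA, ← map_map, ← map_map, gcd_map]
    have h3 := congrArg (Polynomial.map L) hg'
    change (g'.map A * C g.leadingCoeff).map L = g.map L at h3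
    rw [Polynomial.map_mul, map_map, hLA, map_C, hg2] at h3
    have h4 : gΩ.leadingCoeff = L g.leadingCoeff := by
      rw [← hg2, leadingCoeff_map]
    have h5 : L g.leadingCoeff ≠ 0 := (map_ne_zero L).2 hlg
    rw [h4]
    nth_rw 1 [← h3]
    rw [mul_assoc, ← C_mul, mul_inv_cancel₀ h5, C_1, mul_one]
  set H := g'.map (eval₂RingHom i T) with hH
  have HH : H = gΩ * C gΩ.leadingCoeff⁻¹ := hmapg T injT rfl rfl
  have Hm : H.Monic := hg'm.map _
  have dVΩ : (VΩ v).natDegree = v.natDegree := by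
    simp only [VΩ]
    rw [natDegree_sub_C, natDegree_map]
  have VΩ0 : VΩ v ≠ 0 := by rintro h; rw [h] at dVΩ; simp at dVΩ; omega
  have hgΩ0 : gΩ ≠ 0 := by
    intro h; rw [h] at HH; simp at HH; exact Hm.ne_zero HH
  have hlΩ : gΩ.leadingCoeff ≠ 0 := leadingCoeff_ne_zero.2 hgΩ0
  have hHdvd : H ∣ VΩ v := by
    have h1 : gΩ ∣ VΩ v := EuclideanDomain.gcd_dvd_left _ _
    rw [HH]
    refine (Associated.dvd ?_).trans h1
    apply associated_mul_unit_left
    rw [isUnit_C, isUnit_iff_ne_zero]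
    exact inv_ne_zero hlΩ
  have hcle := card_roots' (VΩ v)
  have hcle2 := Multiset.toFinset_card_le (VΩ v).roots
  change (VΩ v).roots.toFinset.card = v.natDegree at hcard
  have hcard2 : (VΩ v).roots.card = v.natDegree := by omega
  have hnd : (VΩ v).roots.Nodup := by
    rw [← Multiset.toFinset_card_eq_card_iff_nodup]; omega
  have hsp : (VΩ v).Splits := by rw [splits_iff_card_roots]; omega
  have hHsp : H.Splits := hsp.of_dvd VΩ0 hHdvd
  rw [splits_iff_card_roots] at hHsp
  have hHnd : H.roots.Nodup := Multiset.nodup_of_le (roots.le_of_dvd VΩ0 hHdvd) hnd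
  have hZmem : ∀ ρ, ρ ∈ H.roots.toFinset ↔ (eval₂ i ρ v = eval₂ i T v ∧ eval₂ i ρ P = eval₂ i T P) := by
    intro ρ
    rw [Multiset.mem_toFinset, mem_roots Hm.ne_zero, IsRoot.def, HH, eval_mul, eval_C, mul_eq_zero,
      or_iff_left (inv_ne_zero hlΩ), ← IsRoot.def, hgΩ, isRoot_gcd_iff_isRoot_left_right]
    simp only [VΩ, IsRoot.def, eval_sub, eval_C, eval_map, sub_eq_zero]
  have hZform : ∀ ρ ∈ H.roots, ∃ y : PowerSeries K, PowerSeries.constantCoeff y ≠ 0 ∧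
      ρ = j y * T := by
    intro ρ hρ
    rw [← Multiset.mem_toFinset, hZmem] at hρ
    obtain ⟨y, hy, e⟩ := hform ρ hρ.1
    refine ⟨y, ?_, e⟩
    intro h0
    rw [h0, zero_pow (by omega)] at hy
    exact zero_ne_one hy
  refine ⟨H.roots.toFinset, g'.coeff 0, hZmem, ?_, ?_⟩
  · obtain ⟨y, hy, e⟩ := prod_lead j H.roots hZform
    have h1 : eval₂ i T (g'.coeff 0) = H.coeff 0 := by
      rw [hH, coeff_map, coe_eval₂RingHom]
    have h2 : H.coeff 0 = (H.roots.map (fun ρ => 0 - ρ)).prod := by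
      rw [coeff_zero_eq_eval_zero]
      conv_lhs => rw [← prod_multiset_X_sub_C_of_monic_of_roots_card_eq Hm hHsp]
      rw [eval_multiset_prod, Multiset.map_map]
      congr 2
      ext a; simp
    rw [h2, e] at h1
    obtain ⟨y', hy', e', -⟩ := lead_eval j hj (q := g'.coeff 0) 1
    rw [← hTform] at e'
    change eval₂ i T _ = _ at e'
    rw [h1] at e'
    rw [Multiset.toFinset_card_of_nodup hHnd]
    have hne : g'.coeff 0 ≠ 0 := by
      intro h0
      rw [h0, eval₂_zero] at h1
      have : j y ≠ 0 := by
        rw [map_ne_zero_iff j hj]; rintro rfl; simp at hy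
      exact mul_ne_zero this (pow_ne_zero _ (inv_ne_zero (jX_ne j hj))) h1.symm
    refine (jT_eq j hj e' hy ?_).1.symm
    rw [hy']
    simpa using hne
  · intro ρ hρ
    have hρ' := (hZmem ρ).1 hρ
    obtain ⟨y, hy, e⟩ := hZform ρ (Multiset.mem_toFinset.1 hρ)
    have hinj : Function.Injective (eval₂RingHom i ρ) := by rw [e]; exact phi_inj j hj hy
    have h1 := hmapg ρ hinj hρ'.1 hρ'.2
    rw [← HH, hH] at h1
    have := congrArg (fun q => q.coeff 0) h1
    simpa only [coeff_map, coe_eval₂RingHom] using this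

lemma mem_of_const (i : K →+* Ω) {T : Ω} (hT : Function.Injective (eval₂RingHom i T)) {Z : Finset Ω}
    {h q : K[X]} (hk : h.natDegree = Z.card) (hk1 : 1 ≤ Z.card)
    (hh : ∀ ρ ∈ Z, eval₂ i ρ h = eval₂ i T h) (hq : ∀ ρ ∈ Z, eval₂ i ρ q = eval₂ i T q) :
    ∃ c : K[X], q = c.comp h := by
  obtain ⟨c, hc⟩ := expand hk hk1 q
  set k := Z.card with hkd
  set R : Polynomial Ω := ∑ a ∈ Finset.range k, C (eval₂ i T ((c a).comp h)) * X ^ a - C (eval₂ i T q) with hR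
  have hR0 : R = 0 := by
    apply eq_zero_of_natDegree_lt_card_of_eval_eq_zero' R Z
    · intro ρ hρ
      rw [hR, eval_sub, eval_C, ← hq ρ hρ, sub_eq_zero]
      conv_rhs => rw [hc]
      rw [eval_finsetSum, eval₂_finsetSum]
      apply Finset.sum_congr rfl
      intro a _
      rw [eval_mul, eval_C, eval_pow, eval_X, eval₂_mul, eval₂_pow, eval₂_X, eval₂_comp, eval₂_comp,
        hh ρ hρ]
    · rw [hR, natDegree_sub_C]
      apply lt_of_le_of_lt (natDegree_sum_le_of_forall_le _ _ (n := k - 1) _)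
      · omega
      · intro a ha
        rw [Finset.mem_range] at ha
        exact (natDegree_C_mul_X_pow_le _ _).trans (by omega)
  have hca : ∀ a ∈ Finset.range k, a ≠ 0 → (c a).comp h = 0 := by
    intro a ha ha0
    apply hT
    rw [map_zero, coe_eval₂RingHom]
    have := congrArg (fun q => q.coeff a) hR0
    simp only [hR, coeff_sub, finsetSum_coeff, coeff_C_mul, coeff_X_pow, coeff_C, if_neg ha0] at this
    simpa [Finset.mem_range.1 ha] using this
  refine ⟨c 0, ?_⟩
  rw [hc, Finset.sum_eq_single 0]
  · simp
  · intro a ha ha0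
    rw [hca a ha ha0, zero_mul]
  · intro h0
    exact absurd (Finset.mem_range.2 (by omega)) h0

/-- the gcd decomposition theorem -/
lemma gcd_decomp [CharZero K] [IsAlgClosed K] {A B v P : K[X]} (h : A.comp v = B.comp P)
    (hA : 1 ≤ A.natDegree) (hv : 1 ≤ v.natDegree) (hP : 1 ≤ P.natDegree) :
    ∃ w v' P' : K[X], v = v'.comp w ∧ P = P'.comp w ∧
      w.natDegree = Nat.gcd v.natDegree P.natDegree := by
  let Ω := FractionRing (PowerSeries K)
  let j : PowerSeries K →+* Ω := algebraMap _ _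
  have hj : Function.Injective j := IsFractionRing.injective _ _
  obtain ⟨Z, w, hZ, hw, hwZ⟩ := exists_h j hj (v := v) (P := P) hv
  have hTform : (j PowerSeries.X)⁻¹ = j 1 * (j PowerSeries.X)⁻¹ := by simp
  have injT : Function.Injective (eval₂RingHom (j.comp PowerSeries.C) (j PowerSeries.X)⁻¹) := by
    rw [hTform]; exact phi_inj j hj (by simp)
  set i := j.comp PowerSeries.C with hi
  set T := (j PowerSeries.X)⁻¹ with hT
  set e := Nat.gcd v.natDegree P.natDegree with he
  have he1 : 1 ≤ e := Nat.gcd_pos_of_pos_left _ hv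
  have hTZ : T ∈ Z := by rw [hZ]; exact ⟨rfl, rfl⟩
  have hZ1 : 1 ≤ Z.card := Finset.card_pos.2 ⟨T, hTZ⟩
  have hcard : e ≤ Z.card := by
    have : NeZero (e : K) := ⟨by exact_mod_cast (by omega : e ≠ 0)⟩
    obtain ⟨ω, hω⟩ := HasEnoughRootsOfUnity.exists_primitiveRoot K e
    have : NeZero e := ⟨by omega⟩
    have hcard : (nthRootsFinset e (1 : K)).card = e := hω.card_nthRootsFinset
    have hz : ∀ ζ ∈ nthRootsFinset e (1 : K), ζ ^ e = 1 := fun ζ h =>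
      (mem_nthRootsFinset (by omega) _).1 h
    have hex : ∀ ζ : K, ζ ^ e = 1 → ∃ y : PowerSeries K, PowerSeries.constantCoeff y = ζ ∧
        j y * T ∈ Z := by
      intro ζ hζ
      have hpow : ∀ n, e ∣ n → ζ ^ n = 1 := by
        rintro n ⟨c, rfl⟩; rw [pow_mul, hζ, one_pow]
      obtain ⟨y1, hy1, e1⟩ := root_exists j hj (u := v) rfl hv (hpow _ (Nat.gcd_dvd_left _ _))
      obtain ⟨y2, hy2, e2⟩ := root_exists j hj (u := P) rfl hP (hpow _ (Nat.gcd_dvd_right _ _))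
      change eval₂ i (j y1 * T) v = eval₂ i T v at e1
      change eval₂ i (j y2 * T) P = eval₂ i T P at e2
      have hd : 1 ≤ (A.comp v).natDegree := by
        rw [natDegree_comp]; exact Nat.mul_pos hA hv
      obtain ⟨-, huniq, -⟩ := roots_param j hj (u := A.comp v) rfl hd
      have : y1 = y2 := by
        apply huniq y1 y2 (hy1.trans hy2.symm)
        · change eval₂ i (j y1 * T) _ = eval₂ i T _
          rw [eval₂_comp, eval₂_comp, e1]
        · change eval₂ i (j y2 * T) _ = eval₂ i T _
          rw [h, eval₂_comp, eval₂_comp, e2]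
      refine ⟨y1, hy1, ?_⟩
      rw [hZ]
      refine ⟨e1, ?_⟩
      rw [this]; exact e2
    choose! y hy1 hy2 using hex
    rw [← hcard]
    apply Finset.card_le_card_of_injOn (fun ζ => j (y ζ) * T)
    · intro ζ hζ
      exact hy2 ζ (hz ζ hζ)
    · intro a ha b hb hab
      have h1 : y a = y b := hj (mul_right_cancel₀ (inv_ne_zero (jX_ne j hj)) hab)
      rw [← hy1 a (hz a ha), ← hy1 b (hz b hb), h1]
  obtain ⟨v', hv'⟩ := mem_of_const i injT hw hZ1 hwZ (fun ρ hρ => ((hZ ρ).1 hρ).1)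
  obtain ⟨P', hP'⟩ := mem_of_const i injT hw hZ1 hwZ (fun ρ hρ => ((hZ ρ).1 hρ).2)
  refine ⟨w, v', P', hv', hP', ?_⟩
  have hdvd : w.natDegree ∣ e := by
    apply Nat.dvd_gcd
    · rw [hv', natDegree_comp]; exact dvd_mul_left _ _
    · rw [hP', natDegree_comp]; exact dvd_mul_left _ _
  have := Nat.le_of_dvd (by omega) hdvd
  omega

end PartFive

section PartSix

variable {K : Type*} [Field K]

lemma distinct_degrees {P η : K[X]} {m D : ℕ} (hP : P.natDegree = m) (hη : η.natDegree = D)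
    (hm : 1 ≤ m) (hD : 1 ≤ D) (hc : Nat.Coprime m D) (r : ℕ → K[X])
    (h : ∑ a ∈ Finset.range m, (r a).comp P * η ^ a = 0) : ∀ a < m, r a = 0 := by
  have hη0 : η ≠ 0 := by rintro rfl; simp at hη; omega
  have hcomp0 : ∀ q : K[X], q.comp P = 0 → q = 0 := by
    intro q hq
    apply comp_right_cancel (h := P) (by omega)
    rw [hq, zero_comp]
  have key := degree_sum_eq_of_disjoint (fun a => (r a).comp P * η ^ a) (Finset.range m) (by
    rintro a ⟨ha, ha0⟩ b ⟨hb, hb0⟩ hab heq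
    simp only [Function.comp] at heq
    rw [degree_eq_natDegree ha0, degree_eq_natDegree hb0] at heq
    have heq' : ((r a).comp P * η ^ a).natDegree = ((r b).comp P * η ^ b).natDegree := by
      exact_mod_cast heq
    rw [natDegree_mul (left_ne_zero_of_mul ha0) (right_ne_zero_of_mul ha0),
      natDegree_mul (left_ne_zero_of_mul hb0) (right_ne_zero_of_mul hb0), natDegree_comp,
      natDegree_comp, natDegree_pow, natDegree_pow, hP, hη] at heq'
    rw [Finset.mem_range] at ha hb
    have h1 : a * D ≡ b * D [MOD m] := by
      have : (r a).natDegree * m + a * D ≡ (r b).natDegree * m + b * D [MOD m] := by rw [heq']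
      unfold Nat.ModEq at this ⊢
      simpa [Nat.add_mod] using this
    have h2 : a ≡ b [MOD m] := Nat.ModEq.cancel_right_of_coprime hc h1
    exact hab (Nat.ModEq.eq_of_lt_of_lt h2 ha hb))
  rw [h, degree_zero] at key
  intro a ha
  have h1 : ((r a).comp P * η ^ a).degree ≤ ⊥ := by
    rw [key]
    exact Finset.le_sup (f := fun a => ((r a).comp P * η ^ a).degree) (Finset.mem_range.2 ha)
  have h2 : (r a).comp P * η ^ a = 0 := degree_eq_bot.1 (le_bot_iff.1 h1)
  rcases mul_eq_zero.1 h2 with h3 | h3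
  · exact hcomp0 _ h3
  · exact absurd h3 (pow_ne_zero _ hη0)

/-- surjectivity onto the correspondence -/
lemma surj_corr [IsAlgClosed K] {F P η : K[X]} (hP1 : 1 ≤ P.natDegree) (hF1 : 1 ≤ F.natDegree)
    (h : F.comp P = P.comp η) (hc : Nat.Coprime P.natDegree F.natDegree) {x y : K}
    (hxy : F.eval x = P.eval y) : ∃ t, P.eval t = x ∧ η.eval t = y := by
  have hP0 : P ≠ 0 := by rintro rfl; simp at hP1
  have hlP : P.leadingCoeff ≠ 0 := leadingCoeff_ne_zero.2 hP0
  have hη : η.natDegree = F.natDegree := by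
    have := congrArg natDegree h
    rw [natDegree_comp, natDegree_comp, mul_comm] at this
    exact (Nat.eq_of_mul_eq_mul_left hP1 this).symm
  set c := P.leadingCoeff⁻¹ with hcdef
  have c0 : c ≠ 0 := inv_ne_zero hlP
  set Pm := C c * P with hPm
  have Pmm : Pm.Monic := by
    unfold Monic; rw [hPm, leadingCoeff_mul, leadingCoeff_C, inv_mul_cancel₀ hlP]
  have dPm : Pm.natDegree = P.natDegree := by rw [hPm, natDegree_C_mul c0]
  let φ : (K[X])[X] →+* K[X] := eval₂RingHom (compRingHom P) η
  have hφC : ∀ q : K[X], φ (C q) = q.comp P := by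
    intro q; simp [φ]
  have hφmap : ∀ q : K[X], φ (q.map C) = q.comp η := by
    intro q
    simp only [φ, coe_eval₂RingHom, eval₂_map]
    have : (compRingHom P).comp C = C := by ext a; simp
    rw [this]; rfl
  let E : (K[X])[X] := Pm.map C - C (C c * F)
  have Em : E.Monic := by
    apply (Pmm.map C).sub_of_left
    refine lt_of_le_of_lt degree_C_le ?_
    rw [degree_eq_natDegree (Pmm.map C).ne_zero, Pmm.natDegree_map, dPm]
    exact_mod_cast hP1
  have dE : E.natDegree = P.natDegree := by
    simp only [E]
    rw [natDegree_sub_C, Pmm.natDegree_map, dPm]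
  have hφE : φ E = 0 := by
    simp only [E]
    rw [map_sub, hφC, hφmap, hPm, mul_comp, mul_comp, h, C_comp, C_comp, sub_self]
  have hker : ∀ r, φ r = 0 → E ∣ r := by
    intro r hr
    have hdm := modByMonic_add_div r E
    have h1 : φ (r %ₘ E) = 0 := by
      have := congrArg φ hdm
      rw [map_add, map_mul, hφE, zero_mul, add_zero, hr] at this
      exact this
    set s := r %ₘ E with hs
    have hsd : s.natDegree < P.natDegree := by
      by_cases hs0 : s = 0
      · rw [hs0]; simp; omega
      · rw [← dE]
        exact natDegree_lt_natDegree hs0 (degree_modByMonic_lt r Em)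
    have h2 : ∑ a ∈ Finset.range P.natDegree, (s.coeff a).comp P * η ^ a = 0 := by
      rw [← h1]
      simp only [φ, coe_eval₂RingHom]
      rw [eval₂_eq_sum_range' _ hsd]
      simp
    have h3 := distinct_degrees rfl hη hP1 hF1 hc _ h2
    have h4 : s = 0 := by
      ext1 a
      by_cases ha : a < P.natDegree
      · rw [h3 a ha, coeff_zero]
      · rw [coeff_zero]; exact coeff_eq_zero_of_natDegree_lt (by omega)
    rw [h4, zero_add] at hdm
    exact ⟨_, hdm.symm⟩
  let ev : (K[X])[X] →+* K := eval₂RingHom (evalRingHom x) y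
  have hevE : ev E = 0 := by
    simp only [E, ev, map_sub, coe_eval₂RingHom, eval₂_map, eval₂_C]
    have : (evalRingHom x).comp C = RingHom.id K := by ext a; simp
    rw [this, eval₂_id]
    simp [hPm, hxy]
  let _ : Algebra (K[X])[X] K[X] := φ.toAlgebra
  have halg : algebraMap (K[X])[X] K[X] = φ := rfl
  have hintX : IsIntegral (K[X])[X] (X : K[X]) := by
    refine ⟨Pm.map (C.comp C) - C (C (C c * X)), ?_, ?_⟩
    · apply (Pmm.map _).sub_of_left
      refine lt_of_le_of_lt degree_C_le ?_
      rw [degree_eq_natDegree (Pmm.map _).ne_zero, Pmm.natDegree_map, dPm]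
      exact_mod_cast hP1
    · rw [halg, eval₂_sub, eval₂_map, eval₂_C, hφC]
      have : φ.comp (C.comp C) = C := by
        ext1 a
        rw [RingHom.comp_apply, RingHom.comp_apply, hφC, C_comp]
      rw [this, eval₂_C_X, hPm]
      simp
  have hIntegral : Algebra.IsIntegral (K[X])[X] K[X] := by
    constructor
    intro q
    induction q using Polynomial.induction_on' with
    | add p q hp hq => exact hp.add hq
    | monomial n a =>
      rw [← C_mul_X_pow_eq_monomial]
      refine IsIntegral.mul ?_ (hintX.pow n)
      have : (C a : K[X]) = algebraMap (K[X])[X] K[X] (C (C a)) := by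
        rw [halg, hφC, C_comp]
      rw [this]
      exact isIntegral_algebraMap
  have hkp : (RingHom.ker ev).IsPrime := RingHom.ker_isPrime ev
  obtain ⟨Q, hQp, hQ⟩ := Ideal.exists_ideal_over_prime_of_isIntegral_of_isDomain
    (S := K[X]) (RingHom.ker ev) (by
      intro r hr
      rw [RingHom.mem_ker] at hr ⊢
      obtain ⟨s, rfl⟩ := hker r hr
      rw [map_mul, hevE, zero_mul])
  have hmem : ∀ r, φ r ∈ Q ↔ ev r = 0 := by
    intro r
    rw [← RingHom.mem_ker, ← hQ, Ideal.mem_comap]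
    exact Iff.rfl
  have hQP : P - C x ∈ Q := by
    have := (hmem (C X - C (C x))).2 (by simp [ev])
    rwa [map_sub, hφC, hφC, X_comp, C_comp] at this
  have hQη : η - C y ∈ Q := by
    have := (hmem (X - C (C y))).2 (by simp [ev])
    rw [map_sub, hφC, C_comp] at this
    simpa [φ] using this
  have hunit : ∀ a : K, C a ∈ Q → a = 0 := by
    intro a ha
    by_contra ha0
    exact hQp.ne_top (Ideal.eq_top_of_isUnit_mem _ ha (isUnit_C.2 (isUnit_iff_ne_zero.2 ha0)))
  have hPx0 : P - C x ≠ 0 := by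
    intro h0
    have := congrArg natDegree h0
    rw [natDegree_sub_C] at this
    simp at this; omega
  obtain ⟨t, ht⟩ : ∃ t, X - C t ∈ Q := by
    have := hQP
    rw [(IsAlgClosed.splits (P - C x)).eq_prod_roots] at this
    rcases hQp.mem_or_mem this with h1 | h1
    · exact absurd (hunit _ h1) (leadingCoeff_ne_zero.2 hPx0)
    · obtain ⟨p, hp, hpQ⟩ := (hQp.multiset_prod_mem_iff_exists_mem _).1 h1
      obtain ⟨t, -, rfl⟩ := Multiset.mem_map.1 hp
      exact ⟨t, hpQ⟩
  have hevalQ : ∀ q ∈ Q, q.eval t = 0 := by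
    intro q hq
    apply hunit
    have h1 : X - C t ∣ q - C (q.eval t) := by
      rw [dvd_iff_isRoot]; simp
    have h2 : q - C (q.eval t) ∈ Q := Ideal.mem_of_dvd _ h1 ht
    have := Q.sub_mem hq h2
    simpa using this
  refine ⟨t, ?_, ?_⟩
  · have := hevalQ _ hQP
    simpa [sub_eq_zero] using this
  · have := hevalQ _ hQη
    simpa [sub_eq_zero] using this

end PartSix

section PartSeven
variable {K : Type*} [Field K]

/-- `z` is a critical value of `P`. -/
def CV (P : K[X]) (z : K) : Prop := ∃ y, P.eval y = z ∧ P.derivative.eval y = 0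

theorem cv_back [IsAlgClosed K] {F P η : K[X]} (hP1 : 1 ≤ P.natDegree) (hF1 : 1 ≤ F.natDegree)
    (h : F.comp P = P.comp η) (hc : Nat.Coprime P.natDegree F.natDegree) {x : K}
    (hx : CV P (F.eval x)) (hx' : F.derivative.eval x ≠ 0) : CV P x := by
  obtain ⟨y, hy, hy'⟩ := hx
  obtain ⟨t, ht, hty⟩ := surj_corr hP1 hF1 h hc hy.symm
  refine ⟨t, ht, ?_⟩
  have := congrArg (fun q => (derivative q).eval t) h
  simp only [derivative_comp, eval_mul, eval_comp, ht, hty, hy', mul_zero] at this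
  rcases mul_eq_zero.1 this with h1 | h1
  · exact h1
  · exact absurd h1 hx'

variable [IsAlgClosed K] [CharZero K]

theorem cv_finite {P : K[X]} (hP1 : 1 ≤ P.natDegree) : {z | CV P z}.Finite := by
  have h0 : P.derivative ≠ 0 := by
    intro h0
    have := natDegree_eq_zero_of_derivative_eq_zero h0
    omega
  classical
  refine (P.derivative.roots.toFinset.image (fun y => P.eval y)).finite_toSet.subset ?_
  rintro z ⟨y, hy, hy'⟩
  simp only [Finset.coe_image, Set.mem_image, Finset.mem_coe, Multiset.mem_toFinset]
  exact ⟨y, (mem_roots h0).2 hy', hy⟩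

theorem dvd_one (F : K[X]) (S : Finset K) (hF : 2 ≤ F.natDegree)
    (hS : ∀ x, F.eval x ∈ S → F.derivative.eval x ≠ 0 → x ∈ S) {z : K} (hz : z ∈ S) :
    F - C z ∣ (∏ z ∈ S, (X - C z)) * (F.derivative * F.derivative) := by
  classical
  have hd0 : F.derivative ≠ 0 := by
    intro h0
    have := natDegree_eq_zero_of_derivative_eq_zero h0
    omega
  have hFz : F - C z ≠ 0 := by
    intro h0
    have := congrArg natDegree h0
    rw [natDegree_sub_C] at this
    simp at this; omega
  have hQ0 : (∏ z ∈ S, (X - C z)) ≠ 0 := Finset.prod_ne_zero_iff.2 fun a _ => X_sub_C_ne_zero a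
  have hR0 : (∏ z ∈ S, (X - C z)) * (F.derivative * F.derivative) ≠ 0 :=
    mul_ne_zero hQ0 (mul_ne_zero hd0 hd0)
  refine (IsAlgClosed.splits (F - C z)).dvd_of_roots_le_roots hFz ?_
  rw [Multiset.le_iff_count]
  intro x
  rw [count_roots, count_roots, rootMultiplicity_mul hR0, rootMultiplicity_mul (mul_ne_zero hd0 hd0)]
  by_cases hx : (F - C z).IsRoot x
  · have h1 := derivative_rootMultiplicity_of_root hx
    rw [derivative_sub, derivative_C, sub_zero] at h1
    by_cases hx' : F.derivative.eval x = 0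
    · have : 0 < F.derivative.rootMultiplicity x := (rootMultiplicity_pos hd0).2 hx'
      omega
    · have hxS : x ∈ S := by
        apply hS x _ hx'
        have : F.eval x = z := by simpa [IsRoot, sub_eq_zero] using hx
        rwa [this]
      have : 0 < (∏ z ∈ S, (X - C z)).rootMultiplicity x := by
        rw [rootMultiplicity_pos hQ0, IsRoot, eval_prod]
        exact Finset.prod_eq_zero hxS (by simp)
      omega
  · rw [rootMultiplicity_eq_zero hx]; omega

theorem dvd_all (F : K[X]) (S : Finset K) (hF : 2 ≤ F.natDegree)
    (hS : ∀ x, F.eval x ∈ S → F.derivative.eval x ≠ 0 → x ∈ S) :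
    (∏ z ∈ S, (F - C z)) ∣ (∏ z ∈ S, (X - C z)) * (F.derivative * F.derivative) := by
  refine Finset.prod_dvd_of_coprime ?_ fun z hz => dvd_one F S hF hS hz
  intro a _ b _ hab
  refine ⟨C (b - a)⁻¹, - C (b - a)⁻¹, ?_⟩
  have : b - a ≠ 0 := sub_ne_zero.2 (Ne.symm hab)
  have h2 : C (b - a)⁻¹ * (F - C a) + -C (b - a)⁻¹ * (F - C b) = C (b-a)⁻¹ * C (b - a) := by
    rw [C_sub]; ring
  rw [h2, ← C_mul, inv_mul_cancel₀ this, C_1]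

theorem natDegree_derivative_eq' {F : K[X]} (hF : 2 ≤ F.natDegree) :
    F.derivative.natDegree = F.natDegree - 1 := by
  rw [natDegree_derivative]

theorem card_le_two (F : K[X]) (S : Finset K) (hF : 2 ≤ F.natDegree)
    (hS : ∀ x, F.eval x ∈ S → F.derivative.eval x ≠ 0 → x ∈ S) : S.card ≤ 2 := by
  have hd0 : F.derivative ≠ 0 := by
    intro h0
    have := natDegree_eq_zero_of_derivative_eq_zero h0
    omega
  have hQ0 : (∏ z ∈ S, (X - C z)) ≠ 0 := Finset.prod_ne_zero_iff.2 fun a _ => X_sub_C_ne_zero a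
  have h := natDegree_le_of_dvd (dvd_all F S hF hS) (mul_ne_zero hQ0 (mul_ne_zero hd0 hd0))
  rw [natDegree_mul hQ0 (mul_ne_zero hd0 hd0), natDegree_mul hd0 hd0,
    natDegree_derivative_eq' hF, natDegree_finset_prod_X_sub_C_eq_card,
    natDegree_prod] at h
  · simp only [natDegree_sub_C, Finset.sum_const, smul_eq_mul] at h
    obtain ⟨e, he⟩ : ∃ e, F.natDegree = e + 2 := ⟨F.natDegree - 2, by omega⟩
    rw [he] at h
    by_contra hc
    have : 3 ≤ S.card := by omega
    have : 3 * (e + 1) ≤ S.card * (e + 1) := Nat.mul_le_mul_right _ this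
    have h3 : S.card * (e + 2) = S.card * (e + 1) + S.card := by ring
    omega
  · intro i _ h0
    have := congrArg natDegree h0
    rw [natDegree_sub_C] at this
    simp at this; omega

theorem two_identity (F : K[X]) {a b : K} (hab : a ≠ b) (hF : 2 ≤ F.natDegree)
    (hS : ∀ x, (F.eval x = a ∨ F.eval x = b) → F.derivative.eval x ≠ 0 → (x = a ∨ x = b)) :
    C ((F.natDegree : K) ^ 2) * ((F - C a) * (F - C b))
      = ((X - C a) * (X - C b)) * (F.derivative * F.derivative) := by
  classical
  have hd0 : F.derivative ≠ 0 := by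
    intro h0
    have := natDegree_eq_zero_of_derivative_eq_zero h0
    omega
  have hn0 : ∀ z, F - C z ≠ 0 := by
    intro i h0
    have := congrArg natDegree h0
    rw [natDegree_sub_C] at this
    simp at this; omega
  have h := dvd_all F {a, b} hF (by simpa using hS)
  rw [Finset.prod_pair hab, Finset.prod_pair hab] at h
  obtain ⟨w, hw⟩ := h
  have hR0 : ((X - C a) * (X - C b)) * (F.derivative * F.derivative) ≠ 0 :=
    mul_ne_zero (mul_ne_zero (X_sub_C_ne_zero _) (X_sub_C_ne_zero _)) (mul_ne_zero hd0 hd0)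
  have hw0 : w ≠ 0 := by rintro rfl; exact hR0 (by rw [hw, mul_zero])
  have hdeg := congrArg natDegree hw
  rw [natDegree_mul (mul_ne_zero (X_sub_C_ne_zero _) (X_sub_C_ne_zero _)) (mul_ne_zero hd0 hd0),
    natDegree_mul hd0 hd0, natDegree_mul (X_sub_C_ne_zero _) (X_sub_C_ne_zero _),
    natDegree_mul (mul_ne_zero (hn0 _) (hn0 _)) hw0, natDegree_mul (hn0 _) (hn0 _),
    natDegree_X_sub_C, natDegree_X_sub_C, natDegree_sub_C, natDegree_sub_C,
    natDegree_derivative_eq' hF] at hdeg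
  have hwc : w.natDegree = 0 := by omega
  rw [eq_C_of_natDegree_eq_zero hwc] at hw
  have hlead := congrArg leadingCoeff hw
  have hlF : ∀ z, (F - C z).leadingCoeff = F.leadingCoeff := by
    intro z
    rw [leadingCoeff, natDegree_sub_C, coeff_sub, coeff_C, if_neg (by omega), sub_zero, leadingCoeff]
  simp only [leadingCoeff_mul, leadingCoeff_X_sub_C, hlF, leadingCoeff_C, leadingCoeff_derivative] at hlead
  have hl0 : F.leadingCoeff ≠ 0 := leadingCoeff_ne_zero.2 (by rintro rfl; simp at hF)
  have hc : w.coeff 0 = (F.natDegree : K) ^ 2 := by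
    have : (F.leadingCoeff * F.leadingCoeff) * w.coeff 0
        = (F.leadingCoeff * F.leadingCoeff) * (F.natDegree : K) ^ 2 := by
      rw [← hlead]; ring
    exact mul_left_cancel₀ (mul_ne_zero hl0 hl0) this
  rw [hw, hc]; ring
end PartSeven

section PartEight
variable {K : Type*} [Field K] [CharZero K]

theorem cheb_natDegree (n : ℕ) : (cheb K n).natDegree = n := by
  have : Invertible (2 : K) := invertibleOfNonzero two_ne_zero
  rw [cheb, dickson_one_one_eq_chebyshev_T]
  have h2 : (2 : K[X]) = C 2 := (map_ofNat C 2).symm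
  rw [h2, natDegree_C_mul two_ne_zero, natDegree_comp, Chebyshev.natDegree_T,
    natDegree_C_mul (by simp), natDegree_X]
  simp

theorem cheb_derivative (n : ℕ) :
    derivative (cheb K n) = C (n : K) * Chebyshev.S K ((n : ℤ) - 1) := by
  have : Invertible (2 : K) := invertibleOfNonzero two_ne_zero
  rw [cheb, dickson_one_one_eq_chebyshev_T, Chebyshev.S_eq_U_comp_half_mul_X]
  have h2 : (2 : K[X]) = C 2 := (map_ofNat C 2).symm
  rw [h2, derivative_C_mul, derivative_comp, Chebyshev.T_derivative_eq_U, derivative_C_mul,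
    derivative_X, mul_one, mul_comp]
  have h3 : (((n : ℤ) : K[X])).comp (C ⅟2 * X) = C (n : K) := by simp
  have h4 : (C (2:K)) * C (⅟(2:K)) = 1 := by rw [← C_mul, mul_invOf_self, C_1]
  rw [h3]
  linear_combination (C (n:K) * (Chebyshev.U K ((n:ℤ) - 1)).comp (C ⅟2 * X)) * h4

theorem cheb_ode (n : ℕ) : (X ^ 2 - 4) * (derivative (cheb K n)) ^ 2
    = C ((n : K) ^ 2) * ((cheb K n) ^ 2 - 4) := by
  have h1 := Chebyshev.S_sq_add_S_sq K ((n : ℤ) - 1)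
  have h2 := Chebyshev.C_eq_S_sub_X_mul_S K (n : ℤ)
  rw [cheb_derivative, cheb, dickson_one_one_eq_chebyshev_C, h2, C_pow]
  rw [sub_add_cancel] at h1
  linear_combination (-4 * (C (n:K))^2) * h1

theorem ode_second {g : K[X]} {n : ℕ} (hg : 1 ≤ g.natDegree)
    (h : (X ^ 2 - 4) * (derivative g) ^ 2 = C ((n : K) ^ 2) * (g ^ 2 - 4)) :
    X * derivative g + (X ^ 2 - 4) * derivative (derivative g) = C ((n : K) ^ 2) * g := by
  have hd0 : derivative g ≠ 0 := by
    intro h0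
    have := derivative_eq_zero.1 h0
    omega
  have h4 : derivative (4 : K[X]) = 0 := by
    have : (4 : K[X]) = C 4 := (map_ofNat C 4).symm
    rw [this, derivative_C]
  have h1 := congrArg derivative h
  simp only [derivative_mul, derivative_sub, derivative_pow, derivative_C, h4, derivative_X] at h1
  have h2 : (2 : K[X]) ≠ 0 := by
    have : (2 : K[X]) = C 2 := (map_ofNat C 2).symm
    rw [this]; exact C_ne_zero.2 two_ne_zero
  apply mul_left_cancel₀ (mul_ne_zero h2 hd0)
  push_cast at h1
  norm_num at h1
  have h3 : (C (2:K)) = (2 : K[X]) := map_ofNat C 2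
  rw [h3] at h1
  rw [C_pow, map_natCast]
  linear_combination h1

theorem ode_zero {r : K[X]} {n : ℕ} (hr : r.natDegree < n)
    (h : X * derivative r + (X ^ 2 - 4) * derivative (derivative r) = C ((n : K) ^ 2) * r) :
    r = 0 := by
  by_contra hr0
  set k := r.natDegree with hk
  have hl : r.coeff k ≠ 0 := by rw [hk]; exact leadingCoeff_ne_zero.2 hr0
  have h4 : (4 : K[X]) = C 4 := (map_ofNat C 4).symm
  have hc := congrArg (fun q => q.coeff k) h
  simp only [coeff_add, sub_mul, coeff_sub, h4, coeff_C_mul] at hc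
  have e0 : (derivative (derivative r)).coeff k = 0 := by
    rw [coeff_derivative, coeff_derivative, coeff_eq_zero_of_natDegree_lt (by omega)]; simp
  have e1 : (X * derivative r).coeff k = k * r.coeff k := by
    rcases k with _ | j
    · simp
    · rw [coeff_X_mul, coeff_derivative]; push_cast; ring
  have e2 : (X ^ 2 * derivative (derivative r)).coeff k = k * (k - 1) * r.coeff k := by
    rcases k with _ | _ | j
    · rw [coeff_X_pow_mul']; simp
    · rw [coeff_X_pow_mul']; simp
    · rw [coeff_X_pow_mul, coeff_derivative, coeff_derivative]; push_cast; ring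
  rw [e0, e1, e2] at hc
  have h5 : ((k : K) ^ 2 - (n : K) ^ 2) * r.coeff k = 0 := by linear_combination hc
  rcases mul_eq_zero.1 h5 with h6 | h6
  · have : ((k ^ 2 : ℕ) : K) = ((n ^ 2 : ℕ) : K) := by push_cast; linear_combination h6
    have := Nat.cast_injective this
    have := Nat.pow_left_injective (n := 2) (by norm_num) this
    omega
  · exact hl h6

theorem eq_cheb {g : K[X]} {n : ℕ} (hn : 1 ≤ n) (hg : g.natDegree = n)
    (h : (X ^ 2 - 4) * (derivative g) ^ 2 = C ((n : K) ^ 2) * (g ^ 2 - 4)) :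
    g = cheb K n ∨ g = - cheb K n := by
  have hT := cheb_ode (K := K) n
  have hTd := cheb_natDegree (K := K) n
  set T := cheb K n with hTdef
  have o1 := ode_second (by omega) h
  have o2 := ode_second (by omega) hT
  have hT0 : T ≠ 0 := by intro h0; rw [h0] at hTd; simp at hTd; omega
  have hg0 : g ≠ 0 := by intro h0; rw [h0] at hg; simp at hg; omega
  have hlT : T.leadingCoeff ≠ 0 := leadingCoeff_ne_zero.2 hT0
  set a := g.leadingCoeff / T.leadingCoeff with ha
  have ha0 : a ≠ 0 := div_ne_zero (leadingCoeff_ne_zero.2 hg0) hlT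
  have hga : g = C a * T := by
    by_contra hne
    have hr0 : g - C a * T ≠ 0 := sub_ne_zero.2 hne
    apply hr0
    refine ode_zero (n := n) ?_ ?_
    · have hlt : (g - C a * T).degree < g.degree := by
        apply degree_sub_lt_left
        · rw [degree_C_mul ha0, degree_eq_natDegree hg0, degree_eq_natDegree hT0, hg, hTd]
        · exact hg0
        · rw [leadingCoeff_mul, leadingCoeff_C, ha, div_mul_cancel₀ _ hlT]
      have := natDegree_lt_natDegree hr0 hlt
      omega
    · simp only [derivative_sub, derivative_C_mul]
      linear_combination o1 - C a * o2
  have hn0 : ((n : K)) ≠ 0 := Nat.cast_ne_zero.2 (by omega)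
  have ha2 : a ^ 2 = 1 := by
    rw [hga, derivative_C_mul] at h
    have h5 : C ((n:K)^2 * 4 * (a^2 - 1)) = 0 := by
      have h4 : (C (4 : K)) = (4 : K[X]) := map_ofNat C 4
      simp only [C_mul, C_sub, C_pow, C_1, h4] at h hT ⊢
      linear_combination (C a)^2 * hT - h
    have h6 := C_eq_zero.1 h5
    have h7 : a ^ 2 - 1 = 0 := by
      rcases mul_eq_zero.1 h6 with h8 | h8
      · exact absurd h8 (mul_ne_zero (pow_ne_zero _ hn0) (by norm_num))
      · exact h8
    linear_combination h7
  rcases mul_self_eq_one_iff.1 ((sq a).symm.trans ha2) with h1 | h1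
  · left; rw [hga, h1]; simp
  · right; rw [hga, h1]; simp

theorem prop_of_cross {a b F : K[X]} (hF : 2 ≤ F.natDegree) (ha : a ≠ 0) (hb : b ≠ 0)
    (hd : a.natDegree = b.natDegree) (h : a.comp F * b = a * b.comp F) :
    a = C (a.leadingCoeff / b.leadingCoeff) * b := by
  set c := a.leadingCoeff / b.leadingCoeff with hc
  have hlb : b.leadingCoeff ≠ 0 := leadingCoeff_ne_zero.2 hb
  have hc0 : c ≠ 0 := div_ne_zero (leadingCoeff_ne_zero.2 ha) hlb
  by_contra hne
  have hr0 : a - C c * b ≠ 0 := sub_ne_zero.2 hne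
  have hlt : (a - C c * b).degree < a.degree := by
    apply degree_sub_lt_left
    · rw [degree_C_mul hc0, degree_eq_natDegree ha, degree_eq_natDegree hb, hd]
    · exact ha
    · rw [leadingCoeff_mul, leadingCoeff_C, hc, div_mul_cancel₀ _ hlb]
  have hlt2 := natDegree_lt_natDegree hr0 hlt
  set r := a - C c * b with hr
  have h2 : r.comp F * b = r * b.comp F := by
    rw [hr, sub_comp, mul_comp, C_comp]; linear_combination h
  have hcF : ∀ q : K[X], q ≠ 0 → q.comp F ≠ 0 := by
    intro q hq h0
    rw [comp_eq_zero_iff] at h0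
    rcases h0 with h0 | ⟨_, h0⟩
    · exact hq h0
    · rw [h0] at hF; simp at hF
  have h3 := congrArg natDegree h2
  rw [natDegree_mul (hcF _ hr0) hb, natDegree_mul hr0 (hcF _ hb), natDegree_comp, natDegree_comp] at h3
  obtain ⟨e, he⟩ : ∃ e, F.natDegree = e + 2 := ⟨F.natDegree - 2, by omega⟩
  rw [he] at h3
  have : r.natDegree * (e + 1) < b.natDegree * (e + 1) := Nat.mul_lt_mul_of_pos_right (by omega) (by omega)
  have e1 : r.natDegree * (e + 2) = r.natDegree * (e + 1) + r.natDegree := by ring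
  have e2 : b.natDegree * (e + 2) = b.natDegree * (e + 1) + b.natDegree := by ring
  omega

theorem descend_identity {f F : K[X]} {a b : K} (hf : 2 ≤ f.natDegree) (hF : 2 ≤ F.natDegree)
    (hcomm : F.comp f = f.comp F)
    (h : C ((F.natDegree : K) ^ 2) * ((F - C a) * (F - C b))
      = ((X - C a) * (X - C b)) * (F.derivative * F.derivative)) :
    ((X - C a) * (X - C b)) * (f.derivative * f.derivative)
      = C ((f.natDegree : K) ^ 2) * ((f - C a) * (f - C b)) := by
  have hd0 : f.derivative ≠ 0 := by
    intro h0
    have := derivative_eq_zero.1 h0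
    omega
  have hn0 : ∀ z, f - C z ≠ 0 := by
    intro i h0
    have := congrArg natDegree h0
    rw [natDegree_sub_C] at this
    simp at this; omega
  have hlF : ∀ z, (f - C z).leadingCoeff = f.leadingCoeff := by
    intro z
    rw [leadingCoeff, natDegree_sub_C, coeff_sub, coeff_C, if_neg (by omega), sub_zero, leadingCoeff]
  have hl0 : f.leadingCoeff ≠ 0 := leadingCoeff_ne_zero.2 (by rintro rfl; simp at hf)
  have hnum : ((X - C a) * (X - C b)) * (f.derivative * f.derivative) ≠ 0 :=
    mul_ne_zero (mul_ne_zero (X_sub_C_ne_zero _) (X_sub_C_ne_zero _)) (mul_ne_zero hd0 hd0)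
  have hden : (f - C a) * (f - C b) ≠ 0 := mul_ne_zero (hn0 _) (hn0 _)
  have hD : C ((F.natDegree : K) ^ 2) ≠ 0 :=
    C_ne_zero.2 (pow_ne_zero _ (Nat.cast_ne_zero.2 (by omega)))
  have key := prop_of_cross (a := ((X - C a) * (X - C b)) * (f.derivative * f.derivative))
    (b := (f - C a) * (f - C b)) hF hnum hden ?_ ?_
  · rw [key]
    congr 2
    simp only [leadingCoeff_mul, leadingCoeff_X_sub_C, hlF, leadingCoeff_derivative]
    field_simp
  · rw [natDegree_mul (mul_ne_zero (X_sub_C_ne_zero _) (X_sub_C_ne_zero _)) (mul_ne_zero hd0 hd0),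
      natDegree_mul hd0 hd0, natDegree_mul (X_sub_C_ne_zero _) (X_sub_C_ne_zero _),
      natDegree_mul (hn0 _) (hn0 _),
      natDegree_X_sub_C, natDegree_X_sub_C, natDegree_sub_C, natDegree_sub_C,
      natDegree_derivative]
    omega
  · apply mul_left_cancel₀ hD
    have h1 := congrArg (fun q => q.comp f) h
    have h2 := congrArg derivative hcomm
    simp only [derivative_comp] at h2
    simp only [mul_comp, sub_comp, C_comp, X_comp, hcomm] at h1 ⊢
    have h3 : (f.derivative * (F.derivative.comp f)) * (f.derivative * (F.derivative.comp f))
        = (F.derivative * (f.derivative.comp F)) * (F.derivative * (f.derivative.comp F)) := by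
      rw [h2]
    linear_combination ((f - C a) * (f - C b) * (f.derivative.comp F) * (f.derivative.comp F)) * h
      - ((X - C a) * (X - C b) * f.derivative * f.derivative) * h1
      - ((X - C a) * (X - C b) * (f - C a) * (f - C b)) * h3

theorem cheb_of_identity {f F : K[X]} {a b : K} (hab : a ≠ b) (hf : 2 ≤ f.natDegree)
    (hF : 2 ≤ F.natDegree) (hcomm : F.comp f = f.comp F)
    (h : C ((F.natDegree : K) ^ 2) * ((F - C a) * (F - C b))
      = ((X - C a) * (X - C b)) * (F.derivative * F.derivative)) :
    LinConj f (cheb K f.natDegree) ∨ LinConj f (-(cheb K f.natDegree)) := by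
  have h1 := descend_identity hf hF hcomm h
  set α : K := (a - b) / 4 with hα
  set β : K := (a + b) / 2 with hβ
  have hα0 : α ≠ 0 := div_ne_zero (sub_ne_zero.2 hab) (by norm_num)
  have ea : a = β + 2 * α := by rw [hα, hβ]; ring
  have eb : b = β - 2 * α := by rw [hα, hβ]; ring
  obtain ⟨l1, l2⟩ := lin_inv (a := α) (b := β) hα0
  have d1 := degree_lin (a := α) (b := β) hα0
  have d2 := degree_lin_inv (a := α) (b := β) hα0
  set ℓ := C α * X + C β with hℓ
  set ℓi := C α⁻¹ * X - C (α⁻¹ * β) with hℓi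
  set g := ℓi.comp (f.comp ℓ) with hg
  have hfg : f.comp ℓ = ℓ.comp g := by
    rw [hg, ← comp_assoc ℓ, l1, X_comp]
  have hfeq : f = ℓ.comp (g.comp ℓi) := by
    rw [← comp_assoc, ← hfg, comp_assoc, l1, comp_X]
  have hgd : g.natDegree = f.natDegree := by
    rw [hg, natDegree_comp, natDegree_comp, natDegree_of_degree_one d1,
      natDegree_of_degree_one d2]; ring
  have hder : C α * (f.derivative.comp ℓ) = C α * g.derivative := by
    have := congrArg derivative hfg
    rw [hℓ, derivative_comp, add_comp, mul_comp, C_comp, X_comp, C_comp] at this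
    simpa using this
  have hder' := mul_left_cancel₀ (C_ne_zero.2 hα0) hder
  have hode : (X ^ 2 - 4) * (derivative g) ^ 2 = C ((f.natDegree : K) ^ 2) * (g ^ 2 - 4) := by
    have h2 := congrArg (fun q => q.comp ℓ) h1
    simp only [mul_comp, sub_comp, C_comp, X_comp, hder', hfg] at h2
    have h3 : ℓ.comp g = C α * g + C β := by rw [hℓ]; simp
    rw [h3, ea, eb, hℓ] at h2
    have c2 : (C (2:K)) = (2 : K[X]) := map_ofNat C 2
    simp only [C_add, C_sub, C_mul, c2] at h2
    apply mul_left_cancel₀ (pow_ne_zero 2 (C_ne_zero.2 hα0))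
    linear_combination h2
  rcases eq_cheb (by omega) hgd hode with h4 | h4
  · left
    exact ⟨ℓ, ℓi, d1, d2, l1, l2, by rw [← h4]; exact hfeq⟩
  · right
    exact ⟨ℓ, ℓi, d1, d2, l1, l2, by rw [← h4]; exact hfeq⟩
end PartEight

section PartNine
variable {K : Type*} [Field K] [CharZero K]

theorem coeff_X_mul_derivative (r : K[X]) (k : ℕ) : (X * derivative r).coeff k = k * r.coeff k := by
  rcases k with _ | j
  · simp
  · rw [coeff_X_mul, coeff_derivative]; push_cast; ring

theorem monomial_of_euler {Q : K[X]} {m : ℕ} (h : X * derivative Q = C (m : K) * Q) :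
    Q = C (Q.coeff m) * X ^ m := by
  ext k
  rw [coeff_C_mul, coeff_X_pow]
  split_ifs with hk
  · rw [hk, mul_one]
  · have := congrArg (fun q => q.coeff k) h
    simp only [coeff_X_mul_derivative, coeff_C_mul] at this
    have h2 : ((k : K) - m) * Q.coeff k = 0 := by linear_combination this
    rcases mul_eq_zero.1 h2 with h3 | h3
    · exact absurd (Nat.cast_injective (sub_eq_zero.1 h3)) hk
    · rw [h3, mul_zero]

variable [IsAlgClosed K]

theorem power_form {P : K[X]} (hP : 1 ≤ P.natDegree) {z : K} (hz : ∀ y, CV P y → y = z) :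
    ∃ γ b : K, γ ≠ 0 ∧ P = (X ^ P.natDegree + C z).comp (C γ * X + C b) := by
  classical
  set m := P.natDegree with hm
  have hd0 : P.derivative ≠ 0 := by
    intro h0
    have := derivative_eq_zero.1 h0
    omega
  have hPz : P - C z ≠ 0 := by
    intro h0
    have := congrArg natDegree h0
    rw [natDegree_sub_C] at this
    simp at this; omega
  have hdvd : P.derivative ∣ P - C z := by
    refine (IsAlgClosed.splits P.derivative).dvd_of_roots_le_roots hd0 ?_
    rw [Multiset.le_iff_count]
    intro x
    rw [count_roots, count_roots]
    by_cases hx : P.derivative.IsRoot x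
    · have h1 : P.eval x = z := hz _ ⟨x, rfl, hx⟩
      have h2 : (P - C z).IsRoot x := by simp [IsRoot, h1]
      have h3 := derivative_rootMultiplicity_of_root h2
      rw [derivative_sub, derivative_C, sub_zero] at h3
      omega
    · rw [rootMultiplicity_eq_zero hx]; omega
  obtain ⟨w, hw⟩ := hdvd
  have hw0 : w ≠ 0 := by rintro rfl; exact hPz (by rw [hw, mul_zero])
  have hwd : w.natDegree = 1 := by
    have := congrArg natDegree hw
    rw [natDegree_mul hd0 hw0, natDegree_derivative, natDegree_sub_C] at this
    omega
  have hlead := congrArg leadingCoeff hw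
  have hlP : (P - C z).leadingCoeff = P.leadingCoeff := by
    rw [leadingCoeff, natDegree_sub_C, coeff_sub, coeff_C, if_neg (by omega), sub_zero, leadingCoeff]
  have hl0 : P.leadingCoeff ≠ 0 := leadingCoeff_ne_zero.2 (by rintro rfl; simp at hm; omega)
  rw [leadingCoeff_mul, leadingCoeff_derivative, hlP, leadingCoeff, leadingCoeff, hwd, ← hm] at hlead
  have hm0 : (m : K) ≠ 0 := Nat.cast_ne_zero.2 (by omega)
  have hc0 : P.coeff m ≠ 0 := hl0
  have hw1 : (m : K) * w.coeff 1 = 1 := by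
    apply mul_left_cancel₀ hc0
    linear_combination -hlead
  have hwe : w = C (w.coeff 1) * X + C (w.coeff 0) := eq_X_add_C_of_natDegree_le_one (by omega)
  set α := - (m : K) * w.coeff 0 with hα
  have hE : (X - C α) * P.derivative = C (m : K) * (P - C z) := by
    rw [hw]
    have h5 : C (m : K) * w = X - C α := by
      rw [hwe, hα, mul_add, ← mul_assoc, ← C_mul, hw1, C_1]
      simp [sub_eq_add_neg]
    rw [← h5]; ring
  set Q := (P - C z).comp (X + C α) with hQ
  have hQE : X * derivative Q = C (m : K) * Q := by
    have := congrArg (fun q => q.comp (X + C α)) hE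
    simp only [mul_comp, sub_comp, X_comp, C_comp] at this
    rw [hQ, derivative_comp, sub_comp, C_comp, derivative_sub, derivative_C, sub_zero]
    simp only [derivative_add, derivative_X, derivative_C, add_zero, one_mul]
    rw [← this]; ring
  have hQm := monomial_of_euler hQE
  set c := Q.coeff m with hcdef
  have hcne : c ≠ 0 := by
    intro h0
    rw [h0, C_0, zero_mul] at hQm
    have := congrArg (fun q => q.comp (X - C α)) hQm
    rw [hQ] at this
    simp only [comp_assoc, add_comp, X_comp, C_comp, sub_add_cancel, comp_X, zero_comp] at this
    exact hPz this
  obtain ⟨γ, hγ⟩ := IsAlgClosed.exists_pow_nat_eq c (n := m) (by omega)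
  refine ⟨γ, - γ * α, ?_, ?_⟩
  · rintro rfl
    rw [zero_pow (by omega)] at hγ
    exact hcne hγ.symm
  · have := congrArg (fun q => q.comp (X - C α)) hQm
    rw [hQ] at this
    simp only [comp_assoc, add_comp, X_comp, C_comp, sub_add_cancel, comp_X, mul_comp, pow_comp] at this
    simp only [add_comp, X_comp, C_comp, pow_comp]
    have h6 : C γ * X + C (-γ * α) = C γ * (X - C α) := by
      simp; ring
    rw [h6, mul_pow, ← C_pow, hγ, ← this]; ring

theorem single_cv {f : K[X]} (hf : Disintegrated f) {M : ℕ} (hM : 1 ≤ M) {P₁ P₂ η₁ η₂ : K[X]}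
    (hP₁ : 1 ≤ P₁.natDegree) (hP₂ : 1 ≤ P₂.natDegree)
    (h₁ : (polyIter f M).comp P₁ = P₁.comp η₁) (h₂ : (polyIter f M).comp P₂ = P₂.comp η₂)
    (cop₁ : Nat.Coprime P₁.natDegree f.natDegree) (cop₂ : Nat.Coprime P₂.natDegree f.natDegree)
    {z₁ z₂ : K} (hz₁ : CV P₁ z₁) (hz₂ : CV P₂ z₂) : z₁ = z₂ := by
  classical
  by_contra hne
  obtain ⟨hδ, -, hT, hT'⟩ := hf
  have hFd : (polyIter f M).natDegree = f.natDegree ^ M := polyIter_natDegree f M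
  have hF2 : 2 ≤ (polyIter f M).natDegree := by
    rw [hFd]
    exact hδ.trans (Nat.le_self_pow (by omega) _)
  have hfin : ({z | CV P₁ z} ∪ {z | CV P₂ z}).Finite := (cv_finite hP₁).union (cv_finite hP₂)
  set S := hfin.toFinset with hSdef
  have hmem : ∀ z, z ∈ S ↔ (CV P₁ z ∨ CV P₂ z) := by
    intro z; rw [hSdef, Set.Finite.mem_toFinset]; exact Iff.rfl
  have hS : ∀ x, (polyIter f M).eval x ∈ S → (polyIter f M).derivative.eval x ≠ 0 → x ∈ S := by
    intro x hx hx'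
    rw [hmem] at hx ⊢
    rcases hx with hx | hx
    · exact Or.inl (cv_back hP₁ (by omega) h₁ (by rw [hFd]; exact cop₁.pow_right M) hx hx')
    · exact Or.inr (cv_back hP₂ (by omega) h₂ (by rw [hFd]; exact cop₂.pow_right M) hx hx')
  have hcard := card_le_two _ S hF2 hS
  have hsub : ({z₁, z₂} : Finset K) ⊆ S := by
    intro z hz
    rw [Finset.mem_insert, Finset.mem_singleton] at hz
    rw [hmem]
    rcases hz with rfl | rfl
    · exact Or.inl hz₁
    · exact Or.inr hz₂
  have hSeq : ({z₁, z₂} : Finset K) = S :=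
    Finset.eq_of_subset_of_card_le hsub (by rw [Finset.card_pair hne]; exact hcard)
  have key := two_identity (polyIter f M) hne hF2 (by
    intro x hx hx'
    have := hS x (by rw [← hSeq]; simpa using hx) hx'
    rw [← hSeq] at this
    simpa using this)
  rcases cheb_of_identity hne hδ hF2 (polyIter_comm f M) key with h | h
  · exact hT h
  · exact hT' h

/-- The class of prime-to-degree semiconjugacies. -/
def InP (f : K[X]) (M : ℕ) (P η : K[X]) : Prop :=
  1 ≤ P.natDegree ∧ (polyIter f M).comp P = P.comp η ∧ Nat.Coprime P.natDegree f.natDegree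

theorem exists_center {f : K[X]} (hf : Disintegrated f) {M : ℕ} (hM : 1 ≤ M) :
    ∃ z : K, ∀ P η, InP f M P η →
      ∃ γ b : K, γ ≠ 0 ∧ P = (X ^ P.natDegree + C z).comp (C γ * X + C b) := by
  by_cases h : ∃ P η z, InP f M P η ∧ CV P z
  · obtain ⟨P₀, η₀, z, ⟨a1, a2, a3⟩, hz⟩ := h
    refine ⟨z, ?_⟩
    rintro P η ⟨b1, b2, b3⟩
    exact power_form b1 fun y hy => single_cv hf hM b1 a1 b2 a2 b3 a3 hy hz
  · refine ⟨0, ?_⟩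
    rintro P η hP
    exact power_form hP.1 fun y hy => absurd ⟨P, η, y, hP, hy⟩ h

theorem pow_exists {f : K[X]} (hf2 : 2 ≤ f.natDegree) {M : ℕ} (hM : 1 ≤ M) {z : K}
    (hz : ∀ P η, InP f M P η →
      ∃ γ b : K, γ ≠ 0 ∧ P = (X ^ P.natDegree + C z).comp (C γ * X + C b))
    {P η : K[X]} (hP : InP f M P η) :
    ∃ k : K[X], (f.comp (X + C z) - C z).comp (X ^ P.natDegree) = k ^ P.natDegree := by
  obtain ⟨γ, b, hγ, hPe⟩ := hz P η hP
  obtain ⟨hP1, hPη, hPc⟩ := hP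
  obtain ⟨e, rfl⟩ : ∃ e, M = e + 1 := ⟨M - 1, by omega⟩
  have hηd : η.natDegree = f.natDegree ^ (e + 1) := by
    have := congrArg natDegree hPη
    rw [natDegree_comp, natDegree_comp, polyIter_natDegree, mul_comm] at this
    exact (Nat.eq_of_mul_eq_mul_left (by omega) this).symm
  have hpos : 0 < f.natDegree ^ e := pow_pos (by omega) _
  have hpos' : 0 < f.natDegree ^ (e + 1) := pow_pos (by omega) _
  have hvd : (f.comp P).natDegree = f.natDegree * P.natDegree := natDegree_comp
  have heq : (polyIter f e).comp (f.comp P) = P.comp η := by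
    rw [← hPη, polyIter_succ_right, comp_assoc]
  obtain ⟨h, P₁, v, e1, e2, e3⟩ := gcd_decomp heq (by rw [polyIter_natDegree]; omega)
    (by rw [hvd]; exact Nat.mul_pos (by omega) (by omega)) (by rw [hηd]; omega)
  rw [hvd, hηd, pow_succ', Nat.gcd_mul_left, (hPc.pow_right e).gcd_eq_one, mul_one] at e3
  have hP₁d : P₁.natDegree = P.natDegree := by
    have := congrArg natDegree e1
    rw [hvd, natDegree_comp, e3, mul_comm] at this
    exact (Nat.eq_of_mul_eq_mul_right (by omega) this).symm
  have hP₁ : InP f (e + 1) P₁ (h.comp v) := by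
    refine ⟨by omega, ?_, by rw [hP₁d]; exact hPc⟩
    apply comp_right_cancel (h := h) (by omega)
    rw [comp_assoc, ← e1, ← comp_assoc, polyIter_comm, comp_assoc, hPη, ← comp_assoc, e1,
      comp_assoc, e2]
    simp only [comp_assoc]
  obtain ⟨γ', b', hγ', hP₁e⟩ := hz _ _ hP₁
  obtain ⟨l1, l2⟩ := lin_inv (a := γ) (b := b) hγ
  set ℓ := C γ * X + C b
  set ℓi := C γ⁻¹ * X - C (γ⁻¹ * b)
  set ℓ' := C γ' * X + C b'
  rw [hP₁d] at hP₁e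
  refine ⟨(ℓ'.comp h).comp ℓi, ?_⟩
  have h7 : f.comp (X ^ P.natDegree + C z) = (X ^ P.natDegree + C z).comp ((ℓ'.comp h).comp ℓi) := by
    have h9 : (f.comp P).comp ℓi = (P₁.comp h).comp ℓi := by rw [e1]
    obtain ⟨m, hm⟩ : ∃ m, m = P.natDegree := ⟨_, rfl⟩
    rw [← hm] at hP₁e hPe ⊢
    rw [hP₁e, hPe] at h9
    simp only [comp_assoc, l1, comp_X] at h9
    rw [h9]
    simp only [comp_assoc]
  have h8 : (f.comp (X + C z) - C z).comp (X ^ P.natDegree) = f.comp (X ^ P.natDegree + C z) - C z := by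
    rw [sub_comp, comp_assoc, C_comp, add_comp, X_comp, C_comp]
  rw [h8, h7, add_comp, C_comp, pow_comp, X_comp, add_sub_cancel_right]
end PartNine

section PartTen
variable {K : Type*} [Field K] [CharZero K] [IsAlgClosed K]

theorem eq_of_pow_eq {a b : K[X]} {n : ℕ} (hn : 1 ≤ n) (hb : b ≠ 0) (h : a ^ n = b ^ n) :
    ∃ ξ : K, ξ ^ n = 1 ∧ a = C ξ * b := by
  have h1 : a ∣ b := (UniqueFactorizationMonoid.pow_dvd_pow_iff_dvd (by omega)).1 h.dvd
  have h2 : b ∣ a := (UniqueFactorizationMonoid.pow_dvd_pow_iff_dvd (by omega)).1 h.symm.dvd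
  obtain ⟨u, hu⟩ := associated_of_dvd_dvd h2 h1
  obtain ⟨c, hc, hcu⟩ := isUnit_iff.1 u.isUnit
  refine ⟨c, ?_, by rw [← hu, ← hcu, mul_comm]⟩
  rw [← hu, ← hcu, mul_pow, ← C_pow] at h
  have h3 : C (c ^ n) = 1 := mul_left_cancel₀ (pow_ne_zero n hb) (by rw [h, mul_one])
  exact C_injective (by rw [h3, C_1])

theorem mult_comp_pow {F : K[X]} (hF : F ≠ 0) {m : ℕ} (hm : 1 ≤ m) {y : K} (hy : y ≠ 0) :
    (F.comp (X ^ m)).rootMultiplicity y = F.rootMultiplicity (y ^ m) := by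
  obtain ⟨u, hu, hu'⟩ := exists_eq_pow_rootMultiplicity_mul_and_not_dvd F hF (y ^ m)
  set e := F.rootMultiplicity (y ^ m)
  obtain ⟨v, hv⟩ : X - C y ∣ X ^ m - C (y ^ m) := by rw [dvd_iff_isRoot]; simp
  have hvy : v.eval y ≠ 0 := by
    have := congrArg (fun q => (derivative q).eval y) hv
    simp only [derivative_sub, derivative_C, derivative_X_pow, derivative_mul, derivative_X] at this
    simp at this
    rw [← this]
    have hm0 : (m : K) ≠ 0 := Nat.cast_ne_zero.2 (by omega)
    exact mul_ne_zero hm0 (pow_ne_zero _ hy)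
  have huy : u.eval (y ^ m) ≠ 0 := by rwa [dvd_iff_isRoot] at hu'
  have hcomp : F.comp (X ^ m) = (X - C y) ^ e * (v ^ e * u.comp (X ^ m)) := by
    conv_lhs => rw [hu]
    rw [mul_comp, pow_comp, sub_comp, X_comp, C_comp, hv, mul_pow, mul_assoc]
  have hw : (v ^ e * u.comp (X ^ m)).eval y ≠ 0 := by
    rw [eval_mul, eval_pow, eval_comp, eval_pow, eval_X]
    exact mul_ne_zero (pow_ne_zero _ hvy) huy
  have hw0 : v ^ e * u.comp (X ^ m) ≠ 0 := by intro h0; rw [h0] at hw; simp at hw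
  rw [hcomp, rootMultiplicity_mul (mul_ne_zero (pow_ne_zero _ (X_sub_C_ne_zero _)) hw0),
    rootMultiplicity_X_sub_C_pow, rootMultiplicity_eq_zero hw, add_zero]

theorem pow_mult {F k : K[X]} (hF : F ≠ 0) {m : ℕ} (hm : 1 ≤ m) (h : F.comp (X ^ m) = k ^ m)
    {r : K} (hr : r ≠ 0) : m ∣ F.rootMultiplicity r := by
  classical
  obtain ⟨y, rfl⟩ := IsAlgClosed.exists_pow_nat_eq r (n := m) (by omega)
  have hy : y ≠ 0 := by rintro rfl; exact hr (zero_pow (by omega))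
  rw [← mult_comp_pow hF hm hy, h]
  rw [← count_roots, roots_pow, Multiset.count_nsmul]
  exact Dvd.intro _ rfl

theorem pow_of_mult {F : K[X]} {m : ℕ} (hm : 1 ≤ m)
    (h : ∀ r : K, r ≠ 0 → m ∣ F.rootMultiplicity r) : ∃ g : K[X], F.comp (X ^ m) = g ^ m := by
  classical
  obtain ⟨γ, hγ⟩ := IsAlgClosed.exists_pow_nat_eq F.leadingCoeff (n := m) (by omega)
  have h1 := (IsAlgClosed.splits F).eq_prod_roots
  rw [prod_multiset_root_eq_finset_root] at h1
  have h2 : ∀ a ∈ F.roots.toFinset, ∃ u : K[X],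
      ((X - C a) ^ F.rootMultiplicity a).comp (X ^ m) = u ^ m := by
    intro a _
    by_cases ha : a = 0
    · refine ⟨X ^ F.rootMultiplicity a, ?_⟩
      rw [ha, C_0, sub_zero, pow_comp, X_comp, ← pow_mul, ← pow_mul, mul_comm]
    · obtain ⟨s, hs⟩ := h a ha
      refine ⟨((X - C a) ^ s).comp (X ^ m), ?_⟩
      rw [hs, mul_comm, pow_mul, pow_comp]
  choose! u hu using h2
  refine ⟨C γ * ∏ a ∈ F.roots.toFinset, u a, ?_⟩
  conv_lhs => rw [h1]
  rw [mul_comp, C_comp, prod_comp, Finset.prod_congr rfl hu, mul_pow, ← C_pow, hγ, Finset.prod_pow]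

theorem coprime_part {m D : ℕ} (hm : 1 ≤ m) {a : ℕ} (h : m = a * Nat.gcd m (D ^ m)) :
    Nat.Coprime a D := by
  rw [Nat.coprime_iff_gcd_eq_one]
  by_contra hne
  obtain ⟨p, hp, hpd⟩ := Nat.exists_prime_and_dvd hne
  have hpa : p ∣ a := hpd.trans (Nat.gcd_dvd_left _ _)
  have hpD : p ∣ D := hpd.trans (Nat.gcd_dvd_right _ _)
  obtain ⟨e, m', hm', hme⟩ := Nat.exists_eq_pow_mul_and_not_dvd (n := m) (by omega) p hp.ne_one
  have hle : e ≤ m := by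
    have h1 : e < p ^ e := Nat.lt_pow_self hp.one_lt
    have h2 : p ^ e ≤ m := Nat.le_of_dvd (by omega) ⟨m', hme⟩
    omega
  have h3 : p ^ e ∣ Nat.gcd m (D ^ m) :=
    Nat.dvd_gcd ⟨m', hme⟩ ((pow_dvd_pow p hle).trans (pow_dvd_pow_of_dvd hpD m))
  have h4 : p ^ e * p ∣ p ^ e * m' := by
    rw [← hme, mul_comm]
    have h5 := mul_dvd_mul hpa h3
    rwa [← h] at h5
  exact hm' ((Nat.mul_dvd_mul_iff_left (pow_pos hp.pos e)).1 h4)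

theorem approx_degree {f g : K[X]} (h : PolyApprox f g) : f.natDegree = g.natDegree := by
  obtain ⟨N, hN, η, -, ⟨p, hp, hp'⟩, ⟨q, hq, hq'⟩⟩ := h
  have h1 := congrArg natDegree hp'
  have h2 := congrArg natDegree hq'
  rw [natDegree_comp, natDegree_comp, polyIter_natDegree, mul_comm] at h1 h2
  have h3 := Nat.eq_of_mul_eq_mul_left hp h1
  have h4 := Nat.eq_of_mul_eq_mul_left hq h2
  exact Nat.pow_left_injective (n := N) (by omega) (h3.trans h4.symm)

theorem lemma_A {f g : K[X]} (hf : 2 ≤ f.natDegree) (h : PolyApprox f g) :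
    ∃ M, 1 ≤ M ∧ ∃ P η q : K[X], InP f M P η ∧ 0 < q.natDegree ∧
      (polyIter g M).comp q = q.comp η := by
  obtain ⟨N, hN, η, hη, ⟨p, hp, hp'⟩, ⟨q, hq, hq'⟩⟩ := h
  set m := p.natDegree with hm
  have hηd : η.natDegree = f.natDegree ^ N := by
    have h1 := congrArg natDegree hp'
    rw [natDegree_comp, natDegree_comp, polyIter_natDegree, mul_comm] at h1
    exact (Nat.eq_of_mul_eq_mul_left hp h1).symm
  have h1 : (polyIter f (N * m)).comp p = p.comp (polyIter η m) := by
    rw [polyIter_mul]; exact semiconj_iter hp' m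
  have h2 : (polyIter g (N * m)).comp q = q.comp (polyIter η m) := by
    rw [polyIter_mul]; exact semiconj_iter hq' m
  have hηm : 1 ≤ (polyIter η m).natDegree := by
    rw [polyIter_natDegree]; exact Nat.pow_pos (by omega)
  obtain ⟨w, P, V, e1, e2, e3⟩ := gcd_decomp h1
    (by rw [polyIter_natDegree]; exact Nat.pow_pos (by omega)) hp hηm
  rw [polyIter_natDegree, ← hm] at e3
  have hVw := congrArg natDegree e2
  rw [natDegree_comp] at hVw
  have hPw := congrArg natDegree e1
  rw [natDegree_comp, ← hm] at hPw
  have hV : 0 < V.natDegree := Nat.pos_of_ne_zero (by intro h0; rw [h0] at hVw; omega)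
  have hw : 0 < w.natDegree := Nat.pos_of_ne_zero (by intro h0; rw [h0] at hVw; omega)
  have hP : 0 < P.natDegree := Nat.pos_of_ne_zero (by intro h0; rw [h0] at hPw; omega)
  refine ⟨N * m, Nat.mul_pos (by omega) hp, P, w.comp V, q.comp V, ⟨hP, ?_, ?_⟩, ?_, ?_⟩
  · apply comp_right_cancel (h := w) hw
    rw [comp_assoc, ← e1, h1, e2]
    conv_lhs => rw [e1]
    simp only [comp_assoc]
  · have h3 := coprime_part (m := m) (D := η.natDegree) (a := P.natDegree) (by omega)
      (by rw [← e3]; exact hPw)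
    rw [hηd] at h3
    exact Nat.Coprime.coprime_dvd_right (dvd_pow_self _ (by omega)) h3
  · rw [natDegree_comp]; exact Nat.mul_pos hq hV
  · rw [← comp_assoc, h2, e2]
    simp only [comp_assoc]

theorem InP.iter {f P η : K[X]} {M : ℕ} (h : InP f M P η) (k : ℕ) :
    InP f (M * k) P (polyIter η k) := by
  refine ⟨h.1, ?_, h.2.2⟩
  rw [polyIter_mul]
  exact semiconj_iter h.2.1 k
end PartTen

section PartEleven
variable {K : Type*} [Field K] [CharZero K] [IsAlgClosed K]

theorem transfer {f fj g P η q : K[X]} {M m c : ℕ} {z : K} (hf : 2 ≤ f.natDegree)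
    (hg0 : 0 < g.natDegree)
    (hP : InP f M P η) (hq : 0 < q.natDegree) (hqη : (polyIter fj M).comp q = q.comp η)
    (hz : ∃ γ b : K, γ ≠ 0 ∧ P = (X ^ P.natDegree + C z).comp (C γ * X + C b))
    (hc : 1 ≤ c) (hm : m = P.natDegree * c)
    (hg : (f.comp (X + C z) - C z).comp (X ^ m) = g ^ m) :
    ∃ k, 1 ≤ k ∧ ∃ p : K[X], 0 < p.natDegree ∧
      (polyIter fj (M * k)).comp p = p.comp (polyIter g (M * k)) := by
  obtain ⟨γ, b, hγ, hPe⟩ := hz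
  obtain ⟨hP1, hPη, hPc⟩ := hP
  have hηd : η.natDegree = f.natDegree ^ M := by
    have := congrArg natDegree hPη
    rw [natDegree_comp, natDegree_comp, polyIter_natDegree, mul_comm] at this
    exact (Nat.eq_of_mul_eq_mul_left (by omega) this).symm
  obtain ⟨l1, l2⟩ := lin_inv (a := γ) (b := b) hγ
  have d1 := natDegree_of_degree_one (degree_lin (a := γ) (b := b) hγ)
  have d2 := natDegree_of_degree_one (degree_lin_inv (a := γ) (b := b) hγ)
  set ℓ := C γ * X + C b
  set ℓi := C γ⁻¹ * X - C (γ⁻¹ * b)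
  obtain ⟨s, hs⟩ : ∃ s, s = P.natDegree := ⟨_, rfl⟩
  rw [← hs] at hPe hPc hP1 hm
  set σ : K[X] := X + C z with hσ
  set σi : K[X] := X - C z with hσi
  have hσσ : σi.comp σ = X := by simp [hσ, hσi]
  have hσσ' : σ.comp σi = X := by simp [hσ, hσi]
  set φ := f.comp σ - C z with hφ
  have hφσ : f.comp σ = σ.comp φ := by rw [hσ, add_comp, X_comp, C_comp, hφ]; ring
  have hφσM := semiconj_iter hφσ M
  have hXs : X ^ s + C z = σ.comp (X ^ s) := by rw [hσ, add_comp, X_comp, C_comp]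
  rw [hXs] at hPe
  set η' := ℓ.comp (η.comp ℓi) with hη'
  have hηη' : η.comp ℓi = ℓi.comp η' := by
    rw [hη', ← comp_assoc, l2, X_comp]
  have hη'd : η'.natDegree = f.natDegree ^ M := by
    rw [hη', natDegree_comp, natDegree_comp, d1, d2, hηd]; ring
  have hA : (polyIter φ M).comp (X ^ s) = η' ^ s := by
    have h1 : σ.comp ((polyIter φ M).comp (X ^ s)) = σ.comp ((X ^ s).comp η') := by
      have h2 : ((polyIter f M).comp P).comp ℓi = (P.comp η).comp ℓi := by rw [hPη]
      rw [hPe] at h2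
      simp only [comp_assoc, l1, comp_X] at h2
      rw [← comp_assoc, ← hφσM, comp_assoc, h2, hη']
    have := comp_left_cancel_inv hσσ h1
    rw [this, pow_comp, X_comp]
  have hB : (polyIter φ M).comp (X ^ m) = (polyIter g M) ^ m := by
    have h1 : φ.comp (X ^ m) = (X ^ m).comp g := by rw [hg, pow_comp, X_comp]
    rw [semiconj_iter h1 M, pow_comp, X_comp]
  have hη'0 : η' ≠ 0 := by
    intro h0
    rw [h0] at hη'd
    have : 0 < f.natDegree ^ M := Nat.pow_pos (by omega)
    simp at hη'd; omega
  have hgM0 : polyIter g M ≠ 0 := by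
    intro h0
    have h1 := polyIter_natDegree g M
    have : 0 < g.natDegree ^ M := Nat.pow_pos hg0
    rw [h0] at h1
    simp at h1; omega
  have hC : (η'.comp (X ^ c)) ^ s = ((polyIter g M) ^ c) ^ s := by
    have h1 := congrArg (fun q => q.comp (X ^ c)) hA
    simp only [comp_assoc, pow_comp, X_comp] at h1
    rw [← h1, ← pow_mul, ← pow_mul, mul_comm c s, ← hm, hB]
  obtain ⟨ξ, hξ, hξe⟩ := eq_of_pow_eq hP1 (pow_ne_zero c hgM0) hC
  have hξ0 : ξ ≠ 0 := by rintro rfl; rw [zero_pow (by omega)] at hξ; exact zero_ne_one hξ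
  have htw : η'.comp (C ξ * X) = C (ξ ^ (f.natDegree ^ M)) * η' := by
    have h1 := congrArg (fun q => q.comp (C ξ * X)) hA
    simp only [comp_assoc, pow_comp, X_comp] at h1
    rw [mul_pow, ← C_pow, hξ, C_1, one_mul, hA] at h1
    obtain ⟨ζ, hζ, hζe⟩ := eq_of_pow_eq hP1 hη'0 h1.symm
    rw [hζe]
    have h2 := congrArg leadingCoeff hζe
    rw [leadingCoeff_mul, leadingCoeff_C, leadingCoeff_comp (by rw [natDegree_C_mul hξ0]; simp),
      leadingCoeff_mul, leadingCoeff_C, leadingCoeff_X, mul_one, hη'd, mul_comm] at h2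
    rw [mul_right_cancel₀ (leadingCoeff_ne_zero.2 hη'0) h2]
  have htw2 := twist_iter (f := η') (g := polyIter g M) (p := X ^ c) (τ := ξ)
    (D := f.natDegree ^ M) (by rw [hξe, pow_comp, X_comp]) htw
  obtain ⟨k, hk, -, hkd⟩ := exists_geoS_dvd (f.natDegree ^ M) s (by omega) (hPc.pow_right M)
  have h3 := htw2 k
  obtain ⟨t, ht⟩ := hkd
  rw [ht, pow_mul, hξ, one_pow, C_1, one_mul] at h3
  refine ⟨k, hk, (q.comp ℓi).comp (X ^ c), ?_, ?_⟩
  · rw [natDegree_comp, natDegree_comp, d2, natDegree_X_pow]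
    exact Nat.mul_pos (Nat.mul_pos hq one_pos) (by omega)
  · have h4 := semiconj_iter hqη k
    have h5 := semiconj_iter hηη' k
    rw [polyIter_mul, polyIter_mul, ← comp_assoc, ← comp_assoc, h4, comp_assoc q, h5]
    simp only [comp_assoc]
    rw [h3]

theorem c₁_bound (d n : ℕ) (hd : 2 ≤ d) : d ^ (n + 2) ≤ c₁ d (n + 2) := by
  induction n with
  | zero =>
    show d ^ 2 ≤ 2 * d ^ 4
    have : d ^ 2 ≤ d ^ 4 := Nat.pow_le_pow_right (by omega) (by omega)
    omega
  | succ n ih =>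
    show d ^ (n + 2 + 1) ≤ c₁ d (n + 2) * (2 * d ^ (4 * c₁ d (n + 2)))
    rw [pow_succ]
    have h0 : 0 < c₁ d (n + 2) := lt_of_lt_of_le (Nat.pow_pos (by omega)) ih
    have h1 : d ≤ d ^ (4 * c₁ d (n + 2)) := Nat.le_self_pow (by omega) _
    exact Nat.mul_le_mul ih (by omega)

theorem exists_common {n : ℕ} (i₀ : Fin n) (f : Fin n → K[X])
    (hdis : ∀ i, Disintegrated (f i)) (happrox : ∀ i j, PolyApprox (f i) (f j)) :
    ∃ g : K[X], g.natDegree = (f i₀).natDegree ∧ ∀ j, ∃ N, 1 ≤ N ∧ ∃ p : K[X], 0 < p.natDegree ∧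
      (polyIter (f j) N).comp p = p.comp (polyIter g N) := by
  have hf2 : 2 ≤ (f i₀).natDegree := (hdis i₀).1
  choose Mj hMj P η q hP hq hqη using fun j => lemma_A hf2 (happrox i₀ j)
  set M := ∏ j, Mj j with hM
  have hM1 : 1 ≤ M := Finset.one_le_prod' fun j _ => hMj j
  have hex : ∀ j, ∃ k, M = Mj j * k := fun j => Finset.dvd_prod_of_mem Mj (Finset.mem_univ j)
  choose k hk using hex
  have hP' : ∀ j, InP (f i₀) M (P j) (polyIter (η j) (k j)) := by
    intro j; rw [hk j]; exact (hP j).iter (k j)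
  have hq' : ∀ j, (polyIter (f j) M).comp (q j) = (q j).comp (polyIter (η j) (k j)) := by
    intro j
    rw [hk j, polyIter_mul]
    exact semiconj_iter (hqη j) (k j)
  obtain ⟨z, hz⟩ := exists_center (hdis i₀) hM1
  set φ := (f i₀).comp (X + C z) - C z with hφ
  have hφd : φ.natDegree = (f i₀).natDegree := by
    rw [hφ, natDegree_sub_C, natDegree_comp, natDegree_X_add_C, mul_one]
  have hφ0 : φ ≠ 0 := by intro h0; rw [h0] at hφd; simp at hφd; omega
  set m := Finset.univ.lcm (fun j => (P j).natDegree) with hm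
  have hm0 : m ≠ 0 := by
    rw [hm, Ne, Finset.lcm_eq_zero_iff]
    rintro ⟨j, -, hj⟩
    have := (hP j).1
    omega
  have hex2 : ∀ j, ∃ c, m = (P j).natDegree * c := fun j => Finset.dvd_lcm (Finset.mem_univ j)
  choose c hc using hex2
  have hmult : ∀ r : K, r ≠ 0 → m ∣ φ.rootMultiplicity r := by
    intro r hr
    apply Finset.lcm_dvd
    intro j _
    obtain ⟨u, hu⟩ := pow_exists hf2 hM1 hz (hP' j)
    exact pow_mult hφ0 (hP j).1 hu hr
  obtain ⟨g, hg⟩ := pow_of_mult (by omega) hmult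
  have hgd : g.natDegree = (f i₀).natDegree := by
    have := congrArg natDegree hg
    rw [natDegree_comp, natDegree_X_pow, natDegree_pow, hφd, mul_comm] at this
    exact (Nat.eq_of_mul_eq_mul_left (Nat.pos_of_ne_zero hm0) this).symm
  refine ⟨g, hgd, fun j => ?_⟩
  obtain ⟨k', hk', p, hp, hpe⟩ := transfer hf2 (by omega) (hP' j) (hq j) (hq' j) (hz _ _ (hP' j))
    (c := c j) (Nat.pos_of_ne_zero (by intro h0; apply hm0; rw [hc j, h0, mul_zero])) (hc j) hg
  exact ⟨M * k', Nat.mul_pos hM1 hk', p, hp, hpe⟩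
end PartEleven


/-- If `f₁, …, fₙ` are disintegrated polynomials of degree at most `d`, pairwise equivalent
under `≈`, then there are `N ≤ c₁(d,n)` and a polynomial `θ` semiconjugate to every
`fᵢ^{∘N}`. -/
theorem common_semiconjugacy_bound {K : Type*} [Field K] [IsAlgClosed K] [CharZero K]
    (d n : ℕ) (hd : 2 ≤ d) (hn : 2 ≤ n) (f : Fin n → K[X])
    (hdis : ∀ i, Disintegrated (f i)) (hdeg : ∀ i, (f i).natDegree ≤ d)
    (happrox : ∀ i j, PolyApprox (f i) (f j)) :
    ∃ N : ℕ, 1 ≤ N ∧ N ≤ c₁ d n ∧ ∃ θ : K[X], 2 ≤ θ.natDegree ∧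
      ∀ i, SemiconjTo θ (polyIter (f i) N) := by
  have i₀ : Fin n := ⟨0, by omega⟩
  obtain ⟨g, hgd, hg⟩ := exists_common i₀ f hdis happrox
  have hδ : ∀ j, (f j).natDegree = g.natDegree := fun j =>
    (approx_degree (happrox j i₀)).trans hgd.symm
  have hg2 : 2 ≤ g.natDegree := by rw [hgd]; exact (hdis i₀).1
  have key : ∀ j, ∃ k, 1 ≤ k ∧ k ≤ d ∧ ∃ p : K[X], 0 < p.natDegree ∧
      (polyIter (f j) k).comp p = p.comp (polyIter g k) := by
    intro j
    obtain ⟨N, hN, p, hp, hpe⟩ := hg j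
    obtain ⟨k, hk1, hk2, hke⟩ := period_bound hg2 hN (hδ j) rfl hp
      (by rw [← hδ j]; exact (hdis j).2.1) hpe
    exact ⟨k, hk1, hk2.trans ((hδ j).symm.le.trans (hdeg j)), p, hp, hke⟩
  choose k hk1 hk2 p hp hpe using key
  refine ⟨∏ j, k j, Finset.one_le_prod' fun j _ => hk1 j, ?_, polyIter g (∏ j, k j), ?_, ?_⟩
  · have h1 : ∏ j, k j ≤ d ^ n := by
      have := Finset.prod_le_pow_card Finset.univ k d (fun j _ => hk2 j)
      simpa using this
    obtain ⟨e, rfl⟩ : ∃ e, n = e + 2 := ⟨n - 2, by omega⟩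
    exact h1.trans (c₁_bound d e hd)
  · rw [polyIter_natDegree]
    have h1 : 1 ≤ ∏ j, k j := Finset.one_le_prod' fun j _ => hk1 j
    exact hg2.trans (Nat.le_self_pow (by omega) _)
  · intro j
    exact ⟨p j, hp j, semiconj_iter_dvd (hpe j) (Finset.dvd_prod_of_mem k (Finset.mem_univ j))⟩
end

section
/- Let K be an algebraically closed field of characteristic 0 and let F ∈ K[x] be a disintegrated polynomial. Then F^{∘2} is not cyclic; that is, F^{∘2} is not of the form L_2 ∘ x^{δ^2} ∘ L_1 for degree-1 polynomials L_1, L_2, where δ = deg(F). -/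
open Polynomial

/-- If `F` is disintegrated, then `F^{∘2}` is not cyclic, i.e. not of the form
`L₂ ∘ x^{δ²} ∘ L₁` for degree-1 polynomials `L₁, L₂`, where `δ = deg F`. -/
theorem second_iterate_not_cyclic {K : Type*} [Field K] [IsAlgClosed K] [CharZero K]
    (F : K[X]) (hF : Disintegrated F) :
    ¬ ∃ L₁ L₂ : K[X], L₁.degree = 1 ∧ L₂.degree = 1 ∧
      polyIter F 2 = L₂.comp (((X : K[X]) ^ (F.natDegree ^ 2)).comp L₁) := by
  rintro ⟨L₁, L₂, h1, h2, h⟩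
  obtain ⟨hd, hX, -, -⟩ := hF
  apply hX
  have hF0 : F ≠ 0 := by rintro rfl; simp at hd
  obtain ⟨a, ha, q, rfl⟩ : ∃ a : K, a ≠ 0 ∧ ∃ q : K, L₁ = C a * (X - C q) := by
    obtain ⟨a, b, ha, rfl⟩ : ∃ a b : K, a ≠ 0 ∧ L₁ = C a * X + C b := by
      refine ⟨L₁.coeff 1, L₁.coeff 0, ?_, eq_X_add_C_of_degree_le_one h1.le⟩
      exact coeff_ne_zero_of_eq_degree h1
    refine ⟨a, ha, -b / a, ?_⟩
    rw [mul_sub, ← C_mul, mul_div_cancel₀ _ ha]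
    simp
  have hL2 : L₂ = C (L₂.coeff 1) * X + C (L₂.coeff 0) := eq_X_add_C_of_degree_le_one h2.le
  have hc : L₂.coeff 1 ≠ 0 := coeff_ne_zero_of_eq_degree h2
  generalize L₂.coeff 1 = c at *
  generalize L₂.coeff 0 = c' at *
  subst hL2
  generalize hn : F.natDegree = d at *
  have hD := congrArg derivative h
  have hp : Prime (X - C q) := prime_X_sub_C q
  obtain ⟨u, hu, hD2⟩ : ∃ u : K, u ≠ 0 ∧
      derivative F * (derivative F).comp F = C u * (X - C q) ^ (d ^ 2 - 1) := by
    refine ⟨c * a ^ (d ^ 2) * ((d ^ 2 : ℕ) : K), ?_, ?_⟩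
    · have : d ≠ 0 := by omega
      simp [hc, ha, this]
    · have e : polyIter F 2 = F.comp F := by simp [polyIter]
      rw [e, derivative_comp] at hD
      rw [hD]
      simp only [add_comp, mul_comp, C_comp, X_comp, pow_comp, mul_pow, ← C_pow]
      simp only [derivative_add, derivative_mul, derivative_C, derivative_X_sub_C_pow]
      simp only [C_mul, map_natCast]
      ring
  have hdvd : ∀ G : K[X], G ∣ derivative F * (derivative F).comp F →
      ∃ v : K, v ≠ 0 ∧ ∃ m : ℕ, G = C v * (X - C q) ^ m := by
    intro G hG
    rw [hD2, (isUnit_C.2 hu.isUnit).dvd_mul_left] at hG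
    obtain ⟨m, -, hm⟩ := (dvd_prime_pow hp _).1 hG
    obtain ⟨w, hw⟩ := hm.symm
    obtain ⟨v, hv, hv'⟩ := Polynomial.isUnit_iff.1 w.isUnit
    exact ⟨v, hv.ne_zero, m, by rw [← hw, ← hv', mul_comm]⟩
  obtain ⟨v, hv, k, hk⟩ := hdvd _ (dvd_mul_right _ _)
  have hkd : k = d - 1 := by
    have := congrArg natDegree hk
    rw [natDegree_C_mul hv, natDegree_pow, natDegree_X_sub_C, natDegree_derivative, hn] at this
    omega
  obtain ⟨e, he, m, hm⟩ := hdvd (F - C q) (by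
    apply Dvd.dvd.mul_left
    rw [hk]
    simp only [mul_comp, C_comp, pow_comp, sub_comp, X_comp]
    exact Dvd.dvd.mul_left (dvd_pow_self _ (by omega)) _)
  have hmd : m = d := by
    have := congrArg natDegree hm
    rw [natDegree_C_mul he, natDegree_pow, natDegree_X_sub_C, natDegree_sub_C, hn] at this
    omega
  subst hmd
  obtain ⟨b, hb⟩ := IsAlgClosed.exists_pow_nat_eq (e⁻¹) (n := m - 1) (by omega)
  have hb0 : b ≠ 0 := by
    rintro rfl
    rw [zero_pow (by omega)] at hb
    exact inv_ne_zero he hb.symm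
  have hbe : b * b⁻¹ ^ m = e := by
    obtain ⟨j, rfl⟩ : ∃ j, m = j + 1 := ⟨m - 1, by omega⟩
    rw [pow_succ, inv_pow]
    simp only [Nat.add_sub_cancel] at hb
    rw [hb]
    field_simp
  have hCb : (C b * C b⁻¹ : K[X]) = 1 := by rw [← C_mul, mul_inv_cancel₀ hb0, C_1]
  refine ⟨C b * X + C q, C b⁻¹ * X + C (-(b⁻¹ * q)), degree_linear hb0,
    degree_linear (inv_ne_zero hb0), ?_, ?_, ?_⟩
  · simp only [add_comp, mul_comp, C_comp, X_comp, neg_comp, C_neg, C_mul]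
    linear_combination (X - C q) * hCb
  · simp only [add_comp, mul_comp, C_comp, X_comp, neg_comp, C_neg, C_mul]
    linear_combination X * hCb
  · have e1 : (C b⁻¹ * X + C (-(b⁻¹ * q)) : K[X]) = C b⁻¹ * (X - C q) := by
      simp only [C_neg, C_mul]; ring
    rw [e1]
    simp only [add_comp, mul_comp, C_comp, X_comp, pow_comp, mul_pow, ← C_pow]
    rw [← mul_assoc, ← C_mul, hbe, ← hm]
    ring
end

section
/- Let K be an algebraically closed field of characteristic 0 and let F ∈ K[x] be a disintegrated polynomial of degree δ ≥ 3. Then F^{∘2} is not dihedral; that is, F^{∘2} is not of the form L_2 ∘ T_{δ^2} ∘ L_1 for degree-1 polynomials L_1, L_2, where T_{δ^2} is the Chebyshev polynomial of degree δ^2. -/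
open Polynomial

theorem aux_right_factor {K : Type*} [Field K] [CharZero K] (A B P D : K[X]) (n : ℕ)
    (hn : 0 < n) (hA : 0 < A.natDegree) (hB : B.natDegree = n) (hD : D.natDegree = n)
    (h : A.comp B = P.comp D) : ∃ c k : K, c ≠ 0 ∧ B = C c * D + C k := by
  have hB0 : B ≠ 0 := by rintro rfl; simp at hB; omega
  have hD0 : D ≠ 0 := by rintro rfl; simp at hD; omega
  have hb : B.leadingCoeff ≠ 0 := leadingCoeff_ne_zero.mpr hB0
  have hd : D.leadingCoeff ≠ 0 := leadingCoeff_ne_zero.mpr hD0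
  set c := B.leadingCoeff / D.leadingCoeff with hc
  have hc0 : c ≠ 0 := div_ne_zero hb hd
  set G := C c * D with hG
  have hGn : G.natDegree = n := by rw [hG, natDegree_C_mul hc0, hD]
  have hGl : G.leadingCoeff = B.leadingCoeff := by
    rw [hG, leadingCoeff_mul, leadingCoeff_C, hc]; field_simp
  set E := B - G with hE
  refine ⟨c, E.coeff 0, hc0, ?_⟩
  suffices hE0 : E.natDegree = 0 by
    rw [← eq_C_of_natDegree_eq_zero hE0, hE]; ring
  by_contra hE0
  have hEne : E ≠ 0 := by intro h0; rw [h0] at hE0; simp at hE0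
  have hElt : E.natDegree < n := by
    have hle : E.natDegree ≤ n := (natDegree_sub_le _ _).trans (by simp [hB, hGn])
    refine lt_of_le_of_ne hle fun heq => ?_
    apply leadingCoeff_ne_zero.mpr hEne
    rw [leadingCoeff, heq, hE, coeff_sub]
    have h1 : B.coeff n = B.leadingCoeff := by rw [leadingCoeff, hB]
    have h2 : G.coeff n = G.leadingCoeff := by rw [leadingCoeff, hGn]
    rw [h1, h2, hGl, sub_self]
  let S : ℕ → K[X] := fun k => ∑ i ∈ Finset.range k, B ^ i * G ^ (k - 1 - i)
  have hS : ∀ k, S k * E = B ^ k - G ^ k := fun k => by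
    exact (Commute.all B G).geom_sum₂_mul k
  let Q : K[X] := ∑ k ∈ Finset.range (A.natDegree + 1), C (A.coeff k) * S k
  have hQ : Q * E = A.comp B - A.comp G := by
    rw [comp_eq_sum_left, comp_eq_sum_left, sum_over_range _ (by simp),
      sum_over_range _ (by simp), ← Finset.sum_sub_distrib, Finset.sum_mul]
    refine Finset.sum_congr rfl fun k _ => ?_
    rw [mul_assoc, hS, mul_sub]
  have hterm : ∀ k i, i < k → (B ^ i * G ^ (k - 1 - i)).natDegree = n * (k - 1) := by
    intro k i hi
    have hG0 : G ≠ 0 := by intro h0; rw [h0] at hGn; simp at hGn; omega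
    rw [natDegree_mul (pow_ne_zero _ hB0) (pow_ne_zero _ hG0), natDegree_pow, natDegree_pow, hB,
      hGn, ← add_mul, mul_comm]
    congr 1; omega
  have hSdeg : ∀ k, (S k).natDegree ≤ n * (k - 1) := by
    intro k
    refine natDegree_sum_le_of_forall_le _ _ fun i hi => ?_
    exact (hterm k i (Finset.mem_range.mp hi)).le
  have hScoeff : (S A.natDegree).coeff (n * (A.natDegree - 1)) =
      A.natDegree * B.leadingCoeff ^ (A.natDegree - 1) := by
    simp only [S, finsetSum_coeff]
    rw [Finset.sum_congr rfl (g := fun _ => B.leadingCoeff ^ (A.natDegree - 1))]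
    · simp
    · intro i hi
      have hi' := Finset.mem_range.mp hi
      rw [← hterm _ i hi', coeff_natDegree, leadingCoeff_mul, leadingCoeff_pow, leadingCoeff_pow,
        hGl, ← pow_add]
      congr 1; omega
  have hQle : Q.natDegree ≤ n * (A.natDegree - 1) := by
    refine natDegree_sum_le_of_forall_le _ _ fun k hk => ?_
    refine (natDegree_C_mul_le _ _).trans ((hSdeg k).trans ?_)
    have := Finset.mem_range.mp hk
    exact Nat.mul_le_mul_left _ (by omega)
  have hQc : Q.coeff (n * (A.natDegree - 1)) ≠ 0 := by
    simp only [Q, finsetSum_coeff, coeff_C_mul]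
    rw [Finset.sum_eq_single A.natDegree]
    · rw [hScoeff]
      refine mul_ne_zero ?_ (mul_ne_zero (by exact_mod_cast hA.ne') (pow_ne_zero _ hb))
      rw [coeff_natDegree]
      exact leadingCoeff_ne_zero.mpr (by rintro rfl; simp at hA)
    · intro k hk hk'
      have := Finset.mem_range.mp hk
      rcases Nat.eq_zero_or_pos k with rfl | hk0
      · simp [S]
      rw [coeff_eq_zero_of_natDegree_lt (p := S k), mul_zero]
      exact (hSdeg k).trans_lt (Nat.mul_lt_mul_of_pos_left (by omega) hn)
    · intro hk; simp at hk
  have hQdeg : Q.natDegree = n * (A.natDegree - 1) :=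
    le_antisymm hQle (le_natDegree_of_ne_zero hQc)
  have hQ0 : Q ≠ 0 := by rintro h0; rw [h0] at hQc; simp at hQc
  have hH : Q * E = (P - A.comp (C c * X)).comp D := by
    rw [hQ, h, sub_comp, comp_assoc]; simp [hG]
  have hdeg := congrArg natDegree hH
  rw [natDegree_mul hQ0 hEne, natDegree_comp, hQdeg, hD] at hdeg
  have hdvd : n ∣ E.natDegree := by
    rw [← Nat.dvd_add_right (dvd_mul_right n (A.natDegree - 1)), hdeg]
    exact dvd_mul_left _ _
  exact absurd (Nat.le_of_dvd (Nat.pos_of_ne_zero hE0) hdvd) (by omega)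

theorem aux_cheb_coeff (K : Type*) [Field K] (n : ℕ) :
    (cheb K (n+1)).natDegree ≤ n + 1 ∧ (cheb K (n+1)).coeff (n+1) = 1 ∧
    (cheb K (n+1)).coeff n = 0 ∧ (cheb K (n+2)).natDegree ≤ n + 2 ∧
    (cheb K (n+2)).coeff (n+2) = 1 ∧ (cheb K (n+2)).coeff (n+1) = 0 ∧
    (cheb K (n+2)).coeff n = -((n:K)+2) := by
  induction n with
  | zero =>
    have h2 : cheb K 2 = X ^ 2 - C 2 := by
      simp only [cheb, dickson_two]; simp; norm_num; exact (map_ofNat C 2).symm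
    have h1 : cheb K 1 = X := by simp [cheb]
    simp only [zero_add, h1, h2]
    refine ⟨by simp, by simp, by simp, by rw [natDegree_X_pow_sub_C], ?_, ?_, ?_⟩ <;>
      simp [coeff_X_pow, coeff_C]
  | succ n ih =>
    obtain ⟨a1, a2, a3, b1, b2, b3, b4⟩ := ih
    have hr : cheb K (n + 1 + 2) = X * cheb K (n + 2) - cheb K (n + 1) := by
      simp only [cheb, dickson_add_two]; simp
    have e1 : (cheb K (n+1)).coeff (n+2) = 0 := coeff_eq_zero_of_natDegree_lt (by omega)
    have e2 : (cheb K (n+1)).coeff (n+3) = 0 := coeff_eq_zero_of_natDegree_lt (by omega)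
    refine ⟨b1, b2, b3, ?_, ?_, ?_, ?_⟩
    · rw [hr]
      refine (natDegree_sub_le _ _).trans (max_le ?_ (by omega))
      refine natDegree_mul_le.trans ?_
      rw [natDegree_X]; omega
    · rw [hr, coeff_sub, coeff_X_mul, b2, e2, sub_zero]
    · rw [hr, coeff_sub, coeff_X_mul, b3, e1, sub_zero]
    · rw [hr, coeff_sub, coeff_X_mul, b4, a2]; push_cast; ring

theorem aux_cheb_neg (K : Type*) [Field K] (n : ℕ) :
    (cheb K n).comp (-X) = (-1) ^ n * cheb K n ∧
    (cheb K (n+1)).comp (-X) = (-1) ^ (n+1) * cheb K (n+1) := by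
  induction n with
  | zero => simp [cheb, dickson_zero]
  | succ n ih =>
    obtain ⟨h1, h2⟩ := ih
    refine ⟨h2, ?_⟩
    have hr : cheb K (n + 1 + 1) = X * cheb K (n + 1) - cheb K n := by
      simp only [cheb, dickson_add_two]; simp
    rw [hr, sub_comp, mul_comp, h1, h2, X_comp]
    ring

theorem aux_lin {K : Type*} [Field K] [CharZero K] (m : ℕ) (c a b e f : K) (hc : c ≠ 0)
    (ha : a ≠ 0)
    (h : C c * (cheb K (m+3)).comp (C a * X + C b) = C e * cheb K (m+3) + C f) :
    b = 0 ∧ a ^ 2 = 1 := by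
  obtain ⟨-, -, -, d1, d2, d3, d4⟩ := aux_cheb_coeff K (m+1)
  rw [show m + 1 + 2 = m + 3 from rfl] at *
  rw [show m + 1 + 1 = m + 2 from rfl] at *
  have hm : ((m:K) + 3) ≠ 0 := by exact_mod_cast (by omega : m + 3 ≠ 0)
  have hb : b = 0 := by
    have h1 : (cheb K (m+3)).comp (C a * X + C b) = (taylor b (cheb K (m+3))).comp (C a * X) := by
      rw [taylor_apply, comp_assoc]; simp
    rw [h1] at h
    have h2 := congrArg (fun p => coeff p (m+2)) h
    simp only [coeff_C_mul, coeff_add, comp_C_mul_X_coeff, d3, taylor_coeff, coeff_C] at h2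
    have h3 : hasseDeriv (m+2) (cheb K (m+3)) = C ((m:K)+3) * X := by
      ext i
      rw [hasseDeriv_coeff]
      rcases i with _ | _ | i
      · simp [d3]
      · rw [show 0 + 1 + (m+2) = m + 3 by ring, d2]
        have : (m+3).choose (m+2) = m + 3 := by
          simpa using Nat.choose_succ_self_right (m+2)
        rw [this]; simp
      · rw [coeff_eq_zero_of_natDegree_lt (by omega)]
        simp [coeff_X]
    rw [h3] at h2
    simp at h2
    tauto
  refine ⟨hb, ?_⟩
  subst hb
  have h2 := congrArg (fun p => coeff p (m+1)) h
  have h3 := congrArg (fun p => coeff p (m+3)) h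
  simp only [coeff_C_mul, coeff_add, C_0, add_zero, comp_C_mul_X_coeff, d2, d4, coeff_C] at h2 h3
  simp at h2 h3
  rw [← h3] at h2
  have h4 : (c * a ^ (m+1) * ((m:K)+3)) * (a ^ 2 - 1) = 0 := by linear_combination h2
  have h5 : c * a ^ (m+1) * ((m:K)+3) ≠ 0 := mul_ne_zero (mul_ne_zero hc (pow_ne_zero _ ha)) hm
  rcases mul_eq_zero.mp h4 with h | h
  · exact absurd h h5
  · linear_combination h

/-- If `F` is disintegrated of degree `δ ≥ 3`, then `F^{∘2}` is not dihedral, i.e. not of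
the form `L₂ ∘ T_{δ²} ∘ L₁` for degree-1 polynomials `L₁, L₂`. -/
theorem second_iterate_not_dihedral {K : Type*} [Field K] [IsAlgClosed K] [CharZero K]
    (F : K[X]) (hF : Disintegrated F) (hdeg : 3 ≤ F.natDegree) :
    ¬ ∃ L₁ L₂ : K[X], L₁.degree = 1 ∧ L₂.degree = 1 ∧
      polyIter F 2 = L₂.comp ((cheb K (F.natDegree ^ 2)).comp L₁) := by
  rintro ⟨L₁, L₂, h1, h2, h⟩
  obtain ⟨-, -, hT, hT'⟩ := hF
  obtain ⟨m, hm⟩ : ∃ m, F.natDegree = m + 3 := ⟨F.natDegree - 3, by omega⟩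
  rw [hm] at hT hT' h
  have e1 := eq_X_add_C_of_degree_le_one h1.le
  have e2 := eq_X_add_C_of_degree_le_one h2.le
  have hp : L₁.coeff 1 ≠ 0 := coeff_ne_zero_of_eq_degree h1
  generalize L₁.coeff 1 = p at e1 hp
  generalize L₁.coeff 0 = q at e1
  generalize L₂.coeff 1 = r at e2
  generalize L₂.coeff 0 = s at e2
  obtain ⟨-, -, -, d1, d2, d3, d4⟩ := aux_cheb_coeff K (m+1)
  have hTd : (cheb K (m+3)).natDegree = m + 3 :=
    le_antisymm d1 (le_natDegree_of_ne_zero (by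
      rw [show m + 3 = m + 1 + 2 from rfl, d2]; exact one_ne_zero))
  have hsq : cheb K ((m+3)^2) = (cheb K (m+3)).comp (cheb K (m+3)) := by
    rw [sq]; exact dickson_one_one_mul _ _ _
  set T := cheb K (m+3) with hTdef
  have hFF : F.comp F = (L₂.comp T).comp (T.comp L₁) := by
    have : polyIter F 2 = F.comp F := by simp [polyIter]
    rw [← this, h, hsq]; simp only [comp_assoc]
  have hDn : (T.comp L₁).natDegree = m + 3 := by
    rw [natDegree_comp, hTd, show L₁.natDegree = 1 from natDegree_eq_of_degree_eq_some h1, mul_one]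
  obtain ⟨c, k, hc, hFe⟩ := aux_right_factor F F (L₂.comp T) (T.comp L₁) (m+3) (by omega)
    (by omega) hm hDn hFF
  have hcomp : F.comp (C c * X + C k) = L₂.comp T := by
    have h0 : (F.comp (C c * X + C k) - L₂.comp T).comp (T.comp L₁) = 0 := by
      rw [sub_comp, ← hFF, comp_assoc]
      simp only [add_comp, mul_comp, C_comp, X_comp]
      rw [← hFe, sub_self]
    rcases comp_eq_zero_iff.mp h0 with h0 | ⟨-, h0⟩
    · exact sub_eq_zero.mp h0
    · rw [h0, natDegree_C] at hDn; omega
  have hlin : C c * T.comp (C (p*c) * X + C (p*k+q)) = C r * T + C (s - k) := by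
    rw [hFe, e1, e2] at hcomp
    simp only [add_comp, mul_comp, C_comp, X_comp, comp_assoc] at hcomp
    have e : C (p*c) * X + C (p*k+q) = C p * (C c * X + C k) + C q := by
      simp only [C_mul, C_add]; ring
    rw [e, C_sub]
    linear_combination hcomp
  obtain ⟨hb, ha⟩ := aux_lin m c _ _ _ _ hc (mul_ne_zero hp hc) hlin
  have hinv : C c * C c⁻¹ = (1 : K[X]) := by rw [← C_mul, mul_inv_cancel₀ hc, C_1]
  have dl : (C c * X + C k : K[X]).degree = 1 := degree_linear hc
  have dli : (C c⁻¹ * X + C (-(c⁻¹ * k)) : K[X]).degree = 1 := degree_linear (inv_ne_zero hc)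
  have i1 : (C c * X + C k : K[X]).comp (C c⁻¹ * X + C (-(c⁻¹ * k))) = X := by
    simp only [add_comp, mul_comp, C_comp, X_comp, C_neg, C_mul, neg_comp]
    linear_combination (X - C k) * hinv
  have i2 : (C c⁻¹ * X + C (-(c⁻¹ * k)) : K[X]).comp (C c * X + C k) = X := by
    simp only [add_comp, mul_comp, C_comp, X_comp, C_neg, C_mul, neg_comp]
    linear_combination X * hinv
  have hq : q = -(p * k) := by linear_combination hb
  have hFl : F = (C c * X + C k).comp (T.comp L₁) := by
    simp only [add_comp, mul_comp, C_comp, X_comp]; exact hFe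
  rcases sq_eq_one_iff.mp ha with h' | h'
  · have hp' : p = c⁻¹ := eq_inv_of_mul_eq_one_left h'
    refine hT ⟨_, _, dl, dli, i1, i2, ?_⟩
    rw [hFl, e1, hq, hp']
  · have hp' : p = -c⁻¹ := by
      field_simp; exact h'
    have hL : L₁ = (-X).comp (C c⁻¹ * X + C (-(c⁻¹ * k))) := by
      rw [e1, hq, hp', neg_comp, X_comp]
      simp only [C_neg, C_mul, neg_mul, neg_neg]; ring
    have hTn := (aux_cheb_neg K (m+3)).1
    rw [← hTdef] at hTn
    rw [hL, ← comp_assoc T, hTn] at hFl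
    rcases neg_one_pow_eq_or K[X] (m+3) with hs | hs
    · refine hT ⟨_, _, dl, dli, i1, i2, ?_⟩
      rw [hs, one_mul] at hFl
      exact hFl
    · refine hT' ⟨_, _, dl, dli, i1, i2, ?_⟩
      rw [hs, neg_one_mul] at hFl
      exact hFl
end

section
/- Let K be an algebraically closed field of characteristic 0 and let f ∈ K[x] be a disintegrated polynomial. Then f^{∘4} is neither cyclic nor dihedral; that is, writing δ = deg(f), the iterate f^{∘4} is not equivalent to x^{δ^4} and not equivalent to T_{δ^4}(x). -/
open Polynomial

namespace FourthIter

variable {K : Type*} [Field K]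

lemma lin_form {L : K[X]} (h : L.degree = 1) : ∃ a b : K, a ≠ 0 ∧ L = C a * X + C b := by
  refine ⟨L.leadingCoeff, L.coeff 0, ?_, eq_X_add_C_of_degree_eq_one h⟩
  intro h0
  rw [leadingCoeff_eq_zero] at h0
  simp [h0] at h

lemma lin_inv {L : K[X]} (h : L.degree = 1) :
    ∃ M : K[X], M.degree = 1 ∧ L.comp M = X ∧ M.comp L = X := by
  obtain ⟨a, b, ha, rfl⟩ := lin_form h
  refine ⟨C a⁻¹ * X + C (-(a⁻¹ * b)), degree_linear (inv_ne_zero ha), ?_, ?_⟩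
  · simp only [add_comp, mul_comp, C_comp, X_comp, mul_add, ← mul_assoc, ← C_mul,
      mul_inv_cancel₀ ha, C_1, one_mul, add_assoc, ← C_add]
    rw [mul_neg, ← mul_assoc, mul_inv_cancel₀ ha]; simp
  · simp only [add_comp, mul_comp, C_comp, X_comp, mul_add, ← mul_assoc, ← C_mul,
      inv_mul_cancel₀ ha, C_1, one_mul, add_assoc, ← C_add]
    simp

lemma lin_natDegree {L : K[X]} (h : L.degree = 1) : L.natDegree = 1 :=
  natDegree_eq_of_degree_eq_some h

lemma lin_comp {L M : K[X]} (h : L.degree = 1) (h' : M.degree = 1) : (L.comp M).degree = 1 := by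
  obtain ⟨a, b, ha, rfl⟩ := lin_form h
  obtain ⟨c, d, hc, rfl⟩ := lin_form h'
  have : (C a * X + C b : K[X]).comp (C c * X + C d) = C (a * c) * X + C (a * d + b) := by
    simp; ring
  rw [this]
  exact degree_linear (mul_ne_zero ha hc)

lemma comp_cancel {P R Q : K[X]} (hQ : 0 < Q.natDegree) (h : P.comp Q = R.comp Q) : P = R := by
  have h1 : (P - R).comp Q = 0 := by rw [sub_comp, h, sub_self]
  rcases comp_eq_zero_iff.1 h1 with h2 | ⟨_, h2⟩
  · exact sub_eq_zero.1 h2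
  · rw [h2, natDegree_C] at hQ; omega

variable [CharZero K]

/-- Uniqueness of right factors, normalized version. -/
lemma right_unique_aux {P Q R S : K[X]} (hP : 0 < P.natDegree) (hQ : 0 < Q.natDegree)
    (hQS : Q.natDegree = S.natDegree) (hlc : Q.leadingCoeff = S.leadingCoeff)
    (h : P.comp Q = R.comp S) : ∃ b : K, S = Q + C b := by
  by_contra hcon
  have hS : 0 < S.natDegree := hQS ▸ hQ
  have hd : P.natDegree = R.natDegree := by
    have := congrArg natDegree h
    rw [natDegree_comp, natDegree_comp, ← hQS] at this
    exact Nat.eq_of_mul_eq_mul_right hQ this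
  have hl : P.leadingCoeff = R.leadingCoeff := by
    have := congrArg leadingCoeff h
    rw [leadingCoeff_comp hQ.ne', leadingCoeff_comp hS.ne', ← hd, hlc] at this
    refine mul_right_cancel₀ (pow_ne_zero _ ?_) this
    rw [Ne, leadingCoeff_eq_zero]; rintro rfl; simp at hS
  obtain ⟨m, hm⟩ : ∃ m, P.natDegree = m + 1 := ⟨P.natDegree - 1, by omega⟩
  set n := Q.natDegree with hn
  set p := P.leadingCoeff with hp
  have hp0 : p ≠ 0 := by
    rw [hp, Ne, leadingCoeff_eq_zero]; rintro rfl; simp at hP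
  have hq0 : Q.leadingCoeff ≠ 0 := by
    rw [Ne, leadingCoeff_eq_zero]; intro h0; simp [h0] at hn; omega
  -- decompositions
  have e1 : P = P.eraseLead + C p * X ^ (m + 1) := by
    rw [← hm]; exact (eraseLead_add_C_mul_X_pow P).symm
  have e2 : R = R.eraseLead + C p * X ^ (m + 1) := by
    rw [← hm, hd, hl]; exact (eraseLead_add_C_mul_X_pow R).symm
  have d1 : (P.eraseLead.comp Q).natDegree ≤ m * n := by
    rw [natDegree_comp]
    exact Nat.mul_le_mul_right _ (by have := eraseLead_natDegree_le P; omega)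
  have d2 : (R.eraseLead.comp S).natDegree ≤ m * n := by
    rw [natDegree_comp, ← hQS]
    exact Nat.mul_le_mul_right _ (by have := eraseLead_natDegree_le R; omega)
  have key : C p * (S ^ (m + 1) - Q ^ (m + 1)) = P.eraseLead.comp Q - R.eraseLead.comp S := by
    have h' : (P.eraseLead + C p * X ^ (m + 1)).comp Q
        = (R.eraseLead + C p * X ^ (m + 1)).comp S := by rw [← e1, ← e2, h]
    simp only [add_comp, mul_comp, C_comp, pow_comp, X_comp] at h'
    linear_combination -h'
  set G := ∑ i ∈ Finset.range (m + 1), S ^ i * Q ^ (m + 1 - 1 - i) with hG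
  have hgeom : G * (S - Q) = S ^ (m + 1) - Q ^ (m + 1) := by
    rw [hG]; exact (Commute.all S Q).geom_sum₂_mul _
  have hGc : G.coeff (m * n) = (m + 1 : ℕ) * Q.leadingCoeff ^ m := by
    rw [hG, finsetSum_coeff]
    rw [Finset.sum_congr rfl (g := fun _ => Q.leadingCoeff ^ m)]
    · simp
    · intro i hi
      have hi' : i ≤ m := by simpa [Nat.lt_succ_iff] using hi
      have : (S ^ i * Q ^ (m + 1 - 1 - i)).natDegree = m * n := by
        have hS0 : S ≠ 0 := by rintro rfl; simp at hS
        have hQ0 : Q ≠ 0 := by rintro h0; simp [h0] at hq0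
        rw [natDegree_mul (pow_ne_zero _ hS0) (pow_ne_zero _ hQ0), natDegree_pow, natDegree_pow,
          ← hQS, ← hn, ← add_mul]
        congr 1; omega
      rw [← this, coeff_natDegree, leadingCoeff_mul, leadingCoeff_pow, leadingCoeff_pow, ← hlc,
        ← pow_add]
      congr 1; omega
  have hGc0 : G.coeff (m * n) ≠ 0 := by
    rw [hGc]; exact mul_ne_zero (by exact_mod_cast Nat.succ_ne_zero m) (pow_ne_zero _ hq0)
  have hG0 : G ≠ 0 := by rintro h0; simp [h0] at hGc0
  have hGd : m * n ≤ G.natDegree := le_natDegree_of_ne_zero hGc0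
  have hSQ : 0 < (S - Q).natDegree := by
    by_contra h0
    have h0' : (S - Q).natDegree = 0 := by omega
    obtain ⟨b, hb⟩ := natDegree_eq_zero.1 h0'
    exact hcon ⟨b, by rw [hb]; ring⟩
  have hSQ0 : S - Q ≠ 0 := by rintro h0; simp [h0] at hSQ
  have f1 : (C p * (S ^ (m + 1) - Q ^ (m + 1))).natDegree = G.natDegree + (S - Q).natDegree := by
    rw [natDegree_C_mul hp0, ← hgeom, natDegree_mul hG0 hSQ0]
  have f2 : (C p * (S ^ (m + 1) - Q ^ (m + 1))).natDegree ≤ m * n := by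
    rw [key]; exact (natDegree_sub_le _ _).trans (max_le d1 d2)
  omega

lemma right_unique {P Q R S : K[X]} (hP : 0 < P.natDegree) (hQ : 0 < Q.natDegree)
    (hQS : Q.natDegree = S.natDegree) (h : P.comp Q = R.comp S) :
    ∃ M : K[X], M.degree = 1 ∧ S = M.comp Q := by
  have hq : Q.leadingCoeff ≠ 0 := by
    rw [Ne, leadingCoeff_eq_zero]; rintro rfl; simp at hQ
  have hs : S.leadingCoeff ≠ 0 := by
    rw [Ne, leadingCoeff_eq_zero]; rintro rfl; simp at hQS; omega
  set t := S.leadingCoeff / Q.leadingCoeff with ht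
  have ht0 : t ≠ 0 := div_ne_zero hs hq
  have h' : (P.comp (C t⁻¹ * X)).comp (C t * Q) = R.comp S := by
    rw [← h, comp_assoc]; congr 1
    rw [mul_comp, C_comp, X_comp, ← mul_assoc, ← C_mul, inv_mul_cancel₀ ht0]; simp
  obtain ⟨b, hb⟩ := right_unique_aux (P := P.comp (C t⁻¹ * X)) (Q := C t * Q)
    (by rw [natDegree_comp, natDegree_C_mul_X _ (inv_ne_zero ht0)]; omega)
    (by rwa [natDegree_C_mul ht0]) (by rw [natDegree_C_mul ht0, hQS])
    (by rw [leadingCoeff_mul, leadingCoeff_C, ht, div_mul_cancel₀ _ hq]) h'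
  exact ⟨C t * X + C b, degree_linear ht0, by simp [hb]⟩

/-- The common structural argument. -/
lemma square_struct {g T L₁ L₂ : K[X]} (hg : 0 < g.natDegree) (hT : T.natDegree = g.natDegree)
    (h1 : L₁.degree = 1) (h2 : L₂.degree = 1)
    (h : L₂.comp ((g.comp g).comp L₁) = T.comp T) :
    ∃ b n : K[X], b.degree = 1 ∧ n.degree = 1 ∧ T.comp b = n.comp T ∧ LinConj g (T.comp b) := by
  have n1 := lin_natDegree h1
  have n2 := lin_natDegree h2
  obtain ⟨M, hM, hTM⟩ := right_unique (P := L₂.comp g) (Q := g.comp L₁) (R := T) (S := T)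
    (by rw [natDegree_comp, n2]; omega) (by rw [natDegree_comp, n1]; omega)
    (by rw [natDegree_comp, n1]; omega) (by rw [← h]; simp only [comp_assoc])
  obtain ⟨Mi, hMi, m1, m2⟩ := lin_inv hM
  obtain ⟨J₁, hJ1, j1, j1'⟩ := lin_inv h1
  obtain ⟨J₂, hJ2, j2, j2'⟩ := lin_inv h2
  have g1 : g = Mi.comp (T.comp J₁) := by
    rw [hTM, comp_assoc, comp_assoc, j1, comp_X, ← comp_assoc, m2, X_comp]
  have g2 : L₂.comp (g.comp Mi) = T := by
    apply comp_cancel (Q := T) (by omega)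
    rw [← h]
    have : g.comp L₁ = Mi.comp T := by rw [hTM, ← comp_assoc, m2, X_comp]
    simp only [comp_assoc, this]
  have g3 : g = J₂.comp (T.comp M) := by
    rw [← g2, comp_assoc, comp_assoc, m2, comp_X, ← comp_assoc, j2', X_comp]
  refine ⟨J₁.comp Mi, M.comp J₂, lin_comp hJ1 hMi, lin_comp hM hJ2, ?_, Mi, M, hMi, hM, m2, m1, ?_⟩
  · have : Mi.comp (T.comp J₁) = J₂.comp (T.comp M) := by rw [← g1, ← g3]
    have h5 : (M.comp (Mi.comp (T.comp J₁))).comp Mi = (M.comp (J₂.comp (T.comp M))).comp Mi := by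
      rw [this]
    rw [← comp_assoc M Mi, m1, X_comp] at h5
    simp only [comp_assoc, m1, comp_X] at h5
    simpa only [comp_assoc] using h5
  · rw [comp_assoc, comp_assoc, m2, comp_X]; exact g1

lemma linConj_trans {f g h : K[X]} (h1 : LinConj f g) (h2 : LinConj g h) : LinConj f h := by
  obtain ⟨l, li, a1, a2, a3, a4, rfl⟩ := h1
  obtain ⟨k, ki, b1, b2, b3, b4, rfl⟩ := h2
  refine ⟨l.comp k, ki.comp li, lin_comp a1 b1, lin_comp b2 a2, ?_, ?_, ?_⟩
  · rw [comp_assoc, ← comp_assoc k, b3, X_comp, a3]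
  · rw [comp_assoc, ← comp_assoc li, a4, X_comp, b4]
  · simp only [comp_assoc]

/-- A conjugate of `s T` is equivalent to `T`. -/
lemma equiv_of_linConj {g T : K[X]} {s : K} (hs : s ≠ 0) (h : LinConj g (C s * T)) :
    ∃ L₁ L₂ : K[X], L₁.degree = 1 ∧ L₂.degree = 1 ∧ L₂.comp (g.comp L₁) = T := by
  obtain ⟨l, li, a1, a2, a3, a4, rfl⟩ := h
  have hd : (C s⁻¹ * X : K[X]).degree = 1 := degree_C_mul_X (inv_ne_zero hs)
  refine ⟨l, (C s⁻¹ * X).comp li, a1, lin_comp hd a2, ?_⟩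
  rw [comp_assoc, comp_assoc, comp_assoc, ← comp_assoc li, a4, X_comp, comp_X,
    mul_comp, C_comp, X_comp, ← mul_assoc, ← C_mul, inv_mul_cancel₀ hs, C_1, one_mul]

/-- A linear symmetry of a centered polynomial has no translation part. -/
lemma lin_sym {T E : K[X]} {n : ℕ} (hT : T = X ^ (n + 2) + E) (hE : E.natDegree ≤ n)
    {b c u v : K} (hb : b ≠ 0)
    (h : T.comp (C b * X + C c) = (C u * X + C v).comp T) : c = 0 := by
  have hd : (C b * X + C c : K[X]).natDegree = 1 := natDegree_linear hb
  have e : (C b * X + C c : K[X]) ^ (n + 2) = C (b ^ (n + 2)) * (X + C (c / b)) ^ (n + 2) := by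
    rw [C_pow, ← mul_pow, mul_add, ← C_mul, mul_div_cancel₀ _ hb]
  have h1 := congrArg (fun p => coeff p (n + 1)) h
  simp only [hT, add_comp, pow_comp, X_comp, mul_comp, C_comp, e, coeff_add, coeff_C_mul,
    coeff_X_add_C_pow, coeff_X_pow, coeff_C] at h1
  rw [coeff_eq_zero_of_natDegree_lt (p := E.comp _)
    (by rw [natDegree_comp, hd]; omega), coeff_eq_zero_of_natDegree_lt (p := E) (by omega)] at h1
  have e2 : n + 2 - (n + 1) = 1 := by omega
  have e3 : (n + 2).choose (n + 1) = n + 2 := Nat.choose_succ_self_right (n + 1)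
  rw [e2, e3] at h1
  simp at h1
  rcases h1 with h1 | (h1 | h1) | h1
  · exact absurd h1 hb
  · exact h1
  · exact absurd h1 hb
  · exfalso; exact absurd h1 (by exact_mod_cast Nat.succ_ne_zero (n + 1))

lemma cheb_form (n : ℕ) : ∃ E : K[X], cheb K (n + 2) = X ^ (n + 2) + E ∧ E.natDegree ≤ n ∧
    E.coeff n = -((n : K) + 2) := by
  induction n using Nat.twoStepInduction with
  | zero =>
    refine ⟨C (-2), ?_, by simp, by simp⟩
    rw [cheb, dickson_two, C_neg, show (C 2 : K[X]) = 2 from map_ofNat C 2]; simp; ring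
  | one =>
    refine ⟨C (-3) * X, ?_, (natDegree_C_mul_le _ _).trans natDegree_X_le, by simp; norm_num⟩
    rw [cheb, show 1 + 2 = 1 + 2 from rfl, dickson_add_two, dickson_two, dickson_one]
    rw [C_neg, show (C 3 : K[X]) = 3 from map_ofNat C 3]; simp; ring
  | more n ih1 ih2 =>
    obtain ⟨E, hE, hd, hc⟩ := ih1
    obtain ⟨F, hF, hd', hc'⟩ := ih2
    refine ⟨X * F - X ^ (n + 2) - E, ?_, ?_, ?_⟩
    · rw [cheb] at *
      rw [dickson_add_two, hE, show n + 2 + 1 = n + 1 + 2 from rfl, hF]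
      simp; ring
    · refine (natDegree_sub_le _ _).trans (max_le ((natDegree_sub_le _ _).trans (max_le ?_ ?_)) ?_)
      · refine natDegree_mul_le.trans ?_
        rw [natDegree_X]; omega
      · simp
      · omega
    · rw [coeff_sub, coeff_sub, coeff_X_pow, if_pos rfl, show n + 2 = n + 1 + 1 from rfl,
        coeff_X_mul, hc', coeff_eq_zero_of_natDegree_lt (p := E) (by omega)]
      push_cast; ring

lemma cheb_natDegree (n : ℕ) : (cheb K (n + 2)).natDegree = n + 2 := by
  obtain ⟨E, hE, hd, -⟩ := cheb_form (K := K) n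
  rw [hE, natDegree_add_eq_left_of_natDegree_lt] <;> simp; omega

lemma cheb_sym {n : ℕ} (hn : 1 ≤ n) {b m : K[X]} (hb : b.degree = 1) (hm : m.degree = 1)
    (h : (cheb K (n + 2)).comp b = m.comp (cheb K (n + 2))) : b = X ∨ b = -X := by
  obtain ⟨E, hE, hd, hc⟩ := cheb_form (K := K) n
  obtain ⟨a, c, ha, rfl⟩ := lin_form hb
  obtain ⟨u, v, hu, rfl⟩ := lin_form hm
  obtain rfl := lin_sym hE hd ha h
  rw [C_0, add_zero] at h ⊢
  have c2 : (cheb K (n + 2)).coeff (n + 2) = 1 := by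
    rw [hE, coeff_add, coeff_X_pow, if_pos rfl, coeff_eq_zero_of_natDegree_lt (by omega), add_zero]
  have c0 : (cheb K (n + 2)).coeff n = -((n : K) + 2) := by
    rw [hE, coeff_add, coeff_X_pow, if_neg (by omega), zero_add, hc]
  have k2 := congrArg (fun p => coeff p (n + 2)) h
  have k0 := congrArg (fun p => coeff p n) h
  simp only [comp_C_mul_X_coeff, add_comp, mul_comp, C_comp, X_comp, coeff_add, coeff_C_mul, c2,
    c0, coeff_C] at k2 k0
  rw [if_neg (by omega)] at k2 k0
  have hn2 : (n : K) + 2 ≠ 0 := by exact_mod_cast Nat.succ_ne_zero (n + 1)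
  have k3 : a ^ n = u := by
    apply mul_left_cancel₀ (neg_ne_zero.2 hn2)
    rw [k0]; ring
  have k4 : a ^ n * a ^ 2 = a ^ n * 1 := by
    rw [← pow_add]; rw [one_mul] at k2; rw [k2, k3]; ring
  have k5 := mul_left_cancel₀ (pow_ne_zero _ ha) k4
  rcases eq_or_eq_neg_of_sq_eq_sq a 1 (by rw [k5, one_pow]) with rfl | rfl
  · left; simp
  · right; simp

lemma cheb_neg (n : ℕ) : (cheb K n).comp (-X) = C ((-1) ^ n) * cheb K n := by
  induction n using Nat.twoStepInduction with
  | zero => simp [cheb]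
  | one => simp [cheb]
  | more n ih1 ih2 =>
    unfold cheb at *
    rw [dickson_add_two, sub_comp, mul_comp, mul_comp, ih1, ih2, X_comp]
    simp only [C_1, one_comp, pow_succ, C_mul, C_neg]
    ring

/-- If `g ∘ g` is dihedral and `deg g ≥ 3` then `g` is conjugate to `± T`. -/
lemma cheb_square {g L₁ L₂ : K[X]} (hg : 3 ≤ g.natDegree)
    (h1 : L₁.degree = 1) (h2 : L₂.degree = 1)
    (h : L₂.comp ((g.comp g).comp L₁) = cheb K (g.natDegree ^ 2)) :
    ∃ s : K, (s = 1 ∨ s = -1) ∧ LinConj g (C s * cheb K g.natDegree) := by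
  obtain ⟨n, hn⟩ : ∃ n, g.natDegree = n + 2 := ⟨g.natDegree - 2, by omega⟩
  have h' : L₂.comp ((g.comp g).comp L₁) = (cheb K (n + 2)).comp (cheb K (n + 2)) := by
    rw [h, hn, sq]; exact dickson_one_one_mul _ _ _
  obtain ⟨b, m, hb, hm, hbm, hc⟩ := square_struct (by omega) (by rw [hn, cheb_natDegree]) h1 h2 h'
  rw [hn]
  rcases cheb_sym (by omega) hb hm hbm with rfl | rfl
  · exact ⟨1, Or.inl rfl, by simpa using hc⟩
  · rw [cheb_neg] at hc
    exact ⟨_, neg_one_pow_eq_or K (n + 2), hc⟩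

lemma pow_square [IsAlgClosed K] {g L₁ L₂ : K[X]} (hg : 2 ≤ g.natDegree)
    (h1 : L₁.degree = 1) (h2 : L₂.degree = 1)
    (h : L₂.comp ((g.comp g).comp L₁) = X ^ (g.natDegree ^ 2)) :
    LinConj g (X ^ g.natDegree) := by
  obtain ⟨n, hn⟩ : ∃ n, g.natDegree = n + 2 := ⟨g.natDegree - 2, by omega⟩
  have h' : L₂.comp ((g.comp g).comp L₁) = (X ^ (n + 2) : K[X]).comp (X ^ (n + 2)) := by
    rw [h, hn, sq, pow_comp, X_comp, ← pow_mul]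
  obtain ⟨b, m, hb, hm, hbm, hc⟩ := square_struct (by omega) (by rw [hn, natDegree_X_pow]) h1 h2 h'
  obtain ⟨a, c, ha, rfl⟩ := lin_form hb
  obtain ⟨u, v, hu, rfl⟩ := lin_form hm
  obtain rfl := lin_sym (E := 0) (n := n) (by simp) (by simp) ha hbm
  rw [hn]
  refine linConj_trans hc ?_
  obtain ⟨w, hw⟩ := IsAlgClosed.exists_pow_nat_eq (a ^ (n + 2)) (n := n + 1) (by omega)
  have hw0 : w ≠ 0 := by
    rintro rfl
    rw [zero_pow (by omega)] at hw
    exact pow_ne_zero _ ha hw.symm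
  refine ⟨C w⁻¹ * X, C w * X, degree_C_mul_X (inv_ne_zero hw0), degree_C_mul_X hw0, ?_, ?_, ?_⟩
  · simp [← mul_assoc, ← C_mul, hw0]
  · simp [← mul_assoc, ← C_mul, hw0]
  · simp only [pow_comp, X_comp, mul_comp, C_comp, C_0, add_zero, mul_pow, ← C_pow, ← hw,
      ← mul_assoc, ← C_mul]
    congr 2
    field_simp
    ring

/-- The quadratic case. -/
lemma quad_case {f : K[X]} (hf : f.natDegree = 2) {s : K} (hs : s = 1 ∨ s = -1)
    (h : LinConj (f.comp f) (C s * cheb K 4)) : LinConj f (C s * cheb K 2) := by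
  obtain ⟨l, li, a1, a2, a3, a4, h⟩ := h
  set t := li.comp (f.comp l) with ht
  have hft : f = l.comp (t.comp li) := by
    rw [ht, comp_assoc, comp_assoc, a3, comp_X, ← comp_assoc, a3, X_comp]
  refine ⟨l, li, a1, a2, a3, a4, ?_⟩
  suffices t = C s * cheb K 2 by rw [← this]; exact hft
  have htt : t.comp t = C s * cheb K 4 := by
    have : t.comp t = li.comp ((f.comp f).comp l) := by
      rw [ht]; simp only [comp_assoc]; rw [← comp_assoc l li, a3, X_comp]
    rw [this, h]
    simp only [comp_assoc]
    rw [← comp_assoc li l, a4, X_comp, comp_X]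
  have htd : t.natDegree = 2 := by
    rw [ht, natDegree_comp, natDegree_comp, lin_natDegree a1, lin_natDegree a2, hf]
  obtain ⟨a, b, c, ha, htq⟩ : ∃ a b c : K, a ≠ 0 ∧ t = C a * X ^ 2 + C b * X + C c := by
    refine ⟨t.coeff 2, t.coeff 1, t.coeff 0, ?_, ?_⟩
    · rw [← htd, coeff_natDegree, Ne, leadingCoeff_eq_zero]; intro h0; simp [h0] at htd
    · conv_lhs => rw [as_sum_range_C_mul_X_pow t, htd]
      simp [Finset.sum_range_succ]; ring
  have c2 : cheb K 2 = X ^ 2 - C 2 := by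
    rw [cheb, dickson_two, show (C 2 : K[X]) = 2 from map_ofNat C 2]; simp; norm_num
  have c4 : cheb K 4 = X ^ 4 - C 4 * X ^ 2 + C 2 := by
    have : cheb K 4 = (cheb K 2).comp (cheb K 2) := by
      exact dickson_one_one_mul K 2 2
    rw [this, c2]; simp
    have : (C 4 : K[X]) = C 2 * C 2 := by rw [← C_mul]; norm_num
    simp only [this, map_ofNat]; ring
  have ex : t.comp t = C (a ^ 3) * X ^ 4 + C (2 * a ^ 2 * b) * X ^ 3
      + C (a * b ^ 2 + 2 * a ^ 2 * c + a * b) * X ^ 2 + C (2 * a * b * c + b ^ 2) * X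
      + C (a * c ^ 2 + b * c + c) := by
    rw [htq]
    simp only [add_comp, mul_comp, C_comp, pow_comp, X_comp, C_add, C_mul, C_pow, map_ofNat]
    ring
  rw [c4, ex] at htt
  have k4 := congrArg (fun p => coeff p 4) htt
  have k3 := congrArg (fun p => coeff p 3) htt
  have k2 := congrArg (fun p => coeff p 2) htt
  have k0 := congrArg (fun p => coeff p 0) htt
  simp only [coeff_add, coeff_sub, coeff_C_mul, coeff_X_pow, coeff_X, coeff_C] at k4 k3 k2 k0
  norm_num at k4 k3 k2 k0
  have hb : b = 0 := by
    rcases k3 with k3 | k3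
    · exact absurd k3 ha
    · exact k3
  subst hb
  have hs2 : s ^ 2 = 1 := by rcases hs with rfl | rfl <;> norm_num
  have hc : c = -2 * a := by
    apply mul_left_cancel₀ (mul_ne_zero two_ne_zero (pow_ne_zero 2 ha))
    linear_combination k2 + 4 * k4
  subst hc
  have ha2 : a ^ 2 = 1 := by
    apply mul_left_cancel₀ (mul_ne_zero two_ne_zero ha)
    linear_combination k0 - 2 * k4
  have has : a = s := by
    linear_combination k4 - a * ha2
  subst has
  rw [htq, c2]
  simp; ring

end FourthIter

/-- If `f` is disintegrated of degree `δ`, then `f^{∘4}` is neither cyclic nor dihedral: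
it is not equivalent to `x^{δ⁴}` and not equivalent to `T_{δ⁴}(x)`. -/
theorem fourth_iterate_not_cyclic_nor_dihedral
    {K : Type*} [Field K] [IsAlgClosed K] [CharZero K]
    (f : K[X]) (hf : Disintegrated f) :
    (¬ ∃ L₁ L₂ : K[X], L₁.degree = 1 ∧ L₂.degree = 1 ∧
        L₂.comp ((polyIter f 4).comp L₁) = (X : K[X]) ^ (f.natDegree ^ 4)) ∧
    (¬ ∃ L₁ L₂ : K[X], L₁.degree = 1 ∧ L₂.degree = 1 ∧
        L₂.comp ((polyIter f 4).comp L₁) = cheb K (f.natDegree ^ 4)) := by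
  obtain ⟨hd, hx, ht, hnt⟩ := hf
  have hit : polyIter f 4 = (f.comp f).comp (f.comp f) := by
    simp [polyIter, comp_assoc]
  have hff : (f.comp f).natDegree = f.natDegree ^ 2 := by rw [natDegree_comp, sq]
  have h4 : f.natDegree ^ 4 = (f.natDegree ^ 2) ^ 2 := by rw [← pow_mul]
  have hge : 4 ≤ f.natDegree ^ 2 := by nlinarith
  rw [hit, h4, ← hff]
  constructor
  · rintro ⟨L₁, L₂, h1, h2, h⟩
    have c := FourthIter.pow_square (by omega) h1 h2 h
    obtain ⟨M₁, M₂, m1, m2, m⟩ := FourthIter.equiv_of_linConj (s := (1 : K))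
      (T := X ^ (f.comp f).natDegree) one_ne_zero
      (by simpa using c)
    rw [hff] at m
    exact hx (FourthIter.pow_square hd m1 m2 m)
  · rintro ⟨L₁, L₂, h1, h2, h⟩
    obtain ⟨s, hs, c⟩ := FourthIter.cheb_square (by omega) h1 h2 h
    have hs0 : s ≠ 0 := by rcases hs with rfl | rfl <;> norm_num
    have fin : ∃ s : K, (s = 1 ∨ s = -1) ∧ LinConj f (C s * cheb K f.natDegree) := by
      rcases hd.lt_or_eq with h3 | h3
      · obtain ⟨M₁, M₂, m1, m2, m⟩ := FourthIter.equiv_of_linConj hs0 c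
        rw [hff] at m
        exact FourthIter.cheb_square h3 m1 m2 m
      · rw [hff, ← h3] at c
        rw [← h3]
        exact ⟨s, hs, FourthIter.quad_case h3.symm hs c⟩
    obtain ⟨r, rfl | rfl, hr⟩ := fin
    · exact ht (by simpa using hr)
    · exact hnt (by simpa using hr)
end

section
/- Let K be an algebraically closed field of characteristic 0 and let A ∈ K[x] have degree δ ≥ 2. Suppose A is equivalent to a polynomial of the form x^s P(x^n) where s > 0, n ≥ 2, and P ∈ K[x] is non-constant with P(0) ≠ 0. Then A is not cyclic, i.e., A is not equivalent to x^δ. -/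
open Polynomial

lemma exists_eq_of_degree_one {K : Type*} [Field K] (L : K[X]) (h : L.degree = 1) :
    ∃ a b : K, a ≠ 0 ∧ L = C a * X + C b := by
  refine ⟨L.coeff 1, L.coeff 0, ?_, eq_X_add_C_of_degree_le_one h.le⟩
  exact coeff_ne_zero_of_eq_degree (by simpa using h)

lemma core {K : Type*} [Field K] [CharZero K] (P : K[X]) (s n d : ℕ)
    (hs : 0 < s) (hn : 2 ≤ n) (hP : 0 < P.natDegree) (hP0 : P.eval 0 ≠ 0)
    (hd : 2 ≤ d) (u c v : K) (hu : u ≠ 0)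
    (h : (X : K[X]) ^ s * P.comp ((X : K[X]) ^ n) = C u * (X + C c) ^ d + C v) : False := by
  have hPne : P ≠ 0 := by rintro rfl; simp at hP
  rw [← expand_eq_comp_X_pow] at h
  have hn0 : 0 < n := by omega
  have hE : expand K n P ≠ 0 := (expand_ne_zero hn0).2 hPne
  have hdeg : s + P.natDegree * n = d := by
    have h1 := congrArg natDegree h
    rw [natDegree_add_C, natDegree_C_mul hu, natDegree_pow, natDegree_X_add_C,
      natDegree_X_pow_mul s hE, natDegree_expand] at h1
    omega
  have hsd : s + 2 ≤ d := by nlinarith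
  have hco : ∀ k, k ≠ 0 → ((X : K[X]) ^ s * expand K n P).coeff k
      = u * (c ^ (d - k) * (d.choose k : K)) := by
    intro k hk
    rw [h, coeff_add, coeff_C_mul, coeff_X_add_C_pow, coeff_C, if_neg hk, add_zero]
  have hc : c = 0 := by
    have h1 := hco (d - 1) (by omega)
    rw [coeff_X_pow_mul', if_pos (by omega), coeff_expand hn0, if_neg] at h1
    · have e : d - (d - 1) = 1 := by omega
      have e2 : d.choose (d - 1) = d := by
        rw [Nat.choose_symm (by omega : 1 ≤ d), Nat.choose_one_right]
      have hd0 : (d : K) ≠ 0 := by exact_mod_cast (by omega : d ≠ 0)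
      rw [e, e2] at h1
      simpa [hu, hd0] using h1.symm
    · intro hdvd
      have h2 : n ∣ d - s := ⟨P.natDegree, by rw [← hdeg, mul_comm]; omega⟩
      have h3 := Nat.dvd_sub h2 hdvd
      have h4 : d - s - (d - 1 - s) = 1 := by omega
      rw [h4] at h3
      have := Nat.le_of_dvd one_pos h3
      omega
  have h1 := hco s (by omega)
  rw [coeff_X_pow_mul', if_pos le_rfl, coeff_expand hn0, hc, zero_pow (by omega)] at h1
  apply hP0
  rw [← coeff_zero_eq_eval_zero]
  simpa using h1

/-- If `A` of degree `δ ≥ 2` is equivalent to `x^s P(xⁿ)` with `s > 0`, `n ≥ 2` and `P`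
non-constant with `P(0) ≠ 0`, then `A` is not cyclic, i.e. not equivalent to `x^δ`. -/
theorem not_cyclic_of_equiv_xsPxn {K : Type*} [Field K] [IsAlgClosed K] [CharZero K]
    (A P : K[X]) (s n : ℕ) (hA : 2 ≤ A.natDegree)
    (hs : 0 < s) (hn : 2 ≤ n) (hP : 0 < P.natDegree) (hP0 : P.eval 0 ≠ 0)
    (h : ∃ L₁ L₂ : K[X], L₁.degree = 1 ∧ L₂.degree = 1 ∧
      L₂.comp (A.comp L₁) = (X : K[X]) ^ s * P.comp ((X : K[X]) ^ n)) :
    ¬ ∃ L₁ L₂ : K[X], L₁.degree = 1 ∧ L₂.degree = 1 ∧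
      L₂.comp (A.comp L₁) = (X : K[X]) ^ A.natDegree := by
  rintro ⟨M₁, M₂, hM₁, hM₂, hM⟩
  obtain ⟨L₁, L₂, hL₁, hL₂, hL⟩ := h
  obtain ⟨p, q, hp, rfl⟩ := exists_eq_of_degree_one M₁ hM₁
  obtain ⟨m, m0, hm, rfl⟩ := exists_eq_of_degree_one M₂ hM₂
  obtain ⟨a, b, ha, rfl⟩ := exists_eq_of_degree_one L₁ hL₁
  obtain ⟨l, l0, hl, rfl⟩ := exists_eq_of_degree_one L₂ hL₂
  generalize A.natDegree = d at *
  -- compose the second identity with `(L₁ - q) / p`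
  have h1 := congrArg (fun f => f.comp (C (a / p) * (X + C ((b - q) / a)))) hM
  have h2 : (C p * X + C q).comp (C (a / p) * (X + C ((b - q) / a))) = C a * X + C b := by
    simp only [add_comp, mul_comp, C_comp, X_comp]
    have e1 : p * (a / p) = a := by field_simp
    have e2 : a * ((b - q) / a) + q = b := by field_simp; ring
    rw [← mul_assoc, ← C_mul, e1, mul_add, add_assoc, ← C_mul, ← C_add, e2]
  simp only [comp_assoc] at h1
  rw [h2] at h1
  simp only [add_comp, mul_comp, C_comp, X_comp, X_pow_comp] at h1 hL
  rw [mul_pow, ← C_pow] at h1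
  refine core P s n d hs hn hP hP0 hA (l / m * (a / p) ^ d) ((b - q) / a) (l0 - l / m * m0)
    (mul_ne_zero (div_ne_zero hl hm) (pow_ne_zero _ (div_ne_zero ha hp))) ?_
  rw [← hL, C_mul, mul_assoc, ← h1, C_sub, C_mul, mul_add, ← mul_assoc, ← C_mul,
    div_mul_cancel₀ _ hm]
  ring
end
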